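/- arXiv:2512.10827 — 2 statements merged into one kernel-verified Lean document; each statement's English description precedes it below -/
import Mathlib

section
/- Let G be a finite simple vdec graph (at most one isolated vertex and no isolated edge). Then the vertex-distinguishing chromatic index of G satisfies χ'_vd(G) ≤ ⌊5.5·k(G) + 6.5⌋ (equivalently, χ'_vd(G) ≤ ⌊(11·k(G) + 13)/2⌋). -/
/-- `φ` is a proper edge-`k`-coloring of `G`: every edge gets a color in `{1,…,k}` and
adjacent (distinct, sharing a vertex) edges get different colors. -/
def IsEdgeKColoring {V : Type*} (G : SimpleGraph V) (k : ℕ) (φ : Sym2 V → ℕ) : Prop :=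
  (∀ e ∈ G.edgeSet, φ e ∈ Finset.Icc 1 k) ∧
  ∀ e₁ ∈ G.edgeSet, ∀ e₂ ∈ G.edgeSet, e₁ ≠ e₂ → (∃ v : V, v ∈ e₁ ∧ v ∈ e₂) → φ e₁ ≠ φ e₂

/-- The color-set of a vertex `v`: the set of colors appearing on edges incident with `v`. -/
def colorSet {V : Type*} (G : SimpleGraph V) (φ : Sym2 V → ℕ) (v : V) : Set ℕ :=
  {c | ∃ e ∈ G.edgeSet, v ∈ e ∧ φ e = c}

/-- A vertex-distinguishing edge-`k`-coloring. -/
def IsVDEC {V : Type*} (G : SimpleGraph V) (k : ℕ) (φ : Sym2 V → ℕ) : Prop :=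
  IsEdgeKColoring G k φ ∧ ∀ u v : V, u ≠ v → colorSet G φ u ≠ colorSet G φ v

/-- The vertex-distinguishing chromatic index: the least `k` admitting a `k`-vdec. -/
noncomputable def vdIndex {V : Type*} (G : SimpleGraph V) : ℕ :=
  sInf {k | ∃ φ : Sym2 V → ℕ, IsVDEC G k φ}

/-- `k(G)`: the least `k` such that `C(k,d) ≥ n_d` for every `d ∈ [δ(G), Δ(G)]`,
where `n_d` is the number of vertices of degree `d`. -/
noncomputable def paramK {V : Type*} [Fintype V] (G : SimpleGraph V) [DecidableRel G.Adj] : ℕ :=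
  sInf {k | ∀ d : ℕ, G.minDegree ≤ d → d ≤ G.maxDegree →
    (Finset.univ.filter (fun v => G.degree v = d)).card ≤ k.choose d}

/-- A graph is vdec if it has at most one isolated vertex and no isolated edge. -/
def IsVdecGraph {V : Type*} [Fintype V] (G : SimpleGraph V) [DecidableRel G.Adj] : Prop :=
  {v : V | G.degree v = 0}.Subsingleton ∧
  ¬ ∃ u v : V, G.Adj u v ∧ G.degree u = 1 ∧ G.degree v = 1

section Counting

open Finset

variable {V E : Type*} [DecidableEq E]

/-- The restriction of a (zero-padded) partial coloring to the set `F`. -/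
def restrictTo {K : ℕ} (F : Finset E) (φ : E → Fin (K + 1)) : E → Fin (K + 1) :=
  fun e => if e ∈ F then φ e else 0

lemma restrictTo_of_mem {K : ℕ} {F : Finset E} {φ : E → Fin (K + 1)} {e : E} (h : e ∈ F) :
    restrictTo F φ e = φ e := if_pos h

lemma restrictTo_restrictTo {K : ℕ} {F F' : Finset E} (h : F' ⊆ F) (φ : E → Fin (K + 1)) :
    restrictTo F' (restrictTo F φ) = restrictTo F' φ := by
  funext e
  by_cases he : e ∈ F'
  · simp [restrictTo, he, h he]
  · simp [restrictTo, he]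

lemma image_restrictTo {K : ℕ} {F A : Finset E} (h : A ⊆ F) (φ : E → Fin (K + 1)) :
    A.image (restrictTo F φ) = A.image φ :=
  image_congr fun _ he => restrictTo_of_mem (h he)

/-- `φ` colors exactly the elements of `F` (with nonzero colors), properly with respect to the
incidence sets `inc v`, and separates any two vertices whose incidence sets are fully colored. -/
structure IsGoodPartial (inc : V → Finset E) {K : ℕ} (F : Finset E) (φ : E → Fin (K + 1)) :
    Prop where
  support : ∀ e, φ e ≠ 0 ↔ e ∈ F
  injOn : ∀ v, Set.InjOn φ ↑(inc v ∩ F)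
  separates : ∀ u w, u ≠ w → inc u ⊆ F → inc w ⊆ F → (inc u).image φ ≠ (inc w).image φ

lemma IsGoodPartial.restrictTo {inc : V → Finset E} {K : ℕ} {F F' : Finset E}
    {φ : E → Fin (K + 1)} (h : IsGoodPartial inc F φ) (hF : F' ⊆ F) :
    IsGoodPartial inc F' (restrictTo F' φ) where
  support e := by
    by_cases he : e ∈ F'
    · simpa [restrictTo_of_mem he, he] using (h.support e).2 (hF he)
    · simp [_root_.restrictTo, he]
  injOn v a ha b hb hab := by
    have ha' := mem_inter.1 (mem_coe.1 ha)
    have hb' := mem_inter.1 (mem_coe.1 hb)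
    rw [restrictTo_of_mem ha'.2, restrictTo_of_mem hb'.2] at hab
    exact h.injOn v (mem_coe.2 (mem_inter.2 ⟨ha'.1, hF ha'.2⟩))
      (mem_coe.2 (mem_inter.2 ⟨hb'.1, hF hb'.2⟩)) hab
  separates u w huw hu hw := by
    rw [image_restrictTo hu, image_restrictTo hw]
    exact h.separates u w huw (hu.trans hF) (hw.trans hF)

variable [Fintype E]

open Classical in
/-- The finite set of good partial colorings of `F` with `K` colors. -/
noncomputable def goodPartials (inc : V → Finset E) (K : ℕ) (F : Finset E) :
    Finset (E → Fin (K + 1)) :=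
  univ.filter (IsGoodPartial inc F)

lemma mem_goodPartials {inc : V → Finset E} {K : ℕ} {F : Finset E} {φ : E → Fin (K + 1)} :
    φ ∈ goodPartials inc K F ↔ IsGoodPartial inc F φ := by
  simp [goodPartials]

lemma pow_mul_card_goodPartials_le {inc : V → Finset E} {K m : ℕ} {F : Finset E}
    (ih : ∀ F' ⊆ F, ∀ e ∈ F',
      m * #(goodPartials inc K (F'.erase e)) ≤ #(goodPartials inc K F'))
    {D : Finset E} (hD : D ⊆ F) :
    m ^ #D * #(goodPartials inc K (F \ D)) ≤ #(goodPartials inc K F) := by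
  induction D using Finset.induction_on with
  | empty => simp
  | insert a D ha hind =>
    rw [insert_subset_iff] at hD
    have hstep := ih (F \ D) sdiff_subset a (mem_sdiff.2 ⟨hD.1, ha⟩)
    rw [card_insert_of_notMem ha, pow_succ, mul_assoc, sdiff_insert]
    exact (Nat.mul_le_mul_left _ hstep).trans (hind hD.2)

/-- Colorings in which the colors on `D ⊆ A` are forced, up to a permutation, by the colors on
`F`. -/
lemma card_le_factorial_mul_card_goodPartials {inc : V → Finset E} {K : ℕ}
    {X : Finset (E → Fin (K + 1))} {F A A' D : Finset E} (hDA : D ⊆ A) (hAD : A \ D ⊆ F)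
    (hA' : A' ⊆ F) (hinj : ∀ φ ∈ X, Set.InjOn φ A) (himg : ∀ φ ∈ X, A.image φ = A'.image φ)
    (hres : ∀ φ ∈ X, restrictTo F φ ∈ goodPartials inc K F)
    (hzero : ∀ φ ∈ X, ∀ e ∉ F, e ∉ D → φ e = 0) :
    #X ≤ (#D).factorial * #(goodPartials inc K F) := by
  classical
  refine card_le_mul_card_image_of_maps_to hres _ fun ψ _ => ?_
  set Y := X.filter fun φ => restrictTo F φ = ψ with hY
  set T := A'.image ψ \ (A \ D).image ψ with hT
  have himgD : ∀ φ ∈ Y, D.image φ = T := by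
    intro φ hφ
    obtain ⟨hφX, rfl⟩ := mem_filter.1 hφ
    rw [hT, image_restrictTo hA', image_restrictTo hAD, ← himg φ hφX,
      ← image_sdiff_of_injOn (hinj φ hφX) sdiff_subset, Finset.sdiff_sdiff_eq_self hDA]
  have hinjD : ∀ φ ∈ Y, Set.InjOn φ D := fun φ hφ =>
    (hinj φ (mem_filter.1 hφ).1).mono (coe_subset.2 hDA)
  rcases Y.eq_empty_or_nonempty with hempty | ⟨φ₀, hφ₀⟩
  · simp [hempty]
  have hTcard : #T = #D := by rw [← himgD φ₀ hφ₀, card_image_of_injOn (hinjD φ₀ hφ₀)]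
  let g : Y → (D ↪ T) := fun φ =>
    ⟨fun e => ⟨φ.1 e, himgD φ.1 φ.2 ▸ mem_image_of_mem _ e.2⟩, fun a b hab =>
      Subtype.ext (hinjD φ.1 φ.2 a.2 b.2 (Subtype.ext_iff.1 hab))⟩
  have hg : Function.Injective g := by
    intro φ χ hφχ
    apply Subtype.ext
    funext e
    obtain ⟨hφX, hφ⟩ := mem_filter.1 φ.2
    obtain ⟨hχX, hχ⟩ := mem_filter.1 χ.2
    by_cases heF : e ∈ F
    · have := congrFun (hφ.trans hχ.symm) e
      rwa [restrictTo_of_mem heF, restrictTo_of_mem heF] at this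
    by_cases heD : e ∈ D
    · exact Subtype.ext_iff.1 (DFunLike.congr_fun hφχ ⟨e, heD⟩)
    · rw [hzero _ hφX e heF heD, hzero _ hχX e heF heD]
  have := Fintype.card_le_of_injective g hg
  rwa [Fintype.card_embedding_eq, Fintype.card_coe, Fintype.card_coe, Fintype.card_coe, hTcard,
    Nat.descFactorial_self] at this

/-- Extensions by one further element `e`, whose color is confined to a set of size at most `m`. -/
lemma card_le_mul_card_of_extends {K m : ℕ} {Y Z : Finset (E → Fin (K + 1))} {F : Finset E}
    {e : E} (C : (E → Fin (K + 1)) → Finset (Fin (K + 1)))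
    (hres : ∀ φ ∈ Y, restrictTo F φ ∈ Z) (hC : ∀ φ ∈ Y, φ e ∈ C (restrictTo F φ))
    (hcard : ∀ ψ ∈ Z, #(C ψ) ≤ m) (hzero : ∀ φ ∈ Y, ∀ f ∉ F, f ≠ e → φ f = 0) :
    #Y ≤ m * #Z := by
  classical
  refine card_le_mul_card_image_of_maps_to hres _ fun ψ hψ => ?_
  refine (card_le_card_of_injOn (fun φ => φ e) ?_ ?_).trans (hcard ψ hψ)
  · intro φ hφ
    obtain ⟨hφY, rfl⟩ := mem_filter.1 (mem_coe.1 hφ)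
    exact mem_coe.2 (hC φ hφY)
  · intro φ hφ χ hχ hφχ
    obtain ⟨hφY, hφ'⟩ := mem_filter.1 (mem_coe.1 hφ)
    obtain ⟨hχY, hχ'⟩ := mem_filter.1 (mem_coe.1 hχ)
    funext f
    by_cases hfF : f ∈ F
    · have := congrFun (hφ'.trans hχ'.symm) f
      rwa [restrictTo_of_mem hfF, restrictTo_of_mem hfF] at this
    by_cases hfe : f = e
    · rw [hfe]; exact hφχ
    · rw [hzero φ hφY f hfF hfe, hzero χ hχY f hfF hfe]

open Classical in
/-- The extensions of the good partial colorings of `F.erase e` by an arbitrary color on `e`. -/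
noncomputable def extensions (inc : V → Finset E) (K : ℕ) (F : Finset E) (e : E) :
    Finset (E → Fin (K + 1)) :=
  univ.filter fun φ => IsGoodPartial inc (F.erase e) (restrictTo (F.erase e) φ) ∧
    ∀ f, φ f ≠ 0 ↔ f ∈ F

lemma mem_extensions {inc : V → Finset E} {K : ℕ} {F : Finset E} {e : E}
    {φ : E → Fin (K + 1)} : φ ∈ extensions inc K F e ↔
      IsGoodPartial inc (F.erase e) (restrictTo (F.erase e) φ) ∧ ∀ f, φ f ≠ 0 ↔ f ∈ F := by
  simp [extensions]

lemma mul_card_goodPartials_le_card_extensions {inc : V → Finset E} {K : ℕ} {F : Finset E} {e : E}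
    (he : e ∈ F) :
    K * #(goodPartials inc K (F.erase e)) ≤ #(extensions inc K F e) := by
  classical
  have hres : ∀ ψ ∈ goodPartials inc K (F.erase e), ∀ c,
      restrictTo (F.erase e) (Function.update ψ e c) = ψ := by
    intro ψ hψ c
    have hψ' := mem_goodPartials.1 hψ
    funext f
    by_cases hf : f ∈ F.erase e
    · rw [restrictTo_of_mem hf, Function.update_of_ne (ne_of_mem_erase hf)]
    · rw [restrictTo, if_neg hf]
      by_contra h0
      exact hf ((hψ'.support f).1 (Ne.symm h0))
  have hK : #((univ : Finset (Fin (K + 1))).erase 0) = K := by simp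
  have hprod : K * #(goodPartials inc K (F.erase e)) =
      #(goodPartials inc K (F.erase e) ×ˢ (univ : Finset (Fin (K + 1))).erase 0) := by
    rw [card_product, hK, mul_comm]
  rw [hprod]
  refine card_le_card_of_injOn (fun p => Function.update p.1 e p.2) ?_ ?_
  · rintro ⟨ψ, c⟩ hp
    obtain ⟨hψ, hc⟩ := mem_product.1 (mem_coe.1 hp)
    have hψ' := mem_goodPartials.1 hψ
    refine mem_coe.2 (mem_extensions.2 ⟨by rw [hres ψ hψ c]; exact hψ', fun f => ?_⟩)
    by_cases hf : f = e
    · subst hf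
      simpa [he] using hc
    · simp only [Function.update_of_ne hf]
      rw [hψ'.support f, mem_erase]
      simp [hf]
  · rintro ⟨ψ, c⟩ hp ⟨χ, c'⟩ hp' h
    have hψ := (mem_product.1 (mem_coe.1 hp)).1
    have hχ := (mem_product.1 (mem_coe.1 hp')).1
    dsimp only at h hψ hχ
    have h1 : ψ = χ := by rw [← hres ψ hψ c, ← hres χ hχ c', h]
    have h2 := congrFun h e
    simp only [Function.update_self] at h2
    rw [h1, h2]

open Classical in
/-- The proper extensions in which `x` and `w` are fully colored and have the same color set. -/
noncomputable def conflicts (inc : V → Finset E) (K : ℕ) (F : Finset E) (e : E) (x w : V) :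
    Finset (E → Fin (K + 1)) :=
  (extensions inc K F e).filter fun φ => (∀ v, Set.InjOn φ ↑(inc v ∩ F)) ∧ inc x ⊆ F ∧
    inc w ⊆ F ∧ (inc x).image φ = (inc w).image φ

lemma mem_conflicts {inc : V → Finset E} {K : ℕ} {F : Finset E} {e : E} {x w : V}
    {φ : E → Fin (K + 1)} : φ ∈ conflicts inc K F e x w ↔ φ ∈ extensions inc K F e ∧
      (∀ v, Set.InjOn φ ↑(inc v ∩ F)) ∧ inc x ⊆ F ∧ inc w ⊆ F ∧
        (inc x).image φ = (inc w).image φ := by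
  simp [conflicts]

lemma conflicts_comm (inc : V → Finset E) (K : ℕ) (F : Finset E) (e : E) (x w : V) :
    conflicts inc K F e x w = conflicts inc K F e w x := by
  ext φ
  simp only [mem_conflicts]
  tauto

lemma card_inc_eq_of_mem_conflicts {inc : V → Finset E} {K : ℕ} {F : Finset E} {e : E} {x w : V}
    {φ : E → Fin (K + 1)} (h : φ ∈ conflicts inc K F e x w) : #(inc x) = #(inc w) := by
  obtain ⟨-, hinj, hx, hw, himg⟩ := mem_conflicts.1 h
  have hx' := hinj x
  have hw' := hinj w
  rw [inter_eq_left.2 hx] at hx'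
  rw [inter_eq_left.2 hw] at hw'
  rw [← card_image_of_injOn hx', himg, card_image_of_injOn hw']

open Classical in
lemma card_improper_extensions_le {inc : V → Finset E} {K : ℕ} {F : Finset E} {e : E} {u v : V}
    (he : ∀ x, e ∈ inc x ↔ x = u ∨ x = v) :
    #((extensions inc K F e).filter fun φ => ¬ ∀ v, Set.InjOn φ ↑(inc v ∩ F)) ≤
      (#(inc u) - 1 + (#(inc v) - 1)) * #(goodPartials inc K (F.erase e)) := by
  refine card_le_mul_card_of_extends (F := F.erase e) (e := e)
    (fun ψ => ((inc u).erase e ∪ (inc v).erase e).image ψ) ?_ ?_ ?_ ?_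
  · intro φ hφ
    exact mem_goodPartials.2 (mem_extensions.1 (mem_filter.1 hφ).1).1
  · intro φ hφ
    obtain ⟨hext, hnot⟩ := mem_filter.1 hφ
    have hgood := (mem_extensions.1 hext).1
    have key : ∀ y, ∀ b ∈ inc y ∩ F, e ∈ inc y → b ≠ e → φ e = φ b →
        φ e ∈ ((inc u).erase e ∪ (inc v).erase e).image (restrictTo (F.erase e) φ) := by
      intro y b hb hy hbe heq
      obtain ⟨hby, hbF⟩ := mem_inter.1 hb
      refine mem_image.2 ⟨b, ?_, by rw [restrictTo_of_mem (mem_erase.2 ⟨hbe, hbF⟩), heq]⟩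
      rcases (he y).1 hy with rfl | rfl
      · exact mem_union_left _ (mem_erase.2 ⟨hbe, hby⟩)
      · exact mem_union_right _ (mem_erase.2 ⟨hbe, hby⟩)
    simp only [Set.InjOn, not_forall] at hnot
    obtain ⟨y, a, ha, b, hb, hab, hne⟩ := hnot
    rw [mem_coe] at ha hb
    obtain ⟨hay, haF⟩ := mem_inter.1 ha
    obtain ⟨hby, hbF⟩ := mem_inter.1 hb
    by_cases hae : a = e
    · subst hae
      exact key y b hb hay (Ne.symm hne) hab
    by_cases hbe : b = e
    · subst hbe
      exact key y a ha hby hne hab.symm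
    have ha' := mem_erase.2 ⟨hae, haF⟩
    have hb' := mem_erase.2 ⟨hbe, hbF⟩
    exact absurd (hgood.injOn y (mem_coe.2 (mem_inter.2 ⟨hay, ha'⟩))
      (mem_coe.2 (mem_inter.2 ⟨hby, hb'⟩))
      (by rw [restrictTo_of_mem ha', restrictTo_of_mem hb', hab])) hne
  · intro ψ _
    refine card_image_le.trans ((card_union_le _ _).trans ?_)
    rw [card_erase_of_mem ((he u).2 (Or.inl rfl)), card_erase_of_mem ((he v).2 (Or.inr rfl))]
  · intro φ hφ f hf hfe
    by_contra h0
    exact hf (mem_erase.2 ⟨hfe, ((mem_extensions.1 (mem_filter.1 hφ).1).2 f).1 h0⟩)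

lemma card_extensions_le [Fintype V] [DecidableEq V] {inc : V → Finset E} {K : ℕ} {F : Finset E}
    {e : E} {u v : V} (he : ∀ x, e ∈ inc x ↔ x = u ∨ x = v) :
    #(extensions inc K F e) ≤ #(goodPartials inc K F) +
      (#(inc u) - 1 + (#(inc v) - 1)) * #(goodPartials inc K (F.erase e)) +
      #(conflicts inc K F e u v) +
      ∑ w with #(inc w) = #(inc u) ∧ w ≠ u ∧ w ≠ v, #(conflicts inc K F e u w) +
      ∑ w with #(inc w) = #(inc v) ∧ w ≠ u ∧ w ≠ v, #(conflicts inc K F e v w) := by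
  classical
  set I := (extensions inc K F e).filter fun φ => ¬ ∀ v, Set.InjOn φ ↑(inc v ∩ F) with hI
  set U := (univ.filter fun w => #(inc w) = #(inc u) ∧ w ≠ u ∧ w ≠ v).biUnion
    (conflicts inc K F e u) with hU
  set W := (univ.filter fun w => #(inc w) = #(inc v) ∧ w ≠ u ∧ w ≠ v).biUnion
    (conflicts inc K F e v) with hW
  have hcover : extensions inc K F e ⊆
      (((goodPartials inc K F ∪ I) ∪ conflicts inc K F e u v) ∪ U) ∪ W := by
    intro φ hφ
    by_cases hproper : ∀ v, Set.InjOn φ ↑(inc v ∩ F)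
    swap
    · have : φ ∈ I := mem_filter.2 ⟨hφ, hproper⟩
      simp [this]
    by_cases hgood : IsGoodPartial inc F φ
    · simp [mem_goodPartials, hgood]
    have hφ' := mem_extensions.1 hφ
    have : ∃ x w, x ≠ w ∧ φ ∈ conflicts inc K F e x w := by
      by_contra! hno
      refine hgood ⟨hφ'.2, hproper, fun x w hxw hx hw himg => hno x w hxw ?_⟩
      exact mem_conflicts.2 ⟨hφ, hproper, hx, hw, himg⟩
    obtain ⟨x, w, hxw, hconf⟩ := this
    have hends : ∃ x w, x ≠ w ∧ (x = u ∨ x = v) ∧ φ ∈ conflicts inc K F e x w := by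
      by_cases hx : e ∈ inc x
      · exact ⟨x, w, hxw, (he x).1 hx, hconf⟩
      by_cases hw : e ∈ inc w
      · exact ⟨w, x, hxw.symm, (he w).1 hw, conflicts_comm inc K F e x w ▸ hconf⟩
      obtain ⟨-, -, hxF, hwF, himg⟩ := mem_conflicts.1 hconf
      have hx' : inc x ⊆ F.erase e := subset_erase.2 ⟨hxF, hx⟩
      have hw' : inc w ⊆ F.erase e := subset_erase.2 ⟨hwF, hw⟩
      exact absurd (by rw [image_restrictTo hx', image_restrictTo hw', himg])
        (hφ'.1.separates x w hxw hx' hw')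
    clear hconf hxw x w
    obtain ⟨x, w, hxw, hx, hconf⟩ := hends
    have hcard := card_inc_eq_of_mem_conflicts hconf
    rcases hx with rfl | rfl
    · by_cases hwv : w = v
      · subst hwv
        simp [hconf]
      · have : φ ∈ U := mem_biUnion.2 ⟨w, by simp [hcard, hxw.symm, hwv], hconf⟩
        simp [this]
    · by_cases hwu : w = u
      · subst hwu
        rw [conflicts_comm] at hconf
        simp [hconf]
      · have : φ ∈ W := mem_biUnion.2 ⟨w, by simp [hcard, hxw.symm, hwu], hconf⟩
        simp [this]
  have hIcard : #I ≤
      (#(inc u) - 1 + (#(inc v) - 1)) * #(goodPartials inc K (F.erase e)) := by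
    convert card_improper_extensions_le (K := K) (F := F) he
  have hUcard : #U ≤ _ := card_biUnion_le
  have hWcard : #W ≤ _ := card_biUnion_le
  refine (card_le_card hcover).trans ?_
  refine (card_union_le _ _).trans (add_le_add ?_ hWcard)
  refine (card_union_le _ _).trans (add_le_add ?_ hUcard)
  refine (card_union_le _ _).trans (add_le_add ?_ le_rfl)
  exact (card_union_le _ _).trans (add_le_add le_rfl hIcard)

lemma pow_mul_card_conflicts_le {inc : V → Finset E} {K m : ℕ} {F D : Finset E} {e : E} {x w : V}
    (ih : ∀ F' ⊆ F.erase e, ∀ f ∈ F',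
      m * #(goodPartials inc K (F'.erase f)) ≤ #(goodPartials inc K F'))
    (hD : D ⊆ inc x) (heD : e ∈ D) (hDw : Disjoint D (inc w)) :
    m ^ (#D - 1) * #(conflicts inc K F e x w) ≤
      (#D).factorial * #(goodPartials inc K (F.erase e)) := by
  rcases (conflicts inc K F e x w).eq_empty_or_nonempty with hempty | ⟨φ₀, hφ₀⟩
  · simp [hempty]
  obtain ⟨-, -, hx, hw, -⟩ := mem_conflicts.1 hφ₀
  have hFD : F \ D = F.erase e \ D.erase e := by
    ext f
    simp only [mem_sdiff, mem_erase]
    grind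
  have hsub : F \ D ⊆ F.erase e := hFD ▸ sdiff_subset
  have hcount : #(conflicts inc K F e x w) ≤
      (#D).factorial * #(goodPartials inc K (F \ D)) := by
    refine card_le_factorial_mul_card_goodPartials (A := inc x) (A' := inc w) hD
      (sdiff_subset_sdiff hx le_rfl) ?_ ?_ ?_ ?_ ?_
    · exact fun f hf => mem_sdiff.2 ⟨hw hf, fun hfD => disjoint_left.1 hDw hfD hf⟩
    · intro φ hφ
      have := (mem_conflicts.1 hφ).2.1 x
      rwa [inter_eq_left.2 hx] at this
    · exact fun φ hφ => (mem_conflicts.1 hφ).2.2.2.2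
    · intro φ hφ
      have := (mem_extensions.1 (mem_conflicts.1 hφ).1).1.restrictTo hsub
      rw [restrictTo_restrictTo hsub] at this
      exact mem_goodPartials.2 this
    · intro φ hφ f hf hfD
      by_contra h0
      exact hf (mem_sdiff.2 ⟨((mem_extensions.1 (mem_conflicts.1 hφ).1).2 f).1 h0, hfD⟩)
  have hchain := pow_mul_card_goodPartials_le ih (D := D.erase e)
    (erase_subset_erase e (hD.trans hx))
  rw [card_erase_of_mem heD, ← hFD] at hchain
  calc m ^ (#D - 1) * #(conflicts inc K F e x w)
      ≤ m ^ (#D - 1) * ((#D).factorial * #(goodPartials inc K (F \ D))) :=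
        Nat.mul_le_mul_left _ hcount
    _ = (#D).factorial * (m ^ (#D - 1) * #(goodPartials inc K (F \ D))) := by ring
    _ ≤ _ := Nat.mul_le_mul_left _ hchain

lemma pow_mul_card_conflicts_ends_le {inc : V → Finset E} {K m : ℕ} {F : Finset E} {e : E}
    {u v : V}
    (ih : ∀ F' ⊆ F.erase e, ∀ f ∈ F',
      m * #(goodPartials inc K (F'.erase f)) ≤ #(goodPartials inc K F'))
    (hu : e ∈ inc u) (hv : e ∈ inc v) (huv : Disjoint ((inc u).erase e) ((inc v).erase e)) :
    m ^ (#(inc u) - 1) * #(conflicts inc K F e u v) ≤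
      K * ((#(inc u) - 1).factorial * #(goodPartials inc K (F.erase e))) := by
  classical
  rcases (conflicts inc K F e u v).eq_empty_or_nonempty with hempty | ⟨φ₀, hφ₀⟩
  · simp [hempty]
  obtain ⟨-, -, huF, hvF, -⟩ := mem_conflicts.1 hφ₀
  have huF' := erase_subset_erase e huF
  have hvF' := erase_subset_erase e hvF
  set D := (inc u).erase e with hD
  set Z := (goodPartials inc K (F.erase e)).filter
    fun ψ => D.image ψ = ((inc v).erase e).image ψ with hZ
  have hDcard : #D = #(inc u) - 1 := card_erase_of_mem hu
  have hext : #(conflicts inc K F e u v) ≤ K * #Z := by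
    refine card_le_mul_card_of_extends (F := F.erase e) (e := e) (fun _ => univ.erase 0)
      ?_ ?_ ?_ ?_
    · intro φ hφ
      obtain ⟨hφe, hinj, -, -, himg⟩ := mem_conflicts.1 hφ
      refine mem_filter.2 ⟨mem_goodPartials.2 (mem_extensions.1 hφe).1, ?_⟩
      have hu' := hinj u
      have hv' := hinj v
      rw [inter_eq_left.2 huF] at hu'
      rw [inter_eq_left.2 hvF] at hv'
      rw [image_restrictTo huF', image_restrictTo hvF', hD, erase_eq, erase_eq,
        image_sdiff_of_injOn hu' (singleton_subset_iff.2 hu),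
        image_sdiff_of_injOn hv' (singleton_subset_iff.2 hv), himg]
    · intro φ hφ
      exact mem_erase.2
        ⟨((mem_extensions.1 (mem_conflicts.1 hφ).1).2 e).2 (huF hu), mem_univ _⟩
    · simp
    · intro φ hφ f hf hfe
      by_contra h0
      exact hf (mem_erase.2 ⟨hfe, ((mem_extensions.1 (mem_conflicts.1 hφ).1).2 f).1 h0⟩)
  have hcount : #Z ≤ (#D).factorial * #(goodPartials inc K (F.erase e \ D)) := by
    refine card_le_factorial_mul_card_goodPartials (A := D) (A' := (inc v).erase e) Subset.rfl
      (by simp) ?_ ?_ ?_ ?_ ?_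
    · exact fun f hf => mem_sdiff.2 ⟨hvF' hf, fun hfD => disjoint_left.1 huv hfD hf⟩
    · intro ψ hψ
      refine ((mem_goodPartials.1 (mem_filter.1 hψ).1).injOn u).mono (coe_subset.2 ?_)
      exact subset_inter (erase_subset _ _) huF'
    · exact fun ψ hψ => (mem_filter.1 hψ).2
    · exact fun ψ hψ =>
        mem_goodPartials.2 ((mem_goodPartials.1 (mem_filter.1 hψ).1).restrictTo sdiff_subset)
    · intro ψ hψ f hf hfD
      by_contra h0
      exact hf (mem_sdiff.2 ⟨((mem_goodPartials.1 (mem_filter.1 hψ).1).support f).1 h0, hfD⟩)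
  have hchain := pow_mul_card_goodPartials_le ih huF'
  rw [← hDcard]
  calc m ^ #D * #(conflicts inc K F e u v)
      ≤ m ^ #D * (K * ((#D).factorial * #(goodPartials inc K (F.erase e \ D)))) :=
        Nat.mul_le_mul_left _ (hext.trans (Nat.mul_le_mul_left _ hcount))
    _ = K * ((#D).factorial * (m ^ #D * #(goodPartials inc K (F.erase e \ D)))) := by ring
    _ ≤ _ := Nat.mul_le_mul_left _ (Nat.mul_le_mul_left _ hchain)

end Counting

section Graph

open Finset

variable {V : Type*} [Fintype V] [DecidableEq V] {G : SimpleGraph V} [DecidableRel G.Adj]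

/-- The edges of `G` incident with `v`. -/
abbrev edgesAt (G : SimpleGraph V) [DecidableRel G.Adj] (v : V) : Finset (Sym2 V) :=
  G.incidenceFinset v

lemma mem_edgesAt_and_mem_iff {x w : V} (hxw : x ≠ w) {f : Sym2 V} :
    f ∈ edgesAt G x ∧ f ∈ edgesAt G w ↔ G.Adj x w ∧ f = s(x, w) := by
  simp only [SimpleGraph.mem_incidenceFinset, SimpleGraph.incidenceSet, Set.mem_ofPred_eq]
  constructor
  · rintro ⟨⟨hf, hx⟩, -, hw⟩
    obtain rfl := (Sym2.mem_and_mem_iff hxw).1 ⟨hx, hw⟩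
    exact ⟨hf, rfl⟩
  · rintro ⟨h, rfl⟩
    exact ⟨⟨h, Sym2.mem_mk_left _ _⟩, h, Sym2.mem_mk_right _ _⟩

lemma pow_mul_sum_conflicts_le {K k m : ℕ} {F : Finset (Sym2 V)} {x y : V} (hxy : G.Adj x y)
    (ih : ∀ F' ⊆ F.erase s(x, y), ∀ f ∈ F', m * #(goodPartials (edgesAt G) K (F'.erase f)) ≤
      #(goodPartials (edgesAt G) K F'))
    {W : Finset V} (hWx : x ∉ W) (hWy : y ∉ W) (hW : #W ≤ k.choose (G.degree x)) :
    m ^ (G.degree x - 1) * ∑ w ∈ W, #(conflicts (edgesAt G) K F s(x, y) x w) ≤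
      (k.choose (G.degree x) * (G.degree x).factorial +
        (G.degree x - 1) * (m * (G.degree x - 1).factorial)) *
        #(goodPartials (edgesAt G) K (F.erase s(x, y))) := by
  set d := G.degree x with hd
  set N := #(goodPartials (edgesAt G) K (F.erase s(x, y))) with hN
  have hinc : #(edgesAt G x) = d := G.card_incidenceFinset_eq_degree x
  have hex := ((mem_edgesAt_and_mem_iff hxy.ne).2 ⟨hxy, rfl⟩).1
  have hterm : ∀ w ∈ W, m ^ (d - 1) * #(conflicts (edgesAt G) K F s(x, y) x w) ≤
      d.factorial * N + if G.Adj x w then m * (d - 1).factorial * N else 0 := by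
    intro w hw
    have hxw : x ≠ w := fun h => hWx (h ▸ hw)
    have hyw : y ≠ w := fun h => hWy (h ▸ hw)
    by_cases hadj : G.Adj x w
    · have hfx := ((mem_edgesAt_and_mem_iff hxw).2 ⟨hadj, rfl⟩).1
      have heD : s(x, y) ∈ (edgesAt G x).erase s(x, w) :=
        mem_erase.2 ⟨fun h => hyw (Sym2.congr_right.1 h), hex⟩
      have hcard := card_erase_of_mem hfx
      rw [hinc] at hcard
      have hpos : 0 < d - 1 := hcard ▸ card_pos.2 ⟨_, heD⟩
      have hmain := pow_mul_card_conflicts_le (K := K) (F := F) (w := w) ih (erase_subset _ _) heD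
        (disjoint_left.2 fun f hf hfw => (mem_erase.1 hf).1
          ((mem_edgesAt_and_mem_iff hxw).1 ⟨(mem_erase.1 hf).2, hfw⟩).2)
      rw [hcard] at hmain
      obtain ⟨r, hr⟩ : ∃ r, d - 1 = r + 1 := ⟨d - 1 - 1, by omega⟩
      rw [if_pos hadj]
      rw [hr] at hmain ⊢
      calc m ^ (r + 1) * #(conflicts (edgesAt G) K F s(x, y) x w)
          = m * (m ^ (r + 1 - 1) * #(conflicts (edgesAt G) K F s(x, y) x w)) := by
            rw [Nat.add_sub_cancel]; ring
        _ ≤ m * ((r + 1).factorial * N) := Nat.mul_le_mul_left _ hmain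
        _ ≤ _ := by rw [mul_assoc]; exact Nat.le_add_left _ _
    · have hmain := pow_mul_card_conflicts_le (K := K) (F := F) (w := w) ih Subset.rfl hex
        (disjoint_left.2 fun f hf hfw =>
          hadj ((mem_edgesAt_and_mem_iff hxw).1 ⟨hf, hfw⟩).1)
      rw [hinc] at hmain
      rw [if_neg hadj]
      exact hmain
  have hadjcard : #(W.filter fun w => G.Adj x w) ≤ d - 1 := by
    have hsub : (W.filter fun w => G.Adj x w) ⊆ (G.neighborFinset x).erase y := by
      intro w hw
      obtain ⟨hwW, hadj⟩ := mem_filter.1 hw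
      exact mem_erase.2 ⟨fun h => hWy (h ▸ hwW), (G.mem_neighborFinset x w).2 hadj⟩
    have := card_le_card hsub
    rwa [card_erase_of_mem ((G.mem_neighborFinset x y).2 hxy), G.card_neighborFinset_eq_degree]
      at this
  rw [mul_sum]
  refine (sum_le_sum hterm).trans ?_
  rw [sum_add_distrib, sum_const, ← sum_filter, sum_const, smul_eq_mul, smul_eq_mul]
  calc #W * (d.factorial * N) + #(W.filter fun w => G.Adj x w) * (m * (d - 1).factorial * N)
      ≤ k.choose d * (d.factorial * N) + (d - 1) * (m * (d - 1).factorial * N) :=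
        add_le_add (Nat.mul_le_mul_right _ hW) (Nat.mul_le_mul_right _ hadjcard)
    _ = _ := by ring

lemma succ_mul_factorial_succ_le {m k : ℕ} (h : m + 2 ≤ k) :
    (m + 1) * (m + 1).factorial ≤ (2 * k) ^ m := by
  induction m with
  | zero => simp
  | succ m ih =>
    have ih' := ih (by omega)
    refine le_of_mul_le_mul_left ?_ (show 0 < m + 1 by omega)
    calc (m + 1) * ((m + 1 + 1) * (m + 1 + 1).factorial)
        = (m + 2) ^ 2 * ((m + 1) * (m + 1).factorial) := by
          rw [Nat.factorial_succ (m + 1)]; ring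
      _ ≤ ((m + 1) * (2 * k)) * (2 * k) ^ m := Nat.mul_le_mul (by nlinarith) ih'
      _ = _ := by ring

lemma two_mul_choose_mul_factorial_add_le {d k : ℕ} (hd : 2 ≤ d) (hdk : d ≤ k) :
    2 * (k.choose d * d.factorial + (d - 1) * (2 * k * (d - 1).factorial)) ≤
      (k + 2) * (2 * k) ^ (d - 1) := by
  obtain ⟨m, rfl⟩ := Nat.exists_eq_add_of_le' hd
  have h1 : 2 * (k.choose (m + 2) * (m + 2).factorial) ≤ k * (2 * k) ^ (m + 1) := by
    rw [mul_comm (k.choose _), ← Nat.descFactorial_eq_factorial_mul_choose]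
    calc 2 * k.descFactorial (m + 2) ≤ 2 * k ^ (m + 2) :=
          Nat.mul_le_mul_left _ (Nat.descFactorial_le_pow _ _)
      _ ≤ 2 ^ (m + 1) * k ^ (m + 2) :=
          Nat.mul_le_mul_right _ (Nat.le_self_pow (Nat.succ_ne_zero m) 2)
      _ = k * (2 * k) ^ (m + 1) := by rw [mul_pow]; ring
  have h2 : (m + 1) * (2 * k * (m + 1).factorial) ≤ (2 * k) ^ (m + 1) := by
    calc (m + 1) * (2 * k * (m + 1).factorial) = 2 * k * ((m + 1) * (m + 1).factorial) := by ring
      _ ≤ 2 * k * (2 * k) ^ m := Nat.mul_le_mul_left _ (succ_mul_factorial_succ_le hdk)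
      _ = _ := by ring
  rw [show m + 2 - 1 = m + 1 from rfl]
  linarith

/-- Coloring one more edge multiplies the number of good partial colorings by at least `2 * k`. -/
theorem two_mul_mul_card_goodPartials_erase_le {k K : ℕ} (hdeg : ∀ v, G.degree v ≤ k)
    (hcount : ∀ v, #{w | G.degree w = G.degree v} ≤ k.choose (G.degree v))
    (hiso : ¬ ∃ u v : V, G.Adj u v ∧ G.degree u = 1 ∧ G.degree v = 1)
    (hK : 11 * k + 12 ≤ 2 * K) {F : Finset (Sym2 V)} (hF : F ⊆ G.edgeFinset) {e : Sym2 V}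
    (he : e ∈ F) :
    2 * k * #(goodPartials (edgesAt G) K (F.erase e)) ≤
      #(goodPartials (edgesAt G) K F) := by
  induction F using Finset.strongInduction generalizing e with
  | H F hind =>
  have ih : ∀ F' ⊆ F.erase e, ∀ f ∈ F',
      2 * k * #(goodPartials (edgesAt G) K (F'.erase f)) ≤
        #(goodPartials (edgesAt G) K F') := fun F' hF' f hf =>
    hind F' (hF'.trans_ssubset (erase_ssubset he)) ((hF'.trans (erase_subset _ _)).trans hF) hf
  clear hind
  induction e with | _ u v
  have huv : G.Adj u v := by simpa using hF he
  have hinc : ∀ x, #(edgesAt G x) = G.degree x := fun x =>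
    G.card_incidenceFinset_eq_degree x
  have hends := (mem_edgesAt_and_mem_iff huv.ne).2 ⟨huv, rfl⟩
  have hmem : ∀ x, s(u, v) ∈ edgesAt G x ↔ x = u ∨ x = v := by
    intro x
    simp [SimpleGraph.mem_incidenceFinset, SimpleGraph.incidenceSet, huv]
  have hub := (mul_card_goodPartials_le_card_extensions (inc := edgesAt G) (K := K)
    he).trans (card_extensions_le hmem)
  simp only [hinc] at hub
  set N := #(goodPartials (edgesAt G) K (F.erase s(u, v))) with hN
  set Tu := ∑ w with G.degree w = G.degree u ∧ w ≠ u ∧ w ≠ v,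
    #(conflicts (edgesAt G) K F s(u, v) u w) with hTu
  set Tv := ∑ w with G.degree w = G.degree v ∧ w ≠ u ∧ w ≠ v,
    #(conflicts (edgesAt G) K F s(u, v) v w) with hTv
  have hboundU := pow_mul_sum_conflicts_le (k := k) huv ih
    (W := univ.filter fun w => G.degree w = G.degree u ∧ w ≠ u ∧ w ≠ v) (by simp) (by simp)
    ((card_le_card (monotone_filter_right _ fun w _ hw => hw.1)).trans (hcount u))
  have hboundV := pow_mul_sum_conflicts_le (k := k) huv.symm (Sym2.eq_swap (a := u) (b := v) ▸ ih)
    (W := univ.filter fun w => G.degree w = G.degree v ∧ w ≠ u ∧ w ≠ v) (by simp) (by simp)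
    ((card_le_card (monotone_filter_right _ fun w _ hw => hw.1)).trans (hcount v))
  rw [Sym2.eq_swap (a := v) (b := u)] at hboundV
  rw [← hTu, ← hN] at hboundU
  rw [← hTv, ← hN] at hboundV
  have hdu : 0 < G.degree u := (G.degree_pos_iff_exists_adj u).2 ⟨v, huv⟩
  have hdv : 0 < G.degree v := (G.degree_pos_iff_exists_adj v).2 ⟨u, huv.symm⟩
  have hkpos : 0 < k := hdu.trans_le (hdeg u)
  have hone : ∀ {d T : ℕ}, d = 1 → (2 * k) ^ (d - 1) * T ≤ (k.choose d * d.factorial +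
      (d - 1) * (2 * k * (d - 1).factorial)) * N → T ≤ k * N := by
    rintro d T rfl h
    simpa using h
  have htwo : ∀ {d T : ℕ}, 2 ≤ d → d ≤ k → (2 * k) ^ (d - 1) * T ≤ (k.choose d * d.factorial +
      (d - 1) * (2 * k * (d - 1).factorial)) * N → 2 * T ≤ (k + 2) * N := by
    intro d T hd hdk h
    refine le_of_mul_le_mul_left ?_ (show 0 < (2 * k) ^ (d - 1) by positivity)
    calc (2 * k) ^ (d - 1) * (2 * T) = 2 * ((2 * k) ^ (d - 1) * T) := by ring
      _ ≤ 2 * ((k.choose d * d.factorial + (d - 1) * (2 * k * (d - 1).factorial)) * N) :=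
        Nat.mul_le_mul_left _ h
      _ = (2 * (k.choose d * d.factorial + (d - 1) * (2 * k * (d - 1).factorial))) * N := by ring
      _ ≤ ((k + 2) * (2 * k) ^ (d - 1)) * N :=
        Nat.mul_le_mul_right _ (two_mul_choose_mul_factorial_add_le hd hdk)
      _ = _ := by ring
  have hblocked : (G.degree u - 1 + (G.degree v - 1)) * N + 2 * N ≤ 2 * k * N := by
    rw [← add_mul]
    have := hdeg u
    have := hdeg v
    exact Nat.mul_le_mul_right _ (by omega)
  have hKN : (11 * k + 12) * N ≤ 2 * K * N := Nat.mul_le_mul_right _ hK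
  by_cases hone_end : G.degree u = 1 ∨ G.degree v = 1
  · have hempty : #(conflicts (edgesAt G) K F s(u, v) u v) = 0 := by
      rw [card_eq_zero, eq_empty_iff_forall_notMem]
      intro φ hφ
      have := card_inc_eq_of_mem_conflicts hφ
      rw [hinc, hinc] at this
      exact hiso ⟨u, v, huv, by omega, by omega⟩
    have hsum : 2 * (Tu + Tv) ≤ (3 * k + 2) * N := by
      rcases hone_end with h1 | h1
      · have hv : 2 ≤ G.degree v := by
          by_contra hlt
          exact hiso ⟨u, v, huv, h1, by omega⟩
        linarith [hone h1 hboundU, htwo hv (hdeg v) hboundV]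
      · have hu : 2 ≤ G.degree u := by
          by_contra hlt
          exact hiso ⟨u, v, huv, by omega, h1⟩
        linarith [hone h1 hboundV, htwo hu (hdeg u) hboundU]
    rw [hempty] at hub
    linarith
  · have hu : 2 ≤ G.degree u := by omega
    have hv : 2 ≤ G.degree v := by omega
    have hboth := pow_mul_card_conflicts_ends_le (K := K) ih hends.1 hends.2
      (disjoint_left.2 fun f hf hf' => (mem_erase.1 hf).1
        ((mem_edgesAt_and_mem_iff huv.ne).1 ⟨(mem_erase.1 hf).2, (mem_erase.1 hf').2⟩).2)
    rw [hinc, ← hN] at hboth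
    set B := #(conflicts (edgesAt G) K F s(u, v) u v) with hB
    have hBbound : 2 * k * B ≤ K * N := by
      obtain ⟨m, hm⟩ := Nat.exists_eq_add_of_le' hu
      have hmk : m + 2 ≤ k := hm ▸ hdeg u
      rw [hm, show m + 2 - 1 = m + 1 from rfl] at hboth
      have hfac : (m + 1).factorial ≤ (2 * k) ^ m :=
        (Nat.le_mul_of_pos_left _ (Nat.succ_pos m)).trans (succ_mul_factorial_succ_le hmk)
      refine le_of_mul_le_mul_left ?_ (show 0 < (2 * k) ^ m by positivity)
      calc (2 * k) ^ m * (2 * k * B) = (2 * k) ^ (m + 1) * B := by ring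
        _ ≤ K * ((m + 1).factorial * N) := hboth
        _ ≤ K * ((2 * k) ^ m * N) := Nat.mul_le_mul_left _ (Nat.mul_le_mul_right _ hfac)
        _ = _ := by ring
    have hTu2 := htwo hu (hdeg u) hboundU
    have hTv2 := htwo hv (hdeg v) hboundV
    have hmain : K * N ≤ #(goodPartials (edgesAt G) K F) + B + 3 * k * N := by linarith
    refine le_of_mul_le_mul_left ?_ (show 0 < 2 * k by positivity)
    have h1 := Nat.mul_le_mul_left (2 * k) hmain
    have h2 : 10 * k ^ 2 * N + K * N ≤ 2 * k * K * N := by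
      rw [← add_mul]
      exact Nat.mul_le_mul_right _ (by nlinarith)
    nlinarith

lemma exists_isGoodPartial_edgeFinset {k K : ℕ} (hdeg : ∀ v, G.degree v ≤ k)
    (hcount : ∀ v, #{w | G.degree w = G.degree v} ≤ k.choose (G.degree v))
    (hvdec : IsVdecGraph G) (hK : 11 * k + 12 ≤ 2 * K) :
    ∃ φ : Sym2 V → Fin (K + 1), IsGoodPartial (edgesAt G) G.edgeFinset φ := by
  have hempty : 0 < #(goodPartials (edgesAt G) K (∅ : Finset (Sym2 V))) := by
    refine card_pos.2 ⟨fun _ => 0, mem_goodPartials.2 ⟨by simp, by simp, ?_⟩⟩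
    intro u w huw hu hw
    have hzero : ∀ x, edgesAt G x ⊆ ∅ → G.degree x = 0 := by
      intro x hx
      exact (G.card_incidenceFinset_eq_degree x).symm.trans (card_eq_zero.2 (subset_empty.1 hx))
    exact absurd (hvdec.1 (hzero u hu) (hzero w hw)) huw
  have hpos : ∀ F ⊆ G.edgeFinset, 0 < #(goodPartials (edgesAt G) K F) := by
    intro F
    induction F using Finset.induction_on with
    | empty => exact fun _ => hempty
    | insert e F heF ih =>
      intro hF
      have hstep := two_mul_mul_card_goodPartials_erase_le hdeg hcount hvdec.2 hK hF
        (mem_insert_self e F)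
      rw [erase_insert heF] at hstep
      have hk : 0 < k := by
        have he := hF (mem_insert_self e F)
        induction e with | _ u v
        have huv : G.Adj u v := by simpa using he
        exact ((G.degree_pos_iff_exists_adj u).2 ⟨v, huv⟩).trans_le (hdeg u)
      have := ih ((subset_insert e F).trans hF)
      exact lt_of_lt_of_le (by positivity) hstep
  obtain ⟨φ, hφ⟩ := card_pos.1 (hpos _ Subset.rfl)
  exact ⟨φ, mem_goodPartials.1 hφ⟩

lemma IsGoodPartial.isVDEC {K : ℕ} {φ : Sym2 V → Fin (K + 1)}
    (h : IsGoodPartial (edgesAt G) G.edgeFinset φ) : IsVDEC G K fun e => (φ e : ℕ) := by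
  have hmem : ∀ v e, e ∈ edgesAt G v ↔ e ∈ G.edgeSet ∧ v ∈ e := fun v e => by
    simp [SimpleGraph.mem_incidenceFinset, SimpleGraph.incidenceSet]
  have hsub : ∀ v, edgesAt G v ⊆ G.edgeFinset := fun v e he =>
    SimpleGraph.mem_edgeFinset.2 ((hmem v e).1 he).1
  refine ⟨⟨fun e he => ?_, ?_⟩, fun u v huv hset => ?_⟩
  · have h0 := (h.support e).2 (SimpleGraph.mem_edgeFinset.2 he)
    exact mem_Icc.2 ⟨Nat.one_le_iff_ne_zero.2 fun hz => h0 (Fin.ext hz),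
      Nat.le_of_lt_succ (φ e).isLt⟩
  · rintro e₁ he₁ e₂ he₂ hne ⟨v, hv₁, hv₂⟩ heq
    have h₁ := (hmem v e₁).2 ⟨he₁, hv₁⟩
    have h₂ := (hmem v e₂).2 ⟨he₂, hv₂⟩
    exact hne (h.injOn v (mem_coe.2 (mem_inter.2 ⟨h₁, hsub v h₁⟩))
      (mem_coe.2 (mem_inter.2 ⟨h₂, hsub v h₂⟩)) (Fin.ext heq))
  · refine h.separates u v huv (hsub u) (hsub v) ?_
    have hcolor : ∀ w c, c ∈ (edgesAt G w).image φ ↔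
        (c : ℕ) ∈ colorSet G (fun e => (φ e : ℕ)) w := by
      intro w c
      simp only [mem_image, colorSet, Set.mem_ofPred_eq, hmem, Fin.ext_iff, and_assoc]
    ext c
    rw [hcolor, hcolor, hset]

end Graph

open Finset in
lemma paramK_spec {V : Type*} [Fintype V] {G : SimpleGraph V} [DecidableRel G.Adj]
    (h : {v : V | G.degree v = 0}.Subsingleton) (d : ℕ)
    (hmin : G.minDegree ≤ d) (hmax : d ≤ G.maxDegree) :
    #{w | G.degree w = d} ≤ (paramK G).choose d := by
  have hne : {k : ℕ | ∀ d : ℕ, G.minDegree ≤ d → d ≤ G.maxDegree →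
      #{w | G.degree w = d} ≤ k.choose d}.Nonempty := by
    refine ⟨G.maxDegree + Fintype.card V, fun d _ hd => ?_⟩
    rcases Nat.eq_zero_or_pos d with rfl | hpos
    · rw [Nat.choose_zero_right, card_le_one]
      intro a ha b hb
      exact h (by simpa using ha) (by simpa using hb)
    · calc #{w | G.degree w = d} ≤ Fintype.card V := card_le_univ _
        _ ≤ (d + Fintype.card V).choose d := by
          rw [Nat.choose_symm_add]
          have := Nat.choose_le_choose (Fintype.card V) (Nat.add_le_add_right hpos
            (Fintype.card V))
          rw [← Nat.choose_symm_add (a := 1), Nat.choose_one_right] at this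
          omega
        _ ≤ _ := Nat.choose_le_choose d (Nat.add_le_add_right hd _)
  exact Nat.sInf_mem hne d hmin hmax

/-- For every vdec graph `G`, `χ'_vd(G) ≤ ⌊5.5·k(G) + 6.5⌋ = ⌊(11·k(G)+13)/2⌋`. -/
theorem vdIndex_le_of_vdec {V : Type*} [Fintype V] (G : SimpleGraph V) [DecidableRel G.Adj]
    (h : IsVdecGraph G) :
    vdIndex G ≤ (11 * paramK G + 13) / 2 := by
  classical
  have hcount : ∀ v, (Finset.univ.filter fun w => G.degree w = G.degree v).card ≤
      (paramK G).choose (G.degree v) := fun v =>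
    paramK_spec h.1 _ (G.minDegree_le_degree v) (G.degree_le_maxDegree v)
  have hdeg : ∀ v, G.degree v ≤ paramK G := by
    intro v
    by_contra hlt
    have hv := hcount v
    rw [Nat.choose_eq_zero_of_lt (not_le.1 hlt), Nat.le_zero, Finset.card_eq_zero] at hv
    exact Finset.notMem_empty v (hv ▸ by simp)
  obtain ⟨φ, hφ⟩ := exists_isGoodPartial_edgeFinset hdeg hcount h
    (K := (11 * paramK G + 13) / 2) (by omega)
  exact Nat.sInf_le ⟨_, hφ.isVDEC⟩
end

section
/- Let G be a finite simple d-regular graph on n vertices with d ≥ log₂ n and log₂ n ≥ 8 (i.e., 2^d ≥ n and n ≥ 256). Then the vertex-distinguishing chromatic index of G satisfies χ'_vd(G) ≤ k(G) + 3. -/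
open scoped Classical in
/-- The finset of colors seen by `v` under the edge coloring `φ` of `G`. -/
noncomputable def palette {V : Type*} [Fintype V] (G : SimpleGraph V) (φ : Sym2 V → ℕ) (v : V) :
    Finset ℕ :=
  (G.neighborFinset v).image fun w => φ s(v, w)

/-- `φ` restricts to a proper edge coloring of `G` with colors in `C`. -/
structure ProperOn {V : Type*} (G : SimpleGraph V) (C : Finset ℕ) (φ : Sym2 V → ℕ) : Prop where
  mem : ∀ ⦃u v : V⦄, G.Adj u v → φ s(u, v) ∈ C
  eq : ∀ ⦃u v w : V⦄, G.Adj u v → G.Adj u w → φ s(u, v) = φ s(u, w) → v = w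

theorem even_card_of_involutive_of_forall_ne {α : Type*} {s : Finset α} {f : α → α}
    (hf : Function.Involutive f) (hs : ∀ v ∈ s, f v ∈ s) (hne : ∀ v ∈ s, f v ≠ v) :
    Even s.card := by
  have h : ∑ _v ∈ s, (1 : ZMod 2) = 0 :=
    Finset.sum_involution (fun v _ => f v) (fun _ _ => by decide) (fun v hv _ => hne v hv)
      (fun v hv => hs v hv) (fun v _ => hf v)
  rw [Finset.sum_const, nsmul_eq_mul, mul_one] at h
  exact (ZMod.natCast_eq_zero_iff_even).1 h

section Kempe

open scoped Classical

variable {V : Type*} [Fintype V] {G : SimpleGraph V} {C : Finset ℕ} {φ : Sym2 V → ℕ}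

theorem mem_palette {v : V} {c : ℕ} : c ∈ palette G φ v ↔ ∃ w, G.Adj v w ∧ φ s(v, w) = c := by
  simp [palette]

theorem ProperOn.palette_subset (h : ProperOn G C φ) (v : V) : palette G φ v ⊆ C := by
  intro c hc
  obtain ⟨w, hw, rfl⟩ := mem_palette.1 hc
  exact h.mem hw

theorem ProperOn.card_palette (h : ProperOn G C φ) (v : V) :
    (palette G φ v).card = G.degree v := by
  rw [palette, Finset.card_image_of_injOn, SimpleGraph.card_neighborFinset_eq_degree]
  intro x hx y hy hxy
  simp only [SimpleGraph.coe_neighborFinset, SimpleGraph.mem_neighborSet] at hx hy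
  exact h.eq hx hy hxy

/-- A component of a graph of maximum degree two has at most two vertices of degree at most one. -/
theorem card_filter_le_two_of_degree_le_two {K : SimpleGraph V} (hK : ∀ v, K.degree v ≤ 2)
    (c : K.ConnectedComponent) {s : Finset V} (hs : ∀ v ∈ s, K.connectedComponentMk v = c)
    (hs1 : ∀ v ∈ s, K.degree v ≤ 1) : s.card ≤ 2 := by
  have hconn := c.connected_toSimpleGraph.card_vert_le_card_edgeSet_add_one
  have hsum := c.toSimpleGraph.sum_degrees_eq_twice_card_edges
  rw [Nat.card_eq_fintype_card, Nat.card_eq_fintype_card, ← SimpleGraph.edgeFinset_card] at hconn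
  have hdeg : ∀ x : c, c.toSimpleGraph.degree x ≤ K.degree x := by
    intro x
    rw [← SimpleGraph.card_neighborFinset_eq_degree, ← SimpleGraph.card_neighborFinset_eq_degree]
    apply Finset.card_le_card_of_injOn (Subtype.val : c → V)
    · intro y hy
      simp only [SimpleGraph.coe_neighborFinset, SimpleGraph.mem_neighborSet] at hy ⊢
      exact hy
    · intro y _ z _ h
      exact Subtype.ext h
  have hbound : ∑ x : c, (c.toSimpleGraph.degree x + if (x : V) ∈ s then 1 else 0)
      ≤ ∑ _x : c, 2 := by
    apply Finset.sum_le_sum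
    intro x _
    have := hdeg x
    have h2 := hK x
    split_ifs with hx
    · have := hs1 _ hx
      omega
    · omega
  have hcount : ∑ x : c, (if (x : V) ∈ s then 1 else 0) = s.card := by
    rw [Finset.sum_boole]
    simp only [Nat.cast_id]
    apply Finset.card_bij (fun (x : c) _ => (x : V))
    · intro x hx
      simpa using hx
    · intro x _ y _ h
      exact Subtype.ext h
    · intro v hv
      exact ⟨⟨v, hs v hv⟩, by simpa using hv, rfl⟩
  rw [Finset.sum_add_distrib, hcount, hsum, Finset.sum_const, smul_eq_mul, Finset.card_univ]
    at hbound
  omega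

/-- The graph `A` together with the edges `{v, ν v}` for `v ∈ X`. -/
def glueGraph (A : SimpleGraph V) (X : Finset V) (ν : V → V) : SimpleGraph V :=
  SimpleGraph.fromRel fun u v => A.Adj u v ∨ (u ∈ X ∧ ν u = v)

section Glue

variable {A : SimpleGraph V} {X : Finset V} {ν : V → V}

theorem glueGraph_mk_eq_of_adj {u v : V} (huv : A.Adj u v) :
    (glueGraph A X ν).connectedComponentMk u = (glueGraph A X ν).connectedComponentMk v :=
  SimpleGraph.ConnectedComponent.connectedComponentMk_eq_of_adj
    ((SimpleGraph.fromRel_adj _ _ _).2 ⟨huv.ne, Or.inl (Or.inl huv)⟩)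

theorem glueGraph_mk_apply {v : V} (hv : v ∈ X) :
    (glueGraph A X ν).connectedComponentMk (ν v) = (glueGraph A X ν).connectedComponentMk v := by
  by_cases hvv : ν v = v
  · rw [hvv]
  · exact SimpleGraph.ConnectedComponent.connectedComponentMk_eq_of_adj
      ((SimpleGraph.fromRel_adj _ _ _).2 ⟨hvv, Or.inr (Or.inr ⟨hv, rfl⟩)⟩)

theorem glueGraph_degree_le (hν : Function.Involutive ν) (hνX : ∀ v ∈ X, ν v ∈ X) (v : V) :
    (glueGraph A X ν).degree v ≤ A.degree v + if v ∈ X ∧ ν v ≠ v then 1 else 0 := by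
  rw [← SimpleGraph.card_neighborFinset_eq_degree, ← SimpleGraph.card_neighborFinset_eq_degree]
  have hsub : (glueGraph A X ν).neighborFinset v ⊆ A.neighborFinset v ∪
      if v ∈ X ∧ ν v ≠ v then {ν v} else ∅ := by
    intro w hw
    rw [SimpleGraph.mem_neighborFinset, glueGraph, SimpleGraph.fromRel_adj] at hw
    rw [Finset.mem_union, SimpleGraph.mem_neighborFinset]
    obtain ⟨hne, (hw | ⟨hv, rfl⟩) | (hw | ⟨hw, rfl⟩)⟩ := hw
    · exact Or.inl hw
    · right
      rw [if_pos ⟨hv, hne.symm⟩]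
      simp
    · exact Or.inl hw.symm
    · right
      rw [hν w, if_pos ⟨hνX w hw, hne.symm⟩]
      simp
  refine (Finset.card_le_card hsub).trans ((Finset.card_union_le _ _).trans ?_)
  split_ifs <;> simp

theorem even_card_filter_mk_eq (hAX : ∀ v ∈ X, A.degree v = 1)
    (hAnX : ∀ v ∉ X, A.degree v = 0 ∨ A.degree v = 2) (c : (glueGraph A X ν).ConnectedComponent) :
    Even (X.filter fun u => (glueGraph A X ν).connectedComponentMk u = c).card := by
  let A' : SimpleGraph V :=
    { Adj := fun u w => A.Adj u w ∧ (glueGraph A X ν).connectedComponentMk u = c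
      symm := ⟨fun u w huw => ⟨huw.1.symm, (glueGraph_mk_eq_of_adj huw.1) ▸ huw.2⟩⟩
      loopless := ⟨fun u hu => A.loopless.irrefl u hu.1⟩ }
  have hA'deg : ∀ u, A'.degree u =
      if (glueGraph A X ν).connectedComponentMk u = c then A.degree u else 0 := by
    intro u
    rw [← SimpleGraph.card_neighborFinset_eq_degree]
    split_ifs with huc
    · rw [← SimpleGraph.card_neighborFinset_eq_degree]
      congr 1
      ext w
      simp [A', huc]
    · rw [Finset.card_eq_zero, Finset.eq_empty_iff_forall_notMem]
      intro w hw
      rw [SimpleGraph.mem_neighborFinset] at hw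
      exact huc hw.2
  convert A'.even_card_odd_degree_vertices using 2
  ext u
  rw [Finset.mem_filter, Finset.mem_filter, hA'deg]
  by_cases hu : u ∈ X
  · have := hAX u hu
    split_ifs with huc <;> simp [*]
  · have := hAnX u hu
    split_ifs with huc
    · rcases this with h0 | h0 <;> simp [hu, h0]
    · simp [hu]

theorem exists_partner_in_component (hAX : ∀ v ∈ X, A.degree v = 1)
    (hAnX : ∀ v ∉ X, A.degree v = 0 ∨ A.degree v = 2) (hν : Function.Involutive ν)
    (hνX : ∀ v ∈ X, ν v ∈ X) {v : V} (hv : v ∈ X) (hvv : ν v = v) :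
    ∃ w ∈ X, w ≠ v ∧ ν w = w ∧
      (glueGraph A X ν).connectedComponentMk w = (glueGraph A X ν).connectedComponentMk v ∧
      ∀ u ∈ X, ν u = u →
        (glueGraph A X ν).connectedComponentMk u = (glueGraph A X ν).connectedComponentMk v →
        u = v ∨ u = w := by
  set c := (glueGraph A X ν).connectedComponentMk v with hc
  have hK2 : ∀ v, (glueGraph A X ν).degree v ≤ 2 := by
    intro v
    have := glueGraph_degree_le (A := A) hν hνX v
    by_cases hv : v ∈ X
    · have := hAX v hv
      split_ifs at * <;> omega
    · have := hAnX v hv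
      rw [if_neg (by tauto)] at *
      omega
  set Xc := X.filter fun u => (glueGraph A X ν).connectedComponentMk u = c with hXc
  have hF2 : (Xc.filter fun u => ν u = u).card ≤ 2 := by
    apply card_filter_le_two_of_degree_le_two hK2 c
    · intro u hu
      exact (Finset.mem_filter.1 (Finset.mem_filter.1 hu).1).2
    · intro u hu
      obtain ⟨huXc, huu⟩ := Finset.mem_filter.1 hu
      have huX := (Finset.mem_filter.1 huXc).1
      have := glueGraph_degree_le (A := A) hν hνX u
      rw [hAX u huX, if_neg (by tauto)] at this
      exact this
  have hsplit := Finset.card_filter_add_card_filter_not (s := Xc) (fun u => ν u = u)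
  have hnon : Even (Xc.filter fun u => ¬ ν u = u).card := by
    apply even_card_of_involutive_of_forall_ne hν
    · intro u hu
      simp only [hXc, Finset.mem_filter] at hu ⊢
      refine ⟨⟨hνX u hu.1.1, (glueGraph_mk_apply hu.1.1).trans hu.1.2⟩, ?_⟩
      rw [hν u]
      exact fun h => hu.2 h.symm
    · intro u hu
      exact (Finset.mem_filter.1 hu).2
  have hvF : v ∈ Xc.filter fun u => ν u = u :=
    Finset.mem_filter.2 ⟨Finset.mem_filter.2 ⟨hv, rfl⟩, hvv⟩
  have hFpos : 0 < (Xc.filter fun u => ν u = u).card := Finset.card_pos.2 ⟨v, hvF⟩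
  have hFcard : (Xc.filter fun u => ν u = u).card = 2 := by
    obtain ⟨m, hm⟩ := hnon
    obtain ⟨m', hm'⟩ := even_card_filter_mk_eq hAX hAnX c
    rw [← hXc] at hm'
    omega
  obtain ⟨w, hw⟩ : ∃ w, (Xc.filter fun u => ν u = u).erase v = {w} := by
    rw [← Finset.card_eq_one, Finset.card_erase_of_mem hvF, hFcard]
  have hwF : w ∈ (Xc.filter fun u => ν u = u).erase v := hw ▸ Finset.mem_singleton_self w
  obtain ⟨hwv, hwF⟩ := Finset.mem_erase.1 hwF
  obtain ⟨hwXc, hww⟩ := Finset.mem_filter.1 hwF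
  obtain ⟨hwX, hwc⟩ := Finset.mem_filter.1 hwXc
  refine ⟨w, hwX, hwv, hww, hwc, ?_⟩
  intro u huX huu huc
  by_contra hcon
  push Not at hcon
  have : u ∈ (Xc.filter fun u => ν u = u).erase v := Finset.mem_erase.2
    ⟨hcon.1, Finset.mem_filter.2 ⟨Finset.mem_filter.2 ⟨huX, huc⟩, huu⟩⟩
  rw [hw, Finset.mem_singleton] at this
  exact hcon.2 this

end Glue

/-- The edges of `G` with color `a` or `b`. -/
def twoColorGraph (G : SimpleGraph V) (φ : Sym2 V → ℕ) (a b : ℕ) : SimpleGraph V where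
  Adj u v := G.Adj u v ∧ (φ s(u, v) = a ∨ φ s(u, v) = b)
  symm := ⟨fun u v huv => by rw [Sym2.eq_swap]; exact ⟨huv.1.symm, huv.2⟩⟩
  loopless := ⟨fun u hu => G.loopless.irrefl u hu.1⟩

theorem ProperOn.degree_twoColorGraph (h : ProperOn G C φ) (a b : ℕ) (v : V) :
    (twoColorGraph G φ a b).degree v = (palette G φ v ∩ {a, b}).card := by
  rw [← SimpleGraph.card_neighborFinset_eq_degree]
  apply Finset.card_bij (fun w _ => φ s(v, w))
  · intro w hw
    rw [SimpleGraph.mem_neighborFinset] at hw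
    simp only [Finset.mem_inter, Finset.mem_insert, Finset.mem_singleton]
    exact ⟨mem_palette.2 ⟨w, hw.1, rfl⟩, hw.2⟩
  · intro w hw w' hw' heq
    rw [SimpleGraph.mem_neighborFinset] at hw hw'
    exact h.eq hw.1 hw'.1 heq
  · intro c hc
    simp only [Finset.mem_inter, Finset.mem_insert, Finset.mem_singleton] at hc
    obtain ⟨w, hw, rfl⟩ := mem_palette.1 hc.1
    exact ⟨w, by rw [SimpleGraph.mem_neighborFinset]; exact ⟨hw, hc.2⟩, rfl⟩

/-- Two colors may be exchanged on any union of their Kempe chains. -/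
theorem ProperOn.exists_swap_on (h : ProperOn G C φ) {a b : ℕ} (ha : a ∈ C) (hb : b ∈ C)
    {S : Set V} (hS : ∀ u v, (twoColorGraph G φ a b).Adj u v → (u ∈ S ↔ v ∈ S)) :
    ∃ φ', ProperOn G C φ' ∧ ∀ v, palette G φ' v =
      if v ∈ S then (palette G φ v).image (Equiv.swap a b) else palette G φ v := by
  let φ' : Sym2 V → ℕ := fun e => if ∃ v ∈ e, v ∈ S then Equiv.swap a b (φ e) else φ e
  have hφ' : ∀ {u v}, G.Adj u v → φ' s(u, v) =
      if u ∈ S then Equiv.swap a b (φ s(u, v)) else φ s(u, v) := by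
    intro u v huv
    by_cases hc : φ s(u, v) = a ∨ φ s(u, v) = b
    · have := hS u v ⟨huv, hc⟩
      simp [φ', this]
    · push Not at hc
      simp [φ', Equiv.swap_apply_of_ne_of_ne hc.1 hc.2]
  refine ⟨φ', ⟨?_, ?_⟩, ?_⟩
  · intro u v huv
    rw [hφ' huv]
    have := h.mem huv
    split_ifs
    · rw [Equiv.swap_apply_def]
      split_ifs <;> assumption
    · assumption
  · intro u v w huv huw heq
    rw [hφ' huv, hφ' huw] at heq
    split_ifs at heq
    · exact h.eq huv huw ((Equiv.swap a b).injective heq)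
    · exact h.eq huv huw heq
  · intro v
    have hp : palette G φ' v = (G.neighborFinset v).image fun w =>
        if v ∈ S then Equiv.swap a b (φ s(v, w)) else φ s(v, w) := by
      apply Finset.image_congr
      intro w hw
      exact hφ' (by simpa using hw)
    rw [hp]
    split_ifs
    · rw [palette, Finset.image_image]
      rfl
    · rfl

/-- Kempe chains for the colors `a` and `b`, glued along an involution `ν` of the set `X` of
chain ends: the components can be recolored independently, and every chain end fixed by `ν` shares
its component with exactly one other such end. -/
theorem ProperOn.exists_kempe_components (h : ProperOn G C φ) {a b : ℕ} (ha : a ∈ C) (hb : b ∈ C)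
    (hab : a ≠ b) {X : Finset V} (hX : ∀ v, v ∈ X ↔ ¬(a ∈ palette G φ v ↔ b ∈ palette G φ v))
    {ν : V → V} (hν : Function.Involutive ν) (hνX : ∀ v ∈ X, ν v ∈ X) :
    ∃ K : SimpleGraph V,
      (∀ P : Set K.ConnectedComponent, ∃ φ', ProperOn G C φ' ∧ ∀ v, palette G φ' v =
        if K.connectedComponentMk v ∈ P then (palette G φ v).image (Equiv.swap a b)
        else palette G φ v) ∧
      (∀ v ∈ X, K.connectedComponentMk (ν v) = K.connectedComponentMk v) ∧
      ∀ v ∈ X, ν v = v → ∃ w ∈ X, w ≠ v ∧ ν w = w ∧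
        K.connectedComponentMk w = K.connectedComponentMk v ∧
        ∀ u ∈ X, ν u = u → K.connectedComponentMk u = K.connectedComponentMk v →
          u = v ∨ u = w := by
  have hdeg := h.degree_twoColorGraph a b
  have hAX : ∀ v, v ∈ X → (twoColorGraph G φ a b).degree v = 1 := by
    intro v hv
    rw [hX] at hv
    rw [hdeg]
    clear hdeg
    by_cases h1 : a ∈ palette G φ v <;> by_cases h2 : b ∈ palette G φ v <;> simp_all
  have hAnX : ∀ v, v ∉ X →
      (twoColorGraph G φ a b).degree v = 0 ∨ (twoColorGraph G φ a b).degree v = 2 := by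
    intro v hv
    rw [hX, not_not] at hv
    rw [hdeg]
    clear hdeg
    by_cases h1 : a ∈ palette G φ v <;> by_cases h2 : b ∈ palette G φ v <;> simp_all
  refine ⟨glueGraph (twoColorGraph G φ a b) X ν, fun P => ?_, fun v hv => glueGraph_mk_apply hv,
    fun v hv hvv => exists_partner_in_component hAX hAnX hν hνX hv hvv⟩
  have := h.exists_swap_on ha hb
    (S := {v | (glueGraph (twoColorGraph G φ a b) X ν).connectedComponentMk v ∈ P})
    (fun u v huv => by rw [Set.mem_ofPred_eq, Set.mem_ofPred_eq, glueGraph_mk_eq_of_adj huv])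
  exact this

end Kempe

section StarExtension

open scoped Classical

theorem ProperOn.mono {V : Type*} {G G' : SimpleGraph V} {C C' : Finset ℕ} {φ : Sym2 V → ℕ}
    (h : ProperOn G C φ) (hG : G' ≤ G) (hC : C ⊆ C') : ProperOn G' C' φ :=
  ⟨fun _ _ huv => hC (h.mem (hG huv)), fun _ _ _ huv huw => h.eq (hG huv) (hG huw)⟩

theorem ProperOn.exists_of_sdiff_matching {V : Type*} {G M : SimpleGraph V} {C : Finset ℕ}
    {φ : Sym2 V → ℕ} {i : ℕ} (h : ProperOn (G \ M) (C.erase i) φ) (hi : i ∈ C)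
    (hM : ∀ ⦃u v w⦄, M.Adj u v → M.Adj u w → v = w) : ∃ φ', ProperOn G C φ' := by
  refine ⟨fun e => if e ∈ M.edgeSet then i else φ e, ?_, ?_⟩
  · intro u v huv
    simp only [SimpleGraph.mem_edgeSet]
    split_ifs with hm
    · exact hi
    · exact Finset.mem_of_mem_erase (h.mem ⟨huv, hm⟩)
  · intro u v w huv huw heq
    simp only [SimpleGraph.mem_edgeSet] at heq
    split_ifs at heq with h1 h2 h2
    · exact hM h1 h2
    · exact absurd heq.symm (Finset.ne_of_mem_erase (h.mem ⟨huw, h2⟩))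
    · exact absurd heq (Finset.ne_of_mem_erase (h.mem ⟨huv, h1⟩))
    · exact h.eq ⟨huv, h1⟩ ⟨huw, h2⟩ heq

theorem sum_sq_lt_of_transfer {C : Finset ℕ} {x x' : ℕ → ℕ} {i j t : ℕ} (hi : i ∈ C) (hj : j ∈ C)
    (hij : i ≠ j) (hx : ∀ c, c ≠ i → c ≠ j → x' c = x c) (hxi : x' i + t = x i)
    (hxj : x' j = x j + t) (ht : 1 ≤ t) (ht2 : t ≤ 2) (hlt : x j + 3 ≤ x i) :
    ∑ c ∈ C, x' c ^ 2 < ∑ c ∈ C, x c ^ 2 := by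
  have hj' : j ∈ C.erase i := Finset.mem_erase.2 ⟨hij.symm, hj⟩
  rw [← Finset.add_sum_erase C _ hi, ← Finset.add_sum_erase _ _ hj',
    ← Finset.add_sum_erase C _ hi, ← Finset.add_sum_erase _ _ hj']
  have : ∑ c ∈ (C.erase i).erase j, x' c ^ 2 = ∑ c ∈ (C.erase i).erase j, x c ^ 2 := by
    apply Finset.sum_congr rfl
    intro c hc
    simp only [Finset.mem_erase] at hc
    rw [hx c hc.2.1 hc.1]
  rw [this, hxj, ← hxi]
  rw [← hxi] at hlt
  interval_cases t <;> nlinarith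

variable {V : Type*} [Fintype V]

/-- A proper coloring of `B` together with a choice `R u` of colors missing at each `u ∈ N`, one
color at `z` and two at every other vertex. -/
structure IsMissingChoice (B : SimpleGraph V) (C : Finset ℕ) (N : Finset V) (z : V)
    (φ : Sym2 V → ℕ) (R : V → Finset ℕ) : Prop where
  proper : ProperOn B C φ
  subset : ∀ u ∈ N, R u ⊆ C \ palette B φ u
  card : ∀ u ∈ N, (R u).card = if u = z then 1 else 2

theorem sum_sq_card_filter_lt {C : Finset ℕ} {N T : Finset V} {R : V → Finset ℕ} {i j : ℕ}
    (hi : i ∈ C) (hj : j ∈ C) (hij : i ≠ j) {u : V} (huN : u ∈ N) (hui : i ∈ R u) (huj : j ∉ R u)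
    (huT : u ∈ T) (hT : T.card ≤ 2) (hTj : ∀ w ∈ T, w ∈ N → j ∈ R w → i ∈ R w)
    (hlt : (N.filter fun w => j ∈ R w).card + 3 ≤ (N.filter fun w => i ∈ R w).card) :
    ∑ c ∈ C, (N.filter fun w => c ∈ if w ∈ T then (R w).image (Equiv.swap i j) else R w).card ^ 2
      < ∑ c ∈ C, (N.filter fun w => c ∈ R w).card ^ 2 := by
  have hmem : ∀ c w, c ∈ (R w).image (Equiv.swap i j) ↔ Equiv.swap i j c ∈ R w := by
    intro c w
    constructor
    · intro h
      obtain ⟨c', hc', rfl⟩ := Finset.mem_image.1 h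
      simpa using hc'
    · intro h
      exact Finset.mem_image.2 ⟨_, h, by simp⟩
  let D := N.filter fun w => w ∈ T ∧ i ∈ R w ∧ j ∉ R w
  have hDT : D ⊆ T := fun w hw => (Finset.mem_filter.1 hw).2.1
  have huD : u ∈ D := Finset.mem_filter.2 ⟨huN, huT, hui, huj⟩
  apply sum_sq_lt_of_transfer hi hj hij (t := D.card)
  · intro c hci hcj
    congr 1
    apply Finset.filter_congr
    intro w _
    split_ifs
    · rw [hmem, Equiv.swap_apply_of_ne_of_ne hci hcj]
    · rfl
  · rw [← Finset.card_union_of_disjoint]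
    · congr 1
      ext w
      simp only [Finset.mem_union, Finset.mem_filter, D]
      have := hTj w
      split_ifs
      · rw [hmem, Equiv.swap_apply_left]
        tauto
      · tauto
    · rw [Finset.disjoint_left]
      intro w hw hwD
      simp only [Finset.mem_filter, D] at hw hwD
      rw [if_pos hwD.2.1, hmem, Equiv.swap_apply_left] at hw
      exact hwD.2.2.2 hw.2
  · rw [← Finset.card_union_of_disjoint]
    · congr 1
      ext w
      simp only [Finset.mem_union, Finset.mem_filter, D]
      have := hTj w
      split_ifs
      · rw [hmem, Equiv.swap_apply_right]
        tauto
      · tauto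
    · rw [Finset.disjoint_left]
      intro w hw hwD
      simp only [Finset.mem_filter, D] at hw hwD
      exact hwD.2.2.2 hw.2
  · exact Finset.card_pos.2 ⟨u, huD⟩
  · exact (Finset.card_le_card hDT).trans hT
  · exact hlt

theorem swap_image_sdiff_subset {C P Q : Finset ℕ} {i j : ℕ} (hi : i ∈ C) (hj : j ∈ C)
    (h : Q ⊆ C \ P) :
    Q.image (Equiv.swap i j) ⊆ C \ P.image (Equiv.swap i j) := by
  intro c hc
  obtain ⟨c', hc', rfl⟩ := Finset.mem_image.1 hc
  obtain ⟨h1, h2⟩ := Finset.mem_sdiff.1 (h hc')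
  refine Finset.mem_sdiff.2 ⟨?_, ?_⟩
  · rw [Equiv.swap_apply_def]
    split_ifs <;> assumption
  · intro h
    obtain ⟨c'', hc'', heq⟩ := Finset.mem_image.1 h
    rw [(Equiv.swap i j).injective heq] at hc''
    exact h2 hc''

theorem image_swap_eq_self {P : Finset ℕ} {i j : ℕ} (h : i ∈ P ↔ j ∈ P) :
    P.image (Equiv.swap i j) = P := by
  have hsub : P.image (Equiv.swap i j) ⊆ P := by
    intro c hc
    obtain ⟨c', hc', rfl⟩ := Finset.mem_image.1 hc
    rw [Equiv.swap_apply_def]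
    split_ifs with h1 h2
    · exact h.1 (h1 ▸ hc')
    · exact h.2 (h2 ▸ hc')
    · exact hc'
  exact Finset.eq_of_subset_of_card_le hsub
    (Finset.card_image_of_injective _ (Equiv.swap i j).injective).ge

variable {B : SimpleGraph V} {C : Finset ℕ} {N : Finset V} {z : V} {φ : Sym2 V → ℕ}
  {R : V → Finset ℕ}

theorem IsMissingChoice.of_swap (h : IsMissingChoice B C N z φ R) {i j : ℕ} (hi : i ∈ C)
    (hj : j ∈ C) {φ' : Sym2 V → ℕ} (hφ' : ProperOn B C φ') {T : Finset V}
    (hT : ∀ w ∈ T, palette B φ' w = (palette B φ w).image (Equiv.swap i j))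
    (hnT : ∀ w ∉ T, palette B φ' w = palette B φ w) :
    IsMissingChoice B C N z φ' fun w => if w ∈ T then (R w).image (Equiv.swap i j) else R w := by
  refine ⟨hφ', fun w hw => ?_, fun w hw => ?_⟩
  · by_cases hwT : w ∈ T
    · rw [if_pos hwT, hT w hwT]
      exact swap_image_sdiff_subset hi hj (h.subset w hw)
    · rw [if_neg hwT, hnT w hwT]
      exact h.subset w hw
  · rw [← h.card w hw]
    split_ifs
    · exact Finset.card_image_of_injective _ (Equiv.swap i j).injective
    · rfl

theorem IsMissingChoice.exists_lt (h : IsMissingChoice B C N z φ R) {i j : ℕ} (hi : i ∈ C)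
    (hj : j ∈ C)
    (hlt : (N.filter fun w => j ∈ R w).card + 3 ≤ (N.filter fun w => i ∈ R w).card) :
    ∃ φ' R', IsMissingChoice B C N z φ' R' ∧
      ∑ c ∈ C, (N.filter fun w => c ∈ R' w).card ^ 2
        < ∑ c ∈ C, (N.filter fun w => c ∈ R w).card ^ 2 := by
  have hij : i ≠ j := by
    rintro rfl
    omega
  by_cases hall : ∃ u ∈ N, i ∈ R u ∧ j ∉ R u ∧ j ∉ palette B φ u
  · obtain ⟨u, huN, hui, huj, hup⟩ := hall
    have hip : i ∉ palette B φ u := (Finset.mem_sdiff.1 (h.subset u huN hui)).2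
    refine ⟨φ, _, h.of_swap hi hj h.proper (T := {u}) ?_ fun _ _ => rfl, ?_⟩
    · intro w hw
      rw [Finset.mem_singleton] at hw
      subst hw
      exact (image_swap_eq_self (by tauto)).symm
    · apply sum_sq_card_filter_lt hi hj hij huN hui huj (by simp) (by simp) _ hlt
      intro w hw _ _
      rw [Finset.mem_singleton.1 hw]
      exact hui
  push Not at hall
  let X : Finset V := Finset.univ.filter fun v => ¬(i ∈ palette B φ v ↔ j ∈ palette B φ v)
  have hX : ∀ v, v ∈ X ↔ ¬(i ∈ palette B φ v ↔ j ∈ palette B φ v) := by simp [X]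
  obtain ⟨K, hK, -, hpart⟩ := h.proper.exists_kempe_components hi hj hij hX (ν := id)
    (fun _ => rfl) (fun _ hv => hv)
  have hpart' : ∀ v, ∃ w, v ∈ X → w ∈ X ∧ w ≠ v ∧
      K.connectedComponentMk w = K.connectedComponentMk v ∧
      ∀ u ∈ X, K.connectedComponentMk u = K.connectedComponentMk v → u = v ∨ u = w := by
    intro v
    by_cases hv : v ∈ X
    · obtain ⟨w, h1, h2, -, h3, h4⟩ := hpart v hv rfl
      exact ⟨w, fun _ => ⟨h1, h2, h3, fun u hu hc => h4 u hu rfl hc⟩⟩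
    · exact ⟨v, fun h => absurd h hv⟩
  choose p hp using hpart'
  let Ui := N.filter fun w => i ∈ R w ∧ j ∉ R w
  let Uj := N.filter fun w => j ∈ R w ∧ i ∉ R w
  have hUX : ∀ u ∈ Ui, u ∈ X := by
    intro u hu
    obtain ⟨huN, hui, huj⟩ := Finset.mem_filter.1 hu
    have h1 := hall u huN hui huj
    have h2 := (Finset.mem_sdiff.1 (h.subset u huN hui)).2
    rw [hX]
    tauto
  have hcard : Uj.card < Ui.card := by
    have h1 : Ui.card + (N.filter fun w => i ∈ R w ∧ j ∈ R w).card
        = (N.filter fun w => i ∈ R w).card := by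
      rw [← Finset.card_filter_add_card_filter_not (s := N.filter fun w => i ∈ R w)
        (fun w => j ∈ R w), Finset.filter_filter, Finset.filter_filter, add_comm]
    have h2 : Uj.card + (N.filter fun w => i ∈ R w ∧ j ∈ R w).card
        = (N.filter fun w => j ∈ R w).card := by
      rw [← Finset.card_filter_add_card_filter_not (s := N.filter fun w => j ∈ R w)
        (fun w => i ∈ R w), Finset.filter_filter, Finset.filter_filter, add_comm]
      congr 2
      ext w
      simp only [Finset.mem_filter]
      tauto
    omega
  obtain ⟨u, huU, hpu⟩ : ∃ u ∈ Ui, p u ∉ Uj := by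
    by_contra hcon
    push Not at hcon
    apply absurd (Finset.card_le_card_of_injOn p hcon _) (not_le.2 hcard)
    intro u hu u' hu' heq
    obtain ⟨-, hne, hmk, -⟩ := hp u (hUX u hu)
    obtain ⟨-, hne', hmk', hun'⟩ := hp u' (hUX u' hu')
    rcases hun' u (hUX u hu) (by rw [← hmk, heq, hmk']) with h1 | h1
    · exact h1
    · exact absurd (heq.trans h1.symm) hne
  obtain ⟨huN, hui, huj⟩ := Finset.mem_filter.1 huU
  obtain ⟨hpX, hpne, hpmk, hpun⟩ := hp u (hUX u huU)
  obtain ⟨φ', hφ', hpal⟩ := hK {K.connectedComponentMk u}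
  refine ⟨φ', _, h.of_swap hi hj hφ' (T := {u, p u}) ?_ ?_, ?_⟩
  · intro w hw
    rw [hpal, if_pos]
    simp only [Finset.mem_insert, Finset.mem_singleton] at hw
    rcases hw with rfl | rfl
    · rfl
    · exact hpmk
  · intro w hw
    rw [hpal]
    split_ifs with hc
    · apply image_swap_eq_self
      by_contra hcon
      rcases hpun w ((hX w).2 hcon) hc with rfl | rfl <;> simp at hw
    · rfl
  · apply sum_sq_card_filter_lt hi hj hij huN hui huj (by simp) Finset.card_le_two _ hlt
    intro w hw hwN hwj
    simp only [Finset.mem_insert, Finset.mem_singleton] at hw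
    rcases hw with rfl | rfl
    · exact hui
    · by_contra hwi
      exact hpu (Finset.mem_filter.2 ⟨hwN, hwj, hwi⟩)

theorem IsMissingChoice.exists_card_eq_one (h : IsMissingChoice B C N z φ R) (hz : z ∈ N)
    (hN : N.card ≤ C.card) :
    ∃ φ' R', IsMissingChoice B C N z φ' R' ∧ ∃ i ∈ C, (N.filter fun w => i ∈ R' w).card = 1 := by
  let S : Set ((Sym2 V → ℕ) × (V → Finset ℕ)) := {p | IsMissingChoice B C N z p.1 p.2}
  obtain ⟨⟨ψ, Q⟩, hmin, hnot⟩ := WellFounded.has_min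
    (measure fun p : (Sym2 V → ℕ) × (V → Finset ℕ) =>
      ∑ c ∈ C, (N.filter fun w => c ∈ p.2 w).card ^ 2).wf S ⟨(φ, R), h⟩
  have hψ : IsMissingChoice B C N z ψ Q := hmin
  refine ⟨ψ, Q, hψ, ?_⟩
  have hdiff : ∀ i ∈ C, ∀ j ∈ C,
      (N.filter fun w => i ∈ Q w).card ≤ (N.filter fun w => j ∈ Q w).card + 2 := by
    intro i hi j hj
    by_contra hcon
    obtain ⟨φ', R', h', hlt⟩ := hψ.exists_lt hi hj (by omega)
    exact hnot (φ', R') h' hlt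
  have hsum : ∑ i ∈ C, (N.filter fun w => i ∈ Q w).card + 1 = 2 * N.card := by
    have h1 : ∑ i ∈ C, (N.filter fun w => i ∈ Q w).card = ∑ w ∈ N, (Q w).card := by
      refine (Finset.sum_card_bipartiteAbove_eq_sum_card_bipartiteBelow
        (fun i w => i ∈ Q w)).trans (Finset.sum_congr rfl ?_)
      intro w hw
      congr 1
      ext c
      simp only [Finset.mem_filter, Finset.bipartiteBelow]
      exact ⟨fun hc => hc.2, fun hc => ⟨(Finset.mem_sdiff.1 (hψ.subset w hw hc)).1, hc⟩⟩
    rw [h1, ← Finset.add_sum_erase N _ hz, hψ.card z hz, if_pos rfl,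
      Finset.sum_congr rfl (g := fun _ => 2), Finset.sum_const, Finset.card_erase_of_mem hz]
    · have := Finset.card_pos.2 ⟨z, hz⟩
      simp only [smul_eq_mul]
      omega
    · intro w hw
      rw [hψ.card w (Finset.mem_of_mem_erase hw), if_neg (Finset.ne_of_mem_erase hw)]
  by_contra hcon
  push Not at hcon
  obtain ⟨i, hi, hi0⟩ : ∃ i ∈ C, (N.filter fun w => i ∈ Q w).card = 0 := by
    by_contra hcon0
    push Not at hcon0
    have : ∑ _i ∈ C, 2 ≤ ∑ i ∈ C, (N.filter fun w => i ∈ Q w).card := by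
      apply Finset.sum_le_sum
      intro i hi
      have := hcon i hi
      have := hcon0 i hi
      omega
    rw [Finset.sum_const, smul_eq_mul] at this
    omega
  have heven : Even (∑ j ∈ C, (N.filter fun w => j ∈ Q w).card) := by
    apply Finset.even_sum
    intro j hj
    have h1 := hdiff j hj i hi
    have h2 := hcon j hj
    have : (N.filter fun w => j ∈ Q w).card = 0 ∨ (N.filter fun w => j ∈ Q w).card = 2 := by
      omega
    rcases this with h | h <;> simp [h]
  obtain ⟨m, hm⟩ := heven
  omega

/-- All edges between `v` and `N`. -/
def starAt (v : V) (N : Finset V) : SimpleGraph V :=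
  SimpleGraph.fromRel fun x y => x = v ∧ y ∈ N

/-- The edges of `B` whose color is not `i`. -/
def avoidColor (B : SimpleGraph V) (φ : Sym2 V → ℕ) (i : ℕ) : SimpleGraph V where
  Adj x y := B.Adj x y ∧ φ s(x, y) ≠ i
  symm := ⟨fun x y hxy => by rw [Sym2.eq_swap]; exact ⟨hxy.1.symm, hxy.2⟩⟩
  loopless := ⟨fun x hx => B.loopless.irrefl x hx.1⟩

/-- The edges of `B` colored `i`, together with the edge `{u, v}`. -/
def colorClassInsert (B : SimpleGraph V) (φ : Sym2 V → ℕ) (i : ℕ) (u v : V) : SimpleGraph V :=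
  SimpleGraph.fromRel fun x y => (B.Adj x y ∧ φ s(x, y) = i) ∨ (x = v ∧ y = u)

theorem colorClassInsert_adj {i : ℕ} {u v x y : V} (huv : u ≠ v) :
    (colorClassInsert B φ i u v).Adj x y ↔
      (B.Adj x y ∧ φ s(x, y) = i) ∨ (x = v ∧ y = u) ∨ (x = u ∧ y = v) := by
  rw [colorClassInsert, SimpleGraph.fromRel_adj, Sym2.eq_swap (a := y), B.adj_comm y x]
  constructor
  · tauto
  · rintro (h | ⟨rfl, rfl⟩ | ⟨rfl, rfl⟩)
    · exact ⟨h.1.ne, Or.inl (Or.inl h)⟩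
    · exact ⟨huv.symm, Or.inl (Or.inr ⟨rfl, rfl⟩)⟩
    · exact ⟨huv, Or.inr (Or.inr ⟨rfl, rfl⟩)⟩

theorem exists_properOn_of_avoidColor (h : ProperOn B C φ) {i : ℕ} (hi : i ∈ C) {u v : V}
    (huN : u ∈ N) (hvN : v ∉ N) (hB : ∀ w, ¬ B.Adj v w) (hup : i ∉ palette B φ u)
    {χ : Sym2 V → ℕ} (hχ : ProperOn (avoidColor B φ i ⊔ starAt v (N.erase u)) (C.erase i) χ) :
    ∃ φ', ProperOn (B ⊔ starAt v N) C φ' := by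
  have huv : u ≠ v := fun h => hvN (h ▸ huN)
  refine ProperOn.exists_of_sdiff_matching (M := colorClassInsert B φ i u v) (i := i) (φ := χ)
    (hχ.mono ?_ subset_rfl) hi ?_
  · intro x y hxy
    rw [SimpleGraph.sdiff_adj, colorClassInsert_adj huv] at hxy
    obtain ⟨hxy, hM⟩ := hxy
    simp only [SimpleGraph.sup_adj, starAt, SimpleGraph.fromRel_adj, Finset.mem_erase] at hxy ⊢
    rcases hxy with h | ⟨hne, ⟨hx, h⟩ | ⟨hy, h⟩⟩
    · exact Or.inl ⟨h, fun h' => hM (Or.inl ⟨h, h'⟩)⟩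
    · exact Or.inr ⟨hne, Or.inl ⟨hx, fun h' => hM (Or.inr (Or.inl ⟨hx, h'⟩)), h⟩⟩
    · exact Or.inr ⟨hne, Or.inr ⟨hy, fun h' => hM (Or.inr (Or.inr ⟨h', hy⟩)), h⟩⟩
  · intro x y w hxy hxw
    rw [colorClassInsert_adj huv] at hxy hxw
    rcases hxy with h1 | ⟨h1, h2⟩ | ⟨h1, h2⟩ <;> rcases hxw with h' | ⟨h', h''⟩ | ⟨h', h''⟩
    · exact h.eq h1.1 h'.1 (h1.2.trans h'.2.symm)
    · exact absurd h1.1 (h' ▸ hB y)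
    · exact absurd (mem_palette.2 ⟨y, h' ▸ h1⟩) hup
    · exact absurd h'.1 (h1 ▸ hB w)
    · exact h2.trans h''.symm
    · exact absurd (h'.symm.trans h1) huv
    · exact absurd (mem_palette.2 ⟨w, h1 ▸ h'⟩) hup
    · exact absurd (h1.symm.trans h') huv
    · exact h2.trans h''.symm

theorem exists_properOn_sup_starAt {v : V} (m : ℕ) : ∀ (B : SimpleGraph V) (C : Finset ℕ)
    (N : Finset V) (z : V) (φ : Sym2 V → ℕ), N.card = m → (∀ u, ¬ B.Adj v u) → v ∉ N →
    ProperOn B C φ → N.card ≤ C.card → (∀ u ∈ N, 1 ≤ (C \ palette B φ u).card) →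
    (∀ u ∈ N, u ≠ z → 2 ≤ (C \ palette B φ u).card) →
    ∃ φ', ProperOn (B ⊔ starAt v N) C φ' := by
  induction m with
  | zero =>
    intro B C N z φ hm _ _ hφ _ _ _
    rw [Finset.card_eq_zero] at hm
    refine ⟨φ, hφ.mono ?_ subset_rfl⟩
    intro x y hxy
    rw [SimpleGraph.sup_adj, starAt, SimpleGraph.fromRel_adj, hm] at hxy
    simpa using hxy
  | succ m ih =>
    intro B C N z φ hm hB hvN hφ hNC h1 h2
    obtain ⟨z', hz', hne⟩ : ∃ z' ∈ N, ∀ u ∈ N, u ≠ z' → u ≠ z := by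
      by_cases hz : z ∈ N
      · exact ⟨z, hz, fun _ _ h => h⟩
      · obtain ⟨z', hz'⟩ := (Finset.card_pos (s := N)).1 (by omega)
        exact ⟨z', hz', fun u hu _ huz => hz (huz ▸ hu)⟩
    have hR : ∀ u, ∃ R : Finset ℕ, u ∈ N →
        R ⊆ C \ palette B φ u ∧ R.card = if u = z' then 1 else 2 := by
      intro u
      by_cases hu : u ∈ N
      · obtain ⟨R, hR⟩ := Finset.exists_subset_card_eq (s := C \ palette B φ u)
          (n := if u = z' then 1 else 2) (by
            split_ifs with huz
            · exact h1 u hu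
            · exact h2 u hu (hne u hu huz))
        exact ⟨R, fun _ => hR⟩
      · exact ⟨∅, fun h => absurd h hu⟩
    choose R hR using hR
    obtain ⟨ψ, Q, hψ, i, hi, hcard⟩ := IsMissingChoice.exists_card_eq_one (z := z')
      ⟨hφ, fun u hu => (hR u hu).1, fun u hu => (hR u hu).2⟩ hz' hNC
    obtain ⟨u, hu⟩ := Finset.card_eq_one.1 hcard
    have huF : u ∈ N ∧ i ∈ Q u := by
      rw [← Finset.mem_filter (s := N) (p := fun w => i ∈ Q w), hu]
      exact Finset.mem_singleton_self u
    obtain ⟨huN, hui⟩ := huF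
    have hup : i ∉ palette B ψ u := (Finset.mem_sdiff.1 (hψ.subset u huN hui)).2
    have hmiss : ∀ w ∈ N.erase u, Q w ⊆ C.erase i \ palette (avoidColor B ψ i) ψ w := by
      intro w hw c hc
      obtain ⟨hwu, hwN⟩ := Finset.mem_erase.1 hw
      obtain ⟨hcC, hcp⟩ := Finset.mem_sdiff.1 (hψ.subset w hwN hc)
      refine Finset.mem_sdiff.2 ⟨Finset.mem_erase.2 ⟨?_, hcC⟩, ?_⟩
      · rintro rfl
        have : w ∈ N.filter fun w => c ∈ Q w := Finset.mem_filter.2 ⟨hwN, hc⟩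
        rw [hu, Finset.mem_singleton] at this
        exact hwu this
      · intro h
        obtain ⟨x, hx, rfl⟩ := mem_palette.1 h
        exact hcp (mem_palette.2 ⟨x, hx.1, rfl⟩)
    have hmissc : ∀ w ∈ N.erase u, (if w = z' then 1 else 2) ≤ (C.erase i \ palette (avoidColor B ψ i) ψ w).card := by
      intro w hw
      rw [← hψ.card w (Finset.mem_of_mem_erase hw)]
      exact Finset.card_le_card (hmiss w hw)
    obtain ⟨χ, hχ⟩ := ih (avoidColor B ψ i) (C.erase i) (N.erase u) z' ψ
      (by rw [Finset.card_erase_of_mem huN]; omega) (fun w hw => hB w hw.1)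
      (fun h => hvN (Finset.mem_of_mem_erase h))
      ⟨fun x y hxy => Finset.mem_erase.2 ⟨hxy.2, hψ.proper.mem hxy.1⟩,
        fun x y w hxy hxw => hψ.proper.eq hxy.1 hxw.1⟩
      (by rw [Finset.card_erase_of_mem huN, Finset.card_erase_of_mem hi]; omega)
      (fun w hw => by
        have := hmissc w hw
        split_ifs at this <;> omega)
      (fun w hw hwz => by simpa [hwz] using hmissc w hw)
    exact exists_properOn_of_avoidColor hψ.proper hi huN hvN hB hup hχ

/-- The edges of `Q` that avoid the vertex `v`. -/
def avoidVertex (Q : SimpleGraph V) (v : V) : SimpleGraph V where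
  Adj x y := Q.Adj x y ∧ x ≠ v ∧ y ≠ v
  symm := ⟨fun _ _ hxy => ⟨hxy.1.symm, hxy.2.2, hxy.2.1⟩⟩
  loopless := ⟨fun x hx => Q.loopless.irrefl x hx.1⟩

/-- A graph can be properly colored if every nonempty subgraph has a non-isolated vertex all of
whose neighbors but one have a degree smaller than the number of colors. -/
theorem exists_properOn_of_degenerate {C : Finset ℕ} (Q : SimpleGraph V)
    (hQ : ∀ v, Q.degree v ≤ C.card)
    (h : ∀ Q' ≤ Q, Q' ≠ ⊥ → ∃ v z, (∃ w, Q'.Adj v w) ∧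
      ∀ u, Q'.Adj v u → u ≠ z → Q'.degree u < C.card) :
    ∃ φ, ProperOn Q C φ := by
  induction hm : Q.edgeFinset.card using Nat.strong_induction_on generalizing Q with
  | _ m ih =>
    subst hm
    by_cases hbot : Q = ⊥
    · refine ⟨fun _ => 0, ?_, ?_⟩ <;> simp [hbot]
    obtain ⟨v, z, ⟨w, hvw⟩, hz⟩ := h Q le_rfl hbot
    obtain ⟨B, hBdef⟩ : ∃ B, B = avoidVertex Q v := ⟨_, rfl⟩
    have hBadj : ∀ x y, B.Adj x y ↔ Q.Adj x y ∧ x ≠ v ∧ y ≠ v := fun x y => by rw [hBdef]; rfl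
    have hBQ : B ≤ Q := fun x y hxy => ((hBadj x y).1 hxy).1
    have hBlt : B < Q := lt_of_le_of_ne hBQ fun heq => by
      rw [← heq, hBadj] at hvw
      exact hvw.2.1 rfl
    obtain ⟨φ, hφ⟩ := ih _ (Finset.card_lt_card (SimpleGraph.edgeFinset_ssubset_edgeFinset.2 hBlt))
      B (fun u => (SimpleGraph.degree_le_of_le hBQ).trans (hQ u))
      (fun Q' hQ' => h Q' (hQ'.trans hBQ)) rfl
    have hmiss : ∀ u, Q.Adj v u → (C \ palette B φ u).card + Q.degree u ≥ C.card + 1 := by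
      intro u hu
      have hlt : B.degree u < Q.degree u := by
        rw [← SimpleGraph.card_neighborFinset_eq_degree, ← SimpleGraph.card_neighborFinset_eq_degree]
        apply Finset.card_lt_card
        rw [Finset.ssubset_iff_of_subset]
        · exact ⟨v, by simpa using hu.symm, by simp [hBadj]⟩
        · intro x hx
          rw [SimpleGraph.mem_neighborFinset] at hx ⊢
          exact hBQ hx
      rw [Finset.card_sdiff_of_subset (hφ.palette_subset u), hφ.card_palette u]
      have := hQ u
      omega
    obtain ⟨φ', hφ'⟩ := exists_properOn_sup_starAt (v := v) _ B C (Q.neighborFinset v) z φ rfl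
      (fun u hu => ((hBadj v u).1 hu).2.1 rfl) (by simp) hφ
      (by rw [SimpleGraph.card_neighborFinset_eq_degree]; exact hQ v)
      (fun u hu => by
        have := hmiss u (by simpa using hu)
        have := hQ u
        omega)
      (fun u hu huz => by
        have := hmiss u (by simpa using hu)
        have := hz u (by simpa using hu) huz
        omega)
    refine ⟨φ', hφ'.mono ?_ subset_rfl⟩
    intro x y hxy
    rw [SimpleGraph.sup_adj, starAt, SimpleGraph.fromRel_adj]
    by_cases hx : x = v
    · right
      subst hx
      exact ⟨hxy.ne, Or.inl ⟨rfl, by simpa using hxy⟩⟩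
    by_cases hy : y = v
    · right
      subst hy
      exact ⟨hxy.ne, Or.inr ⟨rfl, by simpa using hxy.symm⟩⟩
    · exact Or.inl ((hBadj x y).2 ⟨hxy, hx, hy⟩)

/-- Vizing's theorem. -/
theorem exists_properOn_of_degree_lt {C : Finset ℕ} (Q : SimpleGraph V)
    (hQ : ∀ v, Q.degree v < C.card) : ∃ φ, ProperOn Q C φ := by
  apply exists_properOn_of_degenerate Q fun v => (hQ v).le
  intro Q' hQ' hne
  obtain ⟨v, w, hvw⟩ := SimpleGraph.ne_bot_iff_exists_adj.1 hne
  exact ⟨v, v, ⟨w, hvw⟩, fun u _ _ => (SimpleGraph.degree_le_of_le hQ').trans_lt (hQ u)⟩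

end StarExtension

section PathFactor

open scoped Classical

theorem exists_injOn_of_weights {ι α : Type*} [Fintype α] (J : Finset ι) (w : ι → α → ℕ) {m : ℕ}
    (hm : 0 < m) (hrow : ∀ i ∈ J, m ≤ ∑ a, w i a) (hcol : ∀ a, ∑ i ∈ J, w i a ≤ m) :
    ∃ f : J → α, Function.Injective f ∧ ∀ i : J, w i (f i) ≠ 0 := by
  have hall := (Finset.all_card_le_biUnion_card_iff_exists_injective
    (fun i : J => Finset.univ.filter fun a => w i a ≠ 0)).1 ?_
  · obtain ⟨f, hf, hmem⟩ := hall
    exact ⟨f, hf, fun i => (Finset.mem_filter.1 (hmem i)).2⟩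
  intro A
  set T := A.biUnion fun i : J => Finset.univ.filter fun a => w i a ≠ 0 with hT
  have h1 : A.card * m ≤ ∑ i ∈ A, ∑ a ∈ T, w i a := by
    rw [← smul_eq_mul, ← Finset.sum_const]
    apply Finset.sum_le_sum
    intro i hi
    refine (hrow i i.2).trans (Finset.sum_subset (Finset.subset_univ T) ?_).ge
    intro a _ ha
    by_contra hne
    exact ha (Finset.mem_biUnion.2 ⟨i, hi, Finset.mem_filter.2 ⟨Finset.mem_univ _, hne⟩⟩)
  have h2 : ∑ i ∈ A, ∑ a ∈ T, w i a ≤ T.card * m := by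
    rw [Finset.sum_comm, ← smul_eq_mul, ← Finset.sum_const]
    apply Finset.sum_le_sum
    intro a _
    calc ∑ i ∈ A, w i a ≤ ∑ i : J, w i a := Finset.sum_le_sum_of_subset (Finset.subset_univ A)
      _ = ∑ i ∈ J, w i a := Finset.sum_coe_sort J fun i => w i a
      _ ≤ m := hcol a
  exact Nat.le_of_mul_le_mul_right (h1.trans h2) hm

variable {V : Type*} [Fintype V]

theorem exists_le_minimal {P : SimpleGraph V → Prop} {G : SimpleGraph V} (hG : P G) :
    ∃ H ≤ G, P H ∧ ∀ H' ≤ H, P H' → H' = H := by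
  obtain ⟨H, hH, hmin⟩ := exists_minimal_le_of_wellFoundedLT P G hG
  exact ⟨H, hH, hmin.1, fun H' hle hP => le_antisymm hle (hmin.2 hP hle)⟩

/-- The graph `G` without the edge `{x, y}`. -/
def eraseEdge (G : SimpleGraph V) (x y : V) : SimpleGraph V := G.deleteEdges {s(x, y)}

theorem eraseEdge_adj {G : SimpleGraph V} {x y u v : V} :
    (eraseEdge G x y).Adj u v ↔ G.Adj u v ∧ ¬((u = x ∧ v = y) ∨ (u = y ∧ v = x)) := by
  rw [eraseEdge, SimpleGraph.deleteEdges_adj, Set.mem_singleton_iff, Sym2.eq_iff]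

theorem eraseEdge_le (G : SimpleGraph V) (x y : V) : eraseEdge G x y ≤ G :=
  SimpleGraph.deleteEdges_le _

theorem eraseEdge_comm (G : SimpleGraph V) (x y : V) : eraseEdge G x y = eraseEdge G y x := by
  rw [eraseEdge, Sym2.eq_swap, eraseEdge]

theorem neighborFinset_eraseEdge_left {G : SimpleGraph V} {x y : V} :
    (eraseEdge G x y).neighborFinset x = (G.neighborFinset x).erase y := by
  ext w
  simp only [SimpleGraph.mem_neighborFinset, eraseEdge_adj, Finset.mem_erase]
  constructor
  · rintro ⟨h1, h2⟩
    exact ⟨fun h => h2 (Or.inl (by simpa using h)), h1⟩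
  · rintro ⟨h1, h2⟩
    refine ⟨h2, ?_⟩
    rintro (⟨-, h⟩ | ⟨h, h'⟩)
    · exact h1 h
    · exact G.loopless.irrefl x (h' ▸ h2)

theorem degree_eraseEdge_left {G : SimpleGraph V} {x y : V} (hxy : G.Adj x y) :
    (eraseEdge G x y).degree x + 1 = G.degree x := by
  rw [← SimpleGraph.card_neighborFinset_eq_degree, ← SimpleGraph.card_neighborFinset_eq_degree,
    neighborFinset_eraseEdge_left]
  exact Finset.card_erase_add_one (by simpa using hxy)

theorem degree_eraseEdge_right {G : SimpleGraph V} {x y : V} (hxy : G.Adj x y) :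
    (eraseEdge G x y).degree y + 1 = G.degree y := by
  rw [eraseEdge_comm]
  exact degree_eraseEdge_left hxy.symm

theorem degree_eraseEdge_of_ne {G : SimpleGraph V} {x y w : V} (hx : w ≠ x) (hy : w ≠ y) :
    (eraseEdge G x y).degree w = G.degree w := by
  rw [← SimpleGraph.card_neighborFinset_eq_degree, ← SimpleGraph.card_neighborFinset_eq_degree]
  congr 1
  ext u
  simp [eraseEdge_adj, hx, hy]

theorem exists_le_degree_mem_Icc {G : SimpleGraph V} {d : ℕ} (hd : 2 ≤ d)
    (hG : ∀ v, G.degree v = d) : ∃ H ≤ G, ∀ v, 2 ≤ H.degree v ∧ H.degree v ≤ 4 := by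
  have hsum : ∀ v, ∑ y, (if G.Adj v y then 1 else 0) = d := by
    intro v
    rw [Finset.sum_boole, ← hG v, ← SimpleGraph.card_neighborFinset_eq_degree]
    simp only [Nat.cast_id]
    congr 1
    ext y
    simp
  obtain ⟨f, hf, hfadj⟩ := exists_injOn_of_weights (Finset.univ : Finset V)
    (fun v y => if G.Adj v y then 1 else 0) (m := d) (by omega) (fun v _ => (hsum v).ge)
    (fun y => by simp only [G.adj_comm _ y]; exact (hsum y).le)
  obtain ⟨σ, hσdef⟩ : ∃ σ : V → V, ∀ v, σ v = f ⟨v, Finset.mem_univ v⟩ := ⟨_, fun _ => rfl⟩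
  have hσ : Function.Injective σ := fun u v huv => by
    rw [hσdef, hσdef] at huv
    exact congrArg Subtype.val (hf huv)
  have hσadj : ∀ v, G.Adj v (σ v) := fun v => by
    have := hfadj ⟨v, Finset.mem_univ v⟩
    rw [← hσdef] at this
    simpa using this
  have hσsurj : Function.Surjective σ := Finite.surjective_of_injective hσ
  obtain ⟨g, hg, hgadj⟩ := exists_injOn_of_weights (Finset.univ : Finset V)
    (fun v y => if G.Adj v y ∧ y ≠ σ v then 1 else 0) (m := d - 1) (by omega) (fun v _ => by
      have h1 : ∑ y, (if G.Adj v y then 1 else 0) ≤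
          ∑ y, ((if G.Adj v y ∧ y ≠ σ v then 1 else 0) + if y = σ v then 1 else 0) := by
        apply Finset.sum_le_sum
        intro y _
        split_ifs <;> first | omega | tauto
      rw [hsum, Finset.sum_add_distrib, Finset.sum_ite_eq' Finset.univ (σ v) (fun _ => 1),
        if_pos (Finset.mem_univ _)] at h1
      omega)
    (fun y => by
      obtain ⟨u, rfl⟩ := hσsurj y
      have h1 : ∑ v, ((if G.Adj v (σ u) ∧ σ u ≠ σ v then 1 else 0) + if v = u then 1 else 0) ≤
          ∑ v, (if G.Adj (σ u) v then 1 else 0) := by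
        apply Finset.sum_le_sum
        intro v _
        by_cases h2 : v = u
        · subst h2
          simp [(hσadj v).symm]
        · have : σ u ≠ σ v := fun h => h2 (hσ h).symm
          simp [h2, this, G.adj_comm v]
      rw [hsum, Finset.sum_add_distrib, Finset.sum_ite_eq' Finset.univ u (fun _ => 1),
        if_pos (Finset.mem_univ _)] at h1
      omega)
  obtain ⟨τ, hτdef⟩ : ∃ τ : V → V, ∀ v, τ v = g ⟨v, Finset.mem_univ v⟩ := ⟨_, fun _ => rfl⟩
  have hτ : Function.Injective τ := fun u v huv => by
    rw [hτdef, hτdef] at huv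
    exact congrArg Subtype.val (hg huv)
  have hτadj : ∀ v, G.Adj v (τ v) ∧ τ v ≠ σ v := fun v => by
    have := hgadj ⟨v, Finset.mem_univ v⟩
    rw [← hτdef] at this
    simpa using this
  have hτsurj : Function.Surjective τ := Finite.surjective_of_injective hτ
  refine ⟨SimpleGraph.fromRel fun u v => v = σ u ∨ v = τ u, ?_, ?_⟩
  · intro u v huv
    rw [SimpleGraph.fromRel_adj] at huv
    obtain ⟨-, (rfl | rfl) | (rfl | rfl)⟩ := huv
    · exact hσadj u
    · exact (hτadj u).1
    · exact (hσadj v).symm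
    · exact (hτadj v).1.symm
  · intro v
    obtain ⟨a, ha⟩ := hσsurj v
    obtain ⟨b, hb⟩ := hτsurj v
    rw [← SimpleGraph.card_neighborFinset_eq_degree]
    constructor
    · calc 2 = ({τ v, σ v} : Finset V).card := (Finset.card_pair (hτadj v).2).symm
        _ ≤ _ := Finset.card_le_card (by
          intro w hw
          simp only [Finset.mem_insert, Finset.mem_singleton] at hw
          rw [SimpleGraph.mem_neighborFinset, SimpleGraph.fromRel_adj]
          rcases hw with rfl | rfl
          · exact ⟨(hτadj v).1.ne, Or.inl (Or.inr rfl)⟩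
          · exact ⟨(hσadj v).ne, Or.inl (Or.inl rfl)⟩)
    · calc _ ≤ ({σ v, τ v, a, b} : Finset V).card := Finset.card_le_card (by
          intro w hw
          simp only [Finset.mem_insert, Finset.mem_singleton]
          rw [SimpleGraph.mem_neighborFinset, SimpleGraph.fromRel_adj] at hw
          obtain ⟨-, (h | h) | (h | h)⟩ := hw
          · exact Or.inl h
          · exact Or.inr (Or.inl h)
          · exact Or.inr (Or.inr (Or.inl (hσ (h.symm.trans ha.symm))))
          · exact Or.inr (Or.inr (Or.inr (hτ (h.symm.trans hb.symm)))))
        _ ≤ 4 := Finset.card_le_four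

theorem exists_le_degree_mem_Icc_of_independent {G : SimpleGraph V}
    (hG : ∀ v, 2 ≤ G.degree v ∧ G.degree v ≤ 4) :
    ∃ H ≤ G, (∀ v, 2 ≤ H.degree v ∧ H.degree v ≤ 4) ∧
      ∀ x y, H.Adj x y → 3 ≤ H.degree x → H.degree y = 2 := by
  obtain ⟨H, hHG, hH, hmin⟩ := exists_le_minimal (P := fun H => ∀ v, 2 ≤ H.degree v)
    (G := G) (fun v => (hG v).1)
  refine ⟨H, hHG, fun v => ⟨hH v, (SimpleGraph.degree_le_of_le hHG).trans (hG v).2⟩, ?_⟩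
  intro x y hxy hx
  by_contra hy
  have := hH y
  have hlt : eraseEdge H x y = H := by
    apply hmin _ (eraseEdge_le _ _ _)
    intro v
    by_cases hvx : v = x
    · subst hvx
      have := degree_eraseEdge_left hxy
      omega
    by_cases hvy : v = y
    · subst hvy
      have := degree_eraseEdge_right hxy
      omega
    rw [degree_eraseEdge_of_ne hvx hvy]
    exact hH v
  have h1 := degree_eraseEdge_left hxy
  rw [hlt] at h1
  omega

/-- Every component is a cycle or a path with at least three vertices. -/
structure IsPathFactor (H : SimpleGraph V) : Prop where
  one_le : ∀ v, 1 ≤ H.degree v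
  le_two : ∀ v, H.degree v ≤ 2
  edge : ∀ x y, H.Adj x y → H.degree x = 2 ∨ H.degree y = 2

/-- The closed neighborhood of `y` without the vertices of degree at least three. -/
noncomputable def slot (G : SimpleGraph V) (y : V) : Finset V :=
  (insert y (G.neighborFinset y)).filter fun w => G.degree w ≤ 2

theorem sum_card_slot_eq_le_two {G : SimpleGraph V}
    (hI : ∀ x y, G.Adj x y → 3 ≤ G.degree x → G.degree y = 2) (s : Finset V) :
    ∑ x ∈ Finset.univ.filter (fun x => 3 ≤ G.degree x),
      ((G.neighborFinset x).filter fun y => slot G y = s).card ≤ 2 := by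
  set I := Finset.univ.filter (fun x => 3 ≤ G.degree x) with hIdef
  set Y := s.filter fun y => G.degree y = 2 ∧ slot G y = s with hY
  have h1 : ∀ x ∈ I, ((G.neighborFinset x).filter fun y => slot G y = s)
      ⊆ Y.bipartiteAbove (fun x y => G.Adj x y) x := by
    intro x hx y hy
    have hx3 := (Finset.mem_filter.1 hx).2
    simp only [Finset.mem_filter, SimpleGraph.mem_neighborFinset, Finset.bipartiteAbove, hY] at hy ⊢
    have hy2 := hI x y hy.1 hx3
    refine ⟨⟨?_, hy2, hy.2⟩, hy.1⟩
    rw [← hy.2, slot]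
    simp [hy2]
  have h2 : ∀ y ∈ Y, (I.bipartiteBelow (fun x y => G.Adj x y) y).card + s.card ≤ 3 := by
    intro y hy
    simp only [Finset.mem_filter, hY] at hy
    have hs : s = insert y ((G.neighborFinset y).filter fun w => G.degree w ≤ 2) := by
      rw [← hy.2.2, slot, Finset.filter_insert, if_pos hy.2.1.le]
    have hcard : s.card = ((G.neighborFinset y).filter fun w => G.degree w ≤ 2).card + 1 := by
      rw [hs, Finset.card_insert_of_notMem (by simp)]
    have hI' : I.bipartiteBelow (fun x y => G.Adj x y) y
        = (G.neighborFinset y).filter fun w => ¬ G.degree w ≤ 2 := by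
      ext w
      simp only [Finset.bipartiteBelow, Finset.mem_filter, hIdef, Finset.mem_univ, true_and,
        SimpleGraph.mem_neighborFinset, G.adj_comm w y, not_le]
      exact and_comm
    have := Finset.card_filter_add_card_filter_not (s := G.neighborFinset y)
      (fun w => G.degree w ≤ 2)
    rw [SimpleGraph.card_neighborFinset_eq_degree, hy.2.1] at this
    rw [hI', hcard]
    omega
  calc _ ≤ ∑ x ∈ I, (Y.bipartiteAbove (fun x y => G.Adj x y) x).card :=
        Finset.sum_le_sum fun x hx => Finset.card_le_card (h1 x hx)
    _ = ∑ y ∈ Y, (I.bipartiteBelow (fun x y => G.Adj x y) y).card :=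
        Finset.sum_card_bipartiteAbove_eq_sum_card_bipartiteBelow _
    _ ≤ ∑ _y ∈ Y, (3 - s.card) := Finset.sum_le_sum fun y hy => by
        have := h2 y hy
        omega
    _ = Y.card * (3 - s.card) := by rw [Finset.sum_const, smul_eq_mul]
    _ ≤ s.card * (3 - s.card) := Nat.mul_le_mul_right _ (Finset.card_filter_le _ _)
    _ ≤ 2 := by
        rcases Nat.lt_or_ge s.card 3 with h | h
        · interval_cases s.card <;> simp
        · simp [Nat.sub_eq_zero_of_le h]

theorem exists_slot_choice {G : SimpleGraph V}
    (hI : ∀ x y, G.Adj x y → 3 ≤ G.degree x → G.degree y = 2) :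
    ∃ (J : Finset (V × Bool)) (y : V × Bool → V),
      (∀ x t, (x, t) ∈ J ↔ 3 ≤ G.degree x ∧ (t = true → G.degree x = 4)) ∧
      (∀ p ∈ J, G.Adj p.1 (y p)) ∧
      ∀ p ∈ J, ∀ q ∈ J, slot G (y p) = slot G (y q) → p = q := by
  let J : Finset (V × Bool) := Finset.univ.filter fun p =>
    3 ≤ G.degree p.1 ∧ (p.2 = true → G.degree p.1 = 4)
  have hJ : ∀ x t, (x, t) ∈ J ↔ 3 ≤ G.degree x ∧ (t = true → G.degree x = 4) := by
    intro x t
    simp [J]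
  let c : V → Finset V → ℕ := fun x s => ((G.neighborFinset x).filter fun y => slot G y = s).card
  have hc : ∀ x, ∑ s, c x s = G.degree x := by
    intro x
    rw [← SimpleGraph.card_neighborFinset_eq_degree]
    exact (Finset.card_eq_sum_card_fiberwise fun _ _ => Finset.mem_univ _).symm
  obtain ⟨f, hf, hfne⟩ := exists_injOn_of_weights J
    (fun p s => (if G.degree p.1 = 4 then 1 else 2) * c p.1 s) (m := 4) (by omega) (by
      rintro ⟨x, t⟩ hp
      rw [← Finset.mul_sum, hc]
      have := ((hJ x t).1 hp).1
      dsimp only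
      split_ifs <;> omega)
    (by
      intro s
      have hsub : J ⊆ (Finset.univ.filter fun x => 3 ≤ G.degree x) ×ˢ Finset.univ := by
        rintro ⟨x, t⟩ hp
        simpa using ((hJ x t).1 hp).1
      calc ∑ p ∈ J, (if G.degree p.1 = 4 then 1 else 2) * c p.1 s
          = ∑ p ∈ (Finset.univ.filter fun x => 3 ≤ G.degree x) ×ˢ Finset.univ,
            if p ∈ J then (if G.degree p.1 = 4 then 1 else 2) * c p.1 s else 0 := by
            rw [Finset.sum_ite_mem, Finset.inter_eq_right.2 hsub]
        _ ≤ ∑ x ∈ Finset.univ.filter (fun x => 3 ≤ G.degree x), 2 * c x s := by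
            rw [Finset.sum_product]
            apply Finset.sum_le_sum
            intro x hx
            have hx3 := (Finset.mem_filter.1 hx).2
            rw [Fintype.sum_bool]
            simp only [hJ]
            by_cases h4 : G.degree x = 4
            · simp [h4]
              omega
            · simp [h4, hx3]
        _ ≤ 4 := by
            rw [← Finset.mul_sum]
            have := sum_card_slot_eq_le_two hI s
            change 2 * ∑ x ∈ _, ((G.neighborFinset x).filter fun y => slot G y = s).card ≤ 4
            omega)
  have hy : ∀ p, ∃ y, ∀ hp : p ∈ J, G.Adj p.1 y ∧ slot G y = f ⟨p, hp⟩ := by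
    intro p
    by_cases hp : p ∈ J
    · have h1 : c p.1 (f ⟨p, hp⟩) ≠ 0 := (mul_ne_zero_iff.1 (hfne ⟨p, hp⟩)).2
      obtain ⟨y, hy⟩ := Finset.card_pos.1 (Nat.pos_of_ne_zero h1)
      rw [Finset.mem_filter, SimpleGraph.mem_neighborFinset] at hy
      exact ⟨y, fun _ => hy⟩
    · exact ⟨p.1, fun h => absurd h hp⟩
  choose y hy using hy
  refine ⟨J, y, hJ, fun p hp => (hy p hp).1, fun p hp q hq heq => ?_⟩
  rw [(hy p hp).2, (hy q hq).2] at heq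
  exact congrArg Subtype.val (hf heq)

theorem exists_isPathFactor_of_independent {G : SimpleGraph V}
    (hG : ∀ v, 2 ≤ G.degree v ∧ G.degree v ≤ 4)
    (hI : ∀ x y, G.Adj x y → 3 ≤ G.degree x → G.degree y = 2) : ∃ H ≤ G, IsPathFactor H := by
  obtain ⟨J, y, hJ, hadj, hslot⟩ := exists_slot_choice hI
  obtain ⟨H, hH⟩ : ∃ H : SimpleGraph V, H = G \ SimpleGraph.fromRel fun u v =>
      ∃ p ∈ J, p.1 = u ∧ y p = v := ⟨_, rfl⟩
  have hHG : H ≤ G := hH ▸ sdiff_le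
  have hJ3 : ∀ p ∈ J, 3 ≤ G.degree p.1 := fun p hp => ((hJ p.1 p.2).1 hp).1
  have hy2 : ∀ p ∈ J, G.degree (y p) = 2 := fun p hp => hI _ _ (hadj p hp) (hJ3 p hp)
  have hbig : ∀ x, 3 ≤ G.degree x → H.degree x = 2 := by
    intro x hx
    have hN : H.neighborFinset x = G.neighborFinset x \ (J.filter fun p => p.1 = x).image y := by
      ext w
      simp only [hH, SimpleGraph.mem_neighborFinset, SimpleGraph.sdiff_adj, Finset.mem_sdiff,
        SimpleGraph.fromRel_adj, Finset.mem_image, Finset.mem_filter]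
      refine and_congr_right fun hxw => not_congr ⟨?_, ?_⟩
      · rintro ⟨-, ⟨p, hp, h1, h2⟩ | ⟨p, hp, h1, h2⟩⟩
        · exact ⟨p, ⟨hp, h1⟩, h2⟩
        · have := hy2 p hp
          rw [h2] at this
          omega
      · rintro ⟨p, ⟨hp, h1⟩, h2⟩
        exact ⟨hxw.ne, Or.inl ⟨p, hp, h1, h2⟩⟩
    have hsub : (J.filter fun p => p.1 = x).image y ⊆ G.neighborFinset x := by
      intro w hw
      obtain ⟨p, hp, rfl⟩ := Finset.mem_image.1 hw
      obtain ⟨hpJ, rfl⟩ := Finset.mem_filter.1 hp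
      simpa using hadj p hpJ
    have hcard : ((J.filter fun p => p.1 = x).image y).card = G.degree x - 2 := by
      rw [Finset.card_image_of_injOn]
      · by_cases h4 : G.degree x = 4
        · have : (J.filter fun p => p.1 = x) = {(x, true), (x, false)} := by
            ext ⟨u, t⟩
            simp only [Finset.mem_filter, hJ, Finset.mem_insert, Finset.mem_singleton,
              Prod.mk.injEq]
            constructor
            · rintro ⟨-, rfl⟩
              cases t <;> simp
            · rintro (⟨rfl, rfl⟩ | ⟨rfl, rfl⟩) <;> simp [h4]
          rw [this, h4]
          simp
        · have : (J.filter fun p => p.1 = x) = {(x, false)} := by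
            ext ⟨u, t⟩
            simp only [Finset.mem_filter, hJ, Finset.mem_singleton, Prod.mk.injEq]
            constructor
            · rintro ⟨⟨-, h⟩, rfl⟩
              cases t
              · simp
              · exact absurd (h rfl) h4
            · rintro ⟨rfl, rfl⟩
              simp [hx]
          have h4' := (hG x).2
          have h3 : G.degree x = 3 := by omega
          rw [this, h3]
          simp
      · intro p hp q hq heq
        exact hslot p (Finset.mem_filter.1 hp).1 q (Finset.mem_filter.1 hq).1 (by rw [heq])
    rw [← SimpleGraph.card_neighborFinset_eq_degree, hN, Finset.card_sdiff_of_subset hsub, hcard,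
      SimpleGraph.card_neighborFinset_eq_degree]
    omega
  have hsmall : ∀ v, G.degree v = 2 → 1 ≤ H.degree v ∧
      (H.degree v ≠ 2 → ∃ p ∈ J, y p = v) := by
    intro v hv
    set D := (J.filter fun p => y p = v).image Prod.fst with hD
    have hN : H.neighborFinset v = G.neighborFinset v \ D := by
      ext w
      simp only [hD, hH, SimpleGraph.mem_neighborFinset, SimpleGraph.sdiff_adj, Finset.mem_sdiff,
        SimpleGraph.fromRel_adj, Finset.mem_image, Finset.mem_filter]
      refine and_congr_right fun hvw => not_congr ⟨?_, ?_⟩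
      · rintro ⟨-, ⟨p, hp, h1, h2⟩ | ⟨p, hp, h1, h2⟩⟩
        · have := hJ3 p hp
          rw [h1] at this
          omega
        · exact ⟨p, ⟨hp, h2⟩, h1⟩
      · rintro ⟨p, ⟨hp, h1⟩, h2⟩
        exact ⟨hvw.ne, Or.inr ⟨p, hp, h2, h1⟩⟩
    have hsub : D ⊆ G.neighborFinset v := by
      intro w hw
      obtain ⟨p, hp, rfl⟩ := Finset.mem_image.1 hw
      obtain ⟨hpJ, rfl⟩ := Finset.mem_filter.1 hp
      simpa using (hadj p hpJ).symm
    have hcard : D.card ≤ 1 := by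
      refine Finset.card_image_le.trans (Finset.card_le_one.2 ?_)
      intro p hp q hq
      simp only [Finset.mem_filter] at hp hq
      exact hslot p hp.1 q hq.1 (by rw [hp.2, hq.2])
    rw [← SimpleGraph.card_neighborFinset_eq_degree, hN, Finset.card_sdiff_of_subset hsub,
      SimpleGraph.card_neighborFinset_eq_degree, hv]
    refine ⟨by omega, fun hne => ?_⟩
    have hpos : 0 < D.card := by omega
    obtain ⟨w, hw⟩ := Finset.card_pos.1 hpos
    obtain ⟨p, hp, -⟩ := Finset.mem_image.1 hw
    exact ⟨p, Finset.mem_filter.1 hp⟩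
  have htwo : ∀ v, G.degree v = 2 ∨ 3 ≤ G.degree v := fun v => by
    have := (hG v).1
    omega
  refine ⟨H, hHG, fun v => ?_, fun v => ?_, fun u v huv => ?_⟩
  · rcases htwo v with h | h
    · exact (hsmall v h).1
    · rw [hbig v h]
      omega
  · rcases htwo v with h | h
    · exact (SimpleGraph.degree_le_of_le hHG).trans h.le
    · rw [hbig v h]
  · by_contra hcon
    push Not at hcon
    have hu : G.degree u = 2 := (htwo u).resolve_right fun h => hcon.1 (hbig u h)
    have hv : G.degree v = 2 := (htwo v).resolve_right fun h => hcon.2 (hbig v h)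
    obtain ⟨p, hp, hpu⟩ := (hsmall u hu).2 hcon.1
    obtain ⟨q, hq, hqv⟩ := (hsmall v hv).2 hcon.2
    have key : ∀ {a b : V} {p : V × Bool}, p ∈ J → y p = a → G.Adj a b → G.degree a = 2 →
        G.degree b = 2 → slot G a = {a, b} := by
      rintro a b p hp rfl hab ha hb
      have hne : p.1 ≠ b := fun h => by
        have := hJ3 p hp
        rw [h] at this
        omega
      have hN : G.neighborFinset (y p) = {p.1, b} := by
        symm
        apply Finset.eq_of_subset_of_card_le
        · intro w hw
          simp only [Finset.mem_insert, Finset.mem_singleton] at hw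
          rw [SimpleGraph.mem_neighborFinset]
          rcases hw with rfl | rfl
          · exact (hadj p hp).symm
          · exact hab
        · rw [SimpleGraph.card_neighborFinset_eq_degree, ha, Finset.card_pair hne]
      have h3 : ¬ G.degree p.1 ≤ 2 := by
        have := hJ3 p hp
        omega
      rw [slot, hN, Finset.filter_insert, if_pos ha.le, Finset.filter_insert, if_neg h3,
        Finset.filter_singleton, if_pos hb.le]
    have hpq : p = q := hslot p hp q hq (by
      rw [hpu, hqv, key hp hpu (hHG huv) hu hv, key hq hqv (hHG huv).symm hv hu, Finset.pair_comm])
    rw [← hpq, hpu] at hqv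
    exact huv.ne hqv

theorem IsPathFactor.exists_le_leaf {H : SimpleGraph V} (hH : IsPathFactor H) :
    ∃ H' ≤ H, IsPathFactor H' ∧ ∀ x y, H'.Adj x y → H'.degree x = 2 → H'.degree y = 2 →
      (∃ w, H'.Adj x w ∧ H'.degree w = 1) ∨ ∃ w, H'.Adj y w ∧ H'.degree w = 1 := by
  obtain ⟨K, hKH, hK, hmin⟩ := exists_le_minimal hH
  refine ⟨K, hKH, hK, ?_⟩
  intro x y hxy hx hy
  by_contra hcon
  push Not at hcon
  have hdx := degree_eraseEdge_left hxy
  have hdy := degree_eraseEdge_right hxy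
  have h2 : ∀ w, (K.Adj x w ∨ K.Adj y w) → K.degree w = 2 := by
    intro w hw
    have h1 := hK.one_le w
    have h2 := hK.le_two w
    have h3 : K.degree w ≠ 1 := hw.elim (hcon.1 w) (hcon.2 w)
    omega
  have hlt : eraseEdge K x y = K := by
    refine hmin _ (eraseEdge_le _ _ _) ⟨fun v => ?_, fun v => ?_, fun u v huv => ?_⟩
    · by_cases hvx : v = x
      · subst hvx
        omega
      by_cases hvy : v = y
      · subst hvy
        omega
      rw [degree_eraseEdge_of_ne hvx hvy]
      exact hK.one_le v
    · exact (SimpleGraph.degree_le_of_le (eraseEdge_le _ _ _)).trans (hK.le_two v)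
    · have key : ∀ u v, (eraseEdge K x y).Adj u v → (u = x ∨ u = y) →
          (eraseEdge K x y).degree v = 2 := by
        intro u v huv hu
        rw [eraseEdge_adj] at huv
        have hne := huv.1.ne
        have hvx : v ≠ x := by
          rintro rfl
          rcases hu with rfl | rfl
          · exact hne rfl
          · exact huv.2 (Or.inr ⟨rfl, rfl⟩)
        have hvy : v ≠ y := by
          rintro rfl
          rcases hu with rfl | rfl
          · exact huv.2 (Or.inl ⟨rfl, rfl⟩)
          · exact hne rfl
        rw [degree_eraseEdge_of_ne hvx hvy]
        apply h2
        rcases hu with rfl | rfl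
        · exact Or.inl huv.1
        · exact Or.inr huv.1
      by_cases hu : u = x ∨ u = y
      · exact Or.inr (key u v huv hu)
      by_cases hv : v = x ∨ v = y
      · exact Or.inl (key v u huv.symm hv)
      push Not at hu hv
      rw [degree_eraseEdge_of_ne hu.1 hu.2, degree_eraseEdge_of_ne hv.1 hv.2]
      exact hK.edge u v (eraseEdge_le _ _ _ huv)
  rw [hlt] at hdx
  omega

theorem exists_isPathFactor {G : SimpleGraph V} {d : ℕ} (hd : 2 ≤ d)
    (hG : ∀ v, G.degree v = d) :
    ∃ H ≤ G, IsPathFactor H ∧ ∀ x y, H.Adj x y → H.degree x = 2 → H.degree y = 2 →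
      (∃ w, H.Adj x w ∧ H.degree w = 1) ∨ ∃ w, H.Adj y w ∧ H.degree w = 1 := by
  obtain ⟨A, hA, hA'⟩ := exists_le_degree_mem_Icc hd hG
  obtain ⟨B, hB, hB', hI⟩ := exists_le_degree_mem_Icc_of_independent hA'
  obtain ⟨D, hD, hD'⟩ := exists_isPathFactor_of_independent hB' hI
  obtain ⟨H, hH, hH'⟩ := hD'.exists_le_leaf
  exact ⟨H, hH.trans (hD.trans (hB.trans hA)), hH'⟩

end PathFactor

section TieBreaking

open scoped Classical

variable {V β : Type*} [Fintype V] [Fintype β] {H : SimpleGraph V} {f : V → β}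

/-- Two distinct leaves with the same value of `f` and a common neighbor. -/
def HasTwinLeaf (H : SimpleGraph V) (f : V → β) (u : V) : Prop :=
  ∃ w, w ≠ u ∧ f w = f u ∧ H.degree w = 1 ∧ ∃ x, H.Adj u x ∧ H.Adj w x

/-- Leaves with the same value of `f` are merged unless they have a common neighbor. -/
noncomputable def mergeLeaf (H : SimpleGraph V) (f : V → β) (u : V) : V ⊕ β × Bool :=
  if H.degree u = 1 ∧ ¬ HasTwinLeaf H f u then Sum.inr (f u, true) else Sum.inl u

/-- The graph obtained from `H` by merging leaves, and by joining the vertices of degree two that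
have the same value of `f` to a new vertex. -/
def tieGraph (H : SimpleGraph V) (f : V → β) : SimpleGraph (V ⊕ β × Bool) :=
  SimpleGraph.fromRel fun p q =>
    (∃ u v, H.Adj u v ∧ p = mergeLeaf H f u ∧ q = mergeLeaf H f v) ∨
      ∃ v, H.degree v = 2 ∧ p = Sum.inl v ∧ q = Sum.inr (f v, false)

theorem mergeLeaf_of_degree_ne {u : V} (hu : H.degree u ≠ 1) : mergeLeaf H f u = Sum.inl u := by
  rw [mergeLeaf, if_neg (fun h => hu h.1)]

theorem eq_of_mergeLeaf_eq_inl {u v : V} (h : mergeLeaf H f u = Sum.inl v) : u = v := by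
  rw [mergeLeaf] at h
  split_ifs at h
  exact Sum.inl.inj h

theorem mergeLeaf_eq_inr {u : V} {b : β} {t : Bool} (h : mergeLeaf H f u = Sum.inr (b, t)) :
    f u = b ∧ t = true ∧ H.degree u = 1 ∧ ¬ HasTwinLeaf H f u := by
  rw [mergeLeaf] at h
  split_ifs at h with hu
  have := Prod.mk.inj (Sum.inr.inj h)
  exact ⟨this.1, this.2.symm, hu⟩

theorem mergeLeaf_injOn_neighbors {x y z : V} (hy : H.Adj x y) (hz : H.Adj x z)
    (h : mergeLeaf H f y = mergeLeaf H f z) : y = z := by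
  rcases hr : mergeLeaf H f z with w | ⟨b, t⟩
  · exact (eq_of_mergeLeaf_eq_inl (h.trans hr)).trans (eq_of_mergeLeaf_eq_inl hr).symm
  · obtain ⟨h1, -, h2, h3⟩ := mergeLeaf_eq_inr hr
    obtain ⟨h1', -, h2', h3'⟩ := mergeLeaf_eq_inr (h.trans hr)
    by_contra hne
    exact h3 ⟨y, hne, h1'.trans h1.symm, h2', x, hz.symm, hy.symm⟩

theorem tieGraph_adj_mergeLeaf (hH : IsPathFactor H) {u v : V} (huv : H.Adj u v) :
    (tieGraph H f).Adj (mergeLeaf H f u) (mergeLeaf H f v) := by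
  refine (SimpleGraph.fromRel_adj _ _ _).2 ⟨fun heq => ?_, Or.inl (Or.inl ⟨u, v, huv, rfl, rfl⟩)⟩
  rcases hH.edge u v huv with h | h
  · rw [mergeLeaf_of_degree_ne (by omega)] at heq
    exact huv.ne (eq_of_mergeLeaf_eq_inl heq.symm).symm
  · rw [mergeLeaf_of_degree_ne (u := v) (by omega)] at heq
    exact huv.ne (eq_of_mergeLeaf_eq_inl heq)

theorem tieGraph_adj_inr {v : V} (hv : H.degree v = 2) :
    (tieGraph H f).Adj (Sum.inl v) (Sum.inr (f v, false)) :=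
  (SimpleGraph.fromRel_adj _ _ _).2 ⟨by simp, Or.inl (Or.inr ⟨v, hv, rfl, rfl⟩)⟩

theorem of_tieGraph_adj_inl {v : V} {q : V ⊕ β × Bool} (h : (tieGraph H f).Adj (Sum.inl v) q) :
    (∃ u, H.Adj v u ∧ q = mergeLeaf H f u) ∨ (H.degree v = 2 ∧ q = Sum.inr (f v, false)) := by
  obtain ⟨-, (⟨u, w, huw, h1, h2⟩ | ⟨u, hu, h1, h2⟩) | (⟨u, w, huw, h1, h2⟩ | ⟨u, hu, h1, h2⟩)⟩ :=
    (SimpleGraph.fromRel_adj _ _ _).1 h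
  · rw [eq_of_mergeLeaf_eq_inl h1.symm] at huw
    exact Or.inl ⟨w, huw, h2⟩
  · rw [Sum.inl.inj h1]
    exact Or.inr ⟨hu, h2⟩
  · rw [eq_of_mergeLeaf_eq_inl h2.symm] at huw
    exact Or.inl ⟨u, huw.symm, h1⟩
  · exact absurd h2 (by simp)

theorem of_tieGraph_adj_inr {b : β} {t : Bool} {q : V ⊕ β × Bool}
    (h : (tieGraph H f).Adj (Sum.inr (b, t)) q) :
    (∃ u x, f u = b ∧ H.degree u = 1 ∧ t = true ∧ H.Adj u x ∧ q = mergeLeaf H f x) ∨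
      ∃ u, f u = b ∧ t = false ∧ q = Sum.inl u := by
  obtain ⟨-, (⟨u, w, huw, h1, h2⟩ | ⟨u, hu, h1, h2⟩) | (⟨u, w, huw, h1, h2⟩ | ⟨u, hu, h1, h2⟩)⟩ :=
    (SimpleGraph.fromRel_adj _ _ _).1 h
  · obtain ⟨h3, h4, h5, -⟩ := mergeLeaf_eq_inr h1.symm
    exact Or.inl ⟨u, w, h3, h5, h4, huw, h2⟩
  · exact absurd h1 (by simp)
  · obtain ⟨h3, h4, h5, -⟩ := mergeLeaf_eq_inr h2.symm
    exact Or.inl ⟨w, u, h3, h5, h4, huw.symm, h1⟩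
  · have := Prod.mk.inj (Sum.inr.inj h2)
    exact Or.inr ⟨u, this.1.symm, this.2, h1⟩

theorem tieGraph_degree_inl_le (v : V) :
    (tieGraph H f).degree (Sum.inl v) ≤ H.degree v + if H.degree v = 2 then 1 else 0 := by
  rw [← SimpleGraph.card_neighborFinset_eq_degree]
  have hsub : (tieGraph H f).neighborFinset (Sum.inl v) ⊆
      (H.neighborFinset v).image (mergeLeaf H f) ∪
        if H.degree v = 2 then {Sum.inr (f v, false)} else ∅ := by
    intro q hq
    rw [SimpleGraph.mem_neighborFinset] at hq
    rw [Finset.mem_union]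
    rcases of_tieGraph_adj_inl hq with ⟨u, hu, rfl⟩ | ⟨h, rfl⟩
    · exact Or.inl (Finset.mem_image_of_mem _ (by simpa using hu))
    · right
      simp [h]
  refine (Finset.card_le_card hsub).trans ((Finset.card_union_le _ _).trans ?_)
  have := Finset.card_image_le (s := H.neighborFinset v) (f := mergeLeaf H f)
  rw [SimpleGraph.card_neighborFinset_eq_degree] at this
  split_ifs <;> simp <;> omega

theorem tieGraph_degree_inr_le (hf : ∀ b, (Finset.univ.filter fun v => f v = b).card ≤ 2)
    (b : β) (t : Bool) : (tieGraph H f).degree (Sum.inr (b, t)) ≤ 2 := by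
  rw [← SimpleGraph.card_neighborFinset_eq_degree]
  cases t
  · have hsub : (tieGraph H f).neighborFinset (Sum.inr (b, false)) ⊆
        (Finset.univ.filter fun v => f v = b).image Sum.inl := by
      intro q hq
      rw [SimpleGraph.mem_neighborFinset] at hq
      rcases of_tieGraph_adj_inr hq with ⟨u, x, -, -, h, -⟩ | ⟨u, hu, -, rfl⟩
      · exact absurd h (by simp)
      · exact Finset.mem_image_of_mem _ (by simpa using hu)
    exact (Finset.card_le_card hsub).trans (Finset.card_image_le.trans (hf b))
  · have hsub : (tieGraph H f).neighborFinset (Sum.inr (b, true)) ⊆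
        ((Finset.univ.filter fun v => f v = b).filter fun v => H.degree v = 1).biUnion fun u =>
          (H.neighborFinset u).image (mergeLeaf H f) := by
      intro q hq
      rw [SimpleGraph.mem_neighborFinset] at hq
      rcases of_tieGraph_adj_inr hq with ⟨u, x, hu, h1, -, hux, rfl⟩ | ⟨u, -, h, -⟩
      · exact Finset.mem_biUnion.2 ⟨u, by simp [hu, h1],
          Finset.mem_image_of_mem _ (by simpa using hux)⟩
      · exact absurd h (by simp)
    refine (Finset.card_le_card hsub).trans ((Finset.card_biUnion_le_card_mul _ _ 1 ?_).trans ?_)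
    · intro u hu
      refine Finset.card_image_le.trans ?_
      rw [SimpleGraph.card_neighborFinset_eq_degree, (Finset.mem_filter.1 hu).2]
    · rw [mul_one]
      exact (Finset.card_filter_le _ _).trans (hf b)

theorem exists_properOn_tieGraph (hH : IsPathFactor H)
    (hleaf : ∀ x y, H.Adj x y → H.degree x = 2 → H.degree y = 2 →
      (∃ w, H.Adj x w ∧ H.degree w = 1) ∨ ∃ w, H.Adj y w ∧ H.degree w = 1)
    (hf : ∀ b, (Finset.univ.filter fun v => f v = b).card ≤ 2) {C : Finset ℕ} (hC : C.card = 3) :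
    ∃ φ, ProperOn (tieGraph H f) C φ := by
  have hthree : ∀ p, 3 ≤ (tieGraph H f).degree p → ∃ x, p = Sum.inl x ∧ H.degree x = 2 := by
    rintro (x | ⟨b, t⟩) hp
    · refine ⟨x, rfl, ?_⟩
      have h1 := tieGraph_degree_inl_le (H := H) (f := f) x
      have h2 := hH.le_two x
      split_ifs at h1 <;> omega
    · have := tieGraph_degree_inr_le (H := H) hf b t
      omega
  apply exists_properOn_of_degenerate
  · rw [hC]
    rintro (x | ⟨b, t⟩)
    · have h1 := tieGraph_degree_inl_le (H := H) (f := f) x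
      have h2 := hH.le_two x
      split_ifs at h1 <;> omega
    · have := tieGraph_degree_inr_le (H := H) hf b t
      omega
  intro Q hQ hne
  rw [hC]
  have hleafcase : ∀ y w, H.Adj y w → H.degree w = 1 → H.degree y = 2 →
      ∃ z, ∀ p, Q.Adj (Sum.inl y) p → p ≠ z → Q.degree p < 3 := by
    intro y w hyw hw hy
    have hcard : ((H.neighborFinset y).erase w).card = 1 := by
      rw [Finset.card_erase_of_mem (by simpa using hyw),
        SimpleGraph.card_neighborFinset_eq_degree, hy]
    obtain ⟨z, hz⟩ := Finset.card_eq_one.1 hcard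
    refine ⟨Sum.inl z, fun p hp hpz => ?_⟩
    by_contra hcon
    obtain ⟨x, rfl, hx⟩ := hthree p
      ((not_lt.1 hcon).trans (SimpleGraph.degree_le_of_le hQ))
    rcases of_tieGraph_adj_inl (hQ hp) with ⟨u, hu, heq⟩ | ⟨-, heq⟩
    · rw [eq_of_mergeLeaf_eq_inl heq.symm] at hu
      have hxw : x ≠ w := fun h => by
        rw [h] at hx
        omega
      have : x ∈ (H.neighborFinset y).erase w :=
        Finset.mem_erase.2 ⟨hxw, by simpa using hu⟩
      rw [hz, Finset.mem_singleton] at this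
      exact hpz (by rw [this])
    · exact absurd heq (by simp)
  by_cases hsmall : ∀ p, Q.degree p < 3
  · obtain ⟨v, w, hvw⟩ := SimpleGraph.ne_bot_iff_exists_adj.1 hne
    exact ⟨v, v, ⟨w, hvw⟩, fun u _ _ => hsmall u⟩
  push Not at hsmall
  obtain ⟨p, hp⟩ := hsmall
  obtain ⟨x, rfl, hx⟩ := hthree p (hp.trans (SimpleGraph.degree_le_of_le hQ))
  obtain ⟨q, hq⟩ : ((Q.neighborFinset (Sum.inl x)).erase (Sum.inr (f x, false))).Nonempty := by
    rw [← Finset.card_pos]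
    have := Finset.pred_card_le_card_erase (s := Q.neighborFinset (Sum.inl x))
      (a := Sum.inr (f x, false))
    rw [SimpleGraph.card_neighborFinset_eq_degree] at this
    omega
  obtain ⟨hqne, hq⟩ := Finset.mem_erase.1 hq
  rw [SimpleGraph.mem_neighborFinset] at hq
  rcases of_tieGraph_adj_inl (hQ hq) with ⟨y, hxy, rfl⟩ | ⟨-, h⟩
  swap
  · exact absurd h hqne
  by_cases hxleaf : ∃ w, H.Adj x w ∧ H.degree w = 1
  · obtain ⟨w, hxw, hw⟩ := hxleaf
    obtain ⟨z, hz⟩ := hleafcase x w hxw hw hx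
    exact ⟨_, z, ⟨_, hq⟩, hz⟩
  have hy1 : H.degree y ≠ 1 := fun h => hxleaf ⟨y, hxy, h⟩
  have hy : H.degree y = 2 := by
    have := hH.one_le y
    have := hH.le_two y
    omega
  rw [mergeLeaf_of_degree_ne hy1] at hq
  obtain ⟨w, hyw, hw⟩ := (hleaf x y hxy hx hy).resolve_left hxleaf
  obtain ⟨z, hz⟩ := hleafcase y w hyw hw hy
  exact ⟨_, z, ⟨_, hq.symm⟩, hz⟩

theorem eq_of_palette_eq_of_degree_two {C : Finset ℕ} (hC : C.card = 3) {φ : Sym2 (V ⊕ β × Bool) → ℕ}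
    (hφ : ProperOn (tieGraph H f) C φ) {ψ : Sym2 V → ℕ} (hψ : ProperOn H C ψ) (hH : IsPathFactor H)
    (hψφ : ∀ u v, ψ s(u, v) = φ s(mergeLeaf H f u, mergeLeaf H f v)) {u v : V}
    (huv : f u = f v) (hu : H.degree u = 2) (hv : H.degree v = 2)
    (hpal : palette H ψ u = palette H ψ v) : u = v := by
  have key : ∀ w, H.degree w = 2 → C \ palette H ψ w = {φ s(Sum.inl w, Sum.inr (f w, false))} := by
    intro w hw
    symm
    apply Finset.eq_of_subset_of_card_le
    · rw [Finset.singleton_subset_iff, Finset.mem_sdiff]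
      refine ⟨hφ.mem (tieGraph_adj_inr hw), fun hmem => ?_⟩
      obtain ⟨x, hwx, hx⟩ := mem_palette.1 hmem
      have hadj := tieGraph_adj_mergeLeaf (f := f) hH hwx
      rw [hψφ] at hx
      rw [mergeLeaf_of_degree_ne (u := w) (by omega)] at hx hadj
      have := hφ.eq hadj (tieGraph_adj_inr hw) hx
      exact absurd (mergeLeaf_eq_inr this).2.1 (by simp)
    · rw [Finset.card_sdiff_of_subset (hψ.palette_subset w), hψ.card_palette, hC, hw]
      simp
  have h1 := key u hu
  rw [hpal, key v hv, Finset.singleton_inj, ← huv] at h1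
  have hadj := (tieGraph_adj_inr (f := f) hv).symm
  rw [← huv] at hadj
  have := hφ.eq hadj (tieGraph_adj_inr hu).symm (by rw [Sym2.eq_swap, h1, Sym2.eq_swap])
  exact (Sum.inl.inj this).symm

theorem eq_of_palette_eq_of_degree_one {C : Finset ℕ} {φ : Sym2 (V ⊕ β × Bool) → ℕ}
    (hφ : ProperOn (tieGraph H f) C φ) {ψ : Sym2 V → ℕ} (hψ : ProperOn H C ψ) (hH : IsPathFactor H)
    (hψφ : ∀ u v, ψ s(u, v) = φ s(mergeLeaf H f u, mergeLeaf H f v))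
    (hf : ∀ b, (Finset.univ.filter fun v => f v = b).card ≤ 2) {u v : V}
    (huv : f u = f v) (hu : H.degree u = 1) (hv : H.degree v = 1)
    (hpal : palette H ψ u = palette H ψ v) : u = v := by
  by_contra hne
  obtain ⟨x, hx⟩ : ∃ x, H.Adj u x := (H.degree_pos_iff_exists_adj u).1 (by omega)
  obtain ⟨y, hvy, hy⟩ := mem_palette.1 (hpal ▸ mem_palette.2 ⟨x, hx, rfl⟩)
  have hunique : ∀ {a b c : V}, H.degree a = 1 → H.Adj a b → H.Adj a c → b = c := by
    intro a b c ha hb hc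
    rw [← SimpleGraph.card_neighborFinset_eq_degree] at ha
    exact Finset.card_le_one.1 ha.le b (by simpa using hb) c (by simpa using hc)
  have hnbr : ∀ {a b : V}, H.degree a = 1 → H.Adj a b → H.degree b ≠ 1 := by
    intro a b ha hab hb
    rcases hH.edge a b hab with h | h <;> omega
  by_cases hxy : x = y
  · subst hxy
    rw [Sym2.eq_swap, Sym2.eq_swap (a := u)] at hy
    exact hne (hψ.eq hvy.symm hx.symm hy).symm
  have hlone : ∀ a b a' b', a ≠ b → f a = f b → H.degree a = 1 → H.Adj a a' → H.Adj b b' →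
      H.degree b = 1 → a' ≠ b' → ¬ HasTwinLeaf H f a := by
    rintro a b a' b' hab hfab ha haa' hbb' hb ha'b' ⟨w, hwa, hfw, hw, z, haz, hwz⟩
    by_cases hwb : w = b
    · subst hwb
      exact ha'b' ((hunique ha haa' haz).trans (hunique hb hbb' hwz).symm)
    · have h3 : ({a, b, w} : Finset V).card ≤ 2 := by
        refine (Finset.card_le_card ?_).trans (hf (f a))
        intro c hc
        simp only [Finset.mem_insert, Finset.mem_singleton] at hc
        rcases hc with rfl | rfl | rfl <;> simp [hfab, hfw]
      rw [Finset.card_eq_three.2 ⟨a, b, w, hab, fun h => hwa h.symm, fun h => hwb h.symm, rfl⟩]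
        at h3
      omega
  have hru : mergeLeaf H f u = Sum.inr (f u, true) :=
    if_pos ⟨hu, hlone u v x y hne huv hu hx hvy hv hxy⟩
  have hrv : mergeLeaf H f v = Sum.inr (f u, true) := by
    rw [huv]
    exact if_pos ⟨hv, hlone v u y x (Ne.symm hne) huv.symm hv hvy hx hu (Ne.symm hxy)⟩
  have h1 := tieGraph_adj_mergeLeaf (f := f) hH hx
  have h2 := tieGraph_adj_mergeLeaf (f := f) hH hvy
  rw [hψφ, hψφ] at hy
  rw [hru] at h1 hy
  rw [hrv] at h2 hy
  have := hφ.eq h2 h1 hy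
  rw [mergeLeaf_of_degree_ne (hnbr hv hvy), mergeLeaf_of_degree_ne (hnbr hu hx)] at this
  exact hxy (Sum.inl.inj this).symm

/-- Three colors on a path factor suffice to separate the vertices of equal degree in pairs
prescribed by the fibers of `f`. -/
theorem exists_properOn_separating (hH : IsPathFactor H)
    (hleaf : ∀ x y, H.Adj x y → H.degree x = 2 → H.degree y = 2 →
      (∃ w, H.Adj x w ∧ H.degree w = 1) ∨ ∃ w, H.Adj y w ∧ H.degree w = 1)
    (hf : ∀ b, (Finset.univ.filter fun v => f v = b).card ≤ 2) {C : Finset ℕ} (hC : C.card = 3) :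
    ∃ ψ, ProperOn H C ψ ∧ ∀ u v, f u = f v → H.degree u = H.degree v →
      palette H ψ u = palette H ψ v → u = v := by
  obtain ⟨φ, hφ⟩ := exists_properOn_tieGraph hH hleaf hf hC
  obtain ⟨ψ, hψφ⟩ : ∃ ψ : Sym2 V → ℕ, ∀ u v,
      ψ s(u, v) = φ s(mergeLeaf H f u, mergeLeaf H f v) :=
    ⟨fun e => φ (e.map (mergeLeaf H f)), fun u v => rfl⟩
  have hψ : ProperOn H C ψ := by
    refine ⟨fun u v huv => ?_, fun u v w huv huw heq => ?_⟩
    · rw [hψφ]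
      exact hφ.mem (tieGraph_adj_mergeLeaf hH huv)
    · rw [hψφ, hψφ] at heq
      exact mergeLeaf_injOn_neighbors huv huw
        (hφ.eq (tieGraph_adj_mergeLeaf hH huv) (tieGraph_adj_mergeLeaf hH huw) heq)
  refine ⟨ψ, hψ, fun u v huv hdeg hpal => ?_⟩
  have h1 := hH.one_le u
  have h2 := hH.le_two u
  by_cases hu : H.degree u = 1
  · exact eq_of_palette_eq_of_degree_one hφ hψ hH hψφ hf huv hu (hdeg ▸ hu) hpal
  · have hu2 : H.degree u = 2 := by omega
    exact eq_of_palette_eq_of_degree_two hC hφ hψ hH hψφ huv hu2 (hdeg ▸ hu2) hpal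

end TieBreaking

section Balancing

open scoped Classical

variable {V : Type*} [Fintype V]

/-- A maximal involution matching points of value `r` with points of value `σ r`. -/
theorem exists_involutive_matching {α : Type*} (p : V → α) {σ : α → α}
    (hσ : Function.Involutive σ) :
    ∃ ν : V → V, Function.Involutive ν ∧
      (∀ u, ν u ≠ u → p (ν u) = σ (p u) ∧ σ (p u) ≠ p u) ∧
      ∀ u v, ν u = u → ν v = v → p v = σ (p u) → σ (p u) = p u := by
  obtain ⟨A, hA⟩ : ∃ A : Finset (V → V), A = Finset.univ.filter fun ν => Function.Involutive ν ∧
      ∀ u, ν u ≠ u → p (ν u) = σ (p u) ∧ σ (p u) ≠ p u := ⟨_, rfl⟩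
  have hne : A.Nonempty := by
    refine ⟨id, ?_⟩
    rw [hA, Finset.mem_filter]
    exact ⟨Finset.mem_univ _, fun _ => rfl, fun u hu => absurd rfl hu⟩
  obtain ⟨ν, hν, hmax⟩ := A.exists_max_image
    (fun ν => (Finset.univ.filter fun u => ν u ≠ u).card) hne
  have hν' := hν
  rw [hA, Finset.mem_filter] at hν'
  obtain ⟨-, hinv, hpair⟩ := hν'
  refine ⟨ν, hinv, hpair, fun u v hu hv huv => ?_⟩
  by_contra hcon
  have huvne : u ≠ v := by
    rintro rfl
    exact hcon huv.symm
  obtain ⟨μ, hμ⟩ : ∃ μ : V → V, μ = fun x => Equiv.swap u v (ν x) := ⟨_, rfl⟩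
  have hμu : μ u = v := by simp [hμ, hu]
  have hμv : μ v = u := by simp [hμ, hv]
  have hμx : ∀ x, x ≠ u → x ≠ v → μ x = ν x := by
    intro x hxu hxv
    rw [hμ]
    apply Equiv.swap_apply_of_ne_of_ne
    · intro h
      exact hxu (by rw [← hinv x, h, hu])
    · intro h
      exact hxv (by rw [← hinv x, h, hv])
  have hνx : ∀ x, x ≠ u → x ≠ v → ν x ≠ u ∧ ν x ≠ v := by
    intro x hxu hxv
    exact ⟨fun h => hxu (by rw [← hinv x, h, hu]), fun h => hxv (by rw [← hinv x, h, hv])⟩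
  have hμA : μ ∈ A := by
    rw [hA, Finset.mem_filter]
    refine ⟨Finset.mem_univ _, fun x => ?_, fun x hx => ?_⟩
    · by_cases hxu : x = u
      · rw [hxu, hμu, hμv]
      by_cases hxv : x = v
      · rw [hxv, hμv, hμu]
      rw [hμx x hxu hxv, hμx _ (hνx x hxu hxv).1 (hνx x hxu hxv).2, hinv]
    · by_cases hxu : x = u
      · rw [hxu, hμu]
        exact ⟨huv, hcon⟩
      by_cases hxv : x = v
      · rw [hxv, hμv, huv, hσ]
        exact ⟨rfl, fun h => hcon h.symm⟩
      rw [hμx x hxu hxv] at hx ⊢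
      exact hpair x hx
  have hlt : (Finset.univ.filter fun x => ν x ≠ x).card <
      (Finset.univ.filter fun x => μ x ≠ x).card := by
    apply Finset.card_lt_card
    rw [Finset.ssubset_iff_of_subset]
    · refine ⟨u, ?_, ?_⟩
      · simp [hμu, huvne.symm]
      · simp [hu]
    · intro x hx
      simp only [Finset.mem_filter, Finset.mem_univ, true_and] at hx ⊢
      have hxu : x ≠ u := fun h => hx (by rw [h, hu])
      have hxv : x ≠ v := fun h => hx (by rw [h, hv])
      rwa [hμx x hxu hxv]
  exact absurd (hmax μ hμA) (not_le.2 hlt)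

theorem card_fiber_add_card_fixed {p : V → Finset ℕ} {σ : Finset ℕ → Finset ℕ}
    (hσ : Function.Involutive σ) {ν : V → V} (hν : Function.Involutive ν)
    (hp : ∀ u, ν u ≠ u → p (ν u) = σ (p u)) {Q : V → Prop} (hQ : ∀ u, Q u → Q (ν u))
    (r : Finset ℕ) :
    (Finset.univ.filter fun u => Q u ∧ p u = r).card +
        (Finset.univ.filter fun u => ν u = u ∧ Q u ∧ p u = σ r).card =
      (Finset.univ.filter fun u => Q u ∧ p u = σ r).card +
        (Finset.univ.filter fun u => ν u = u ∧ Q u ∧ p u = r).card := by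
  have hsplit : ∀ r, (Finset.univ.filter fun u => Q u ∧ p u = r).card =
      (Finset.univ.filter fun u => ν u = u ∧ Q u ∧ p u = r).card +
      (Finset.univ.filter fun u => ν u ≠ u ∧ Q u ∧ p u = r).card := by
    intro r
    rw [← Finset.card_filter_add_card_filter_not (p := fun u => ν u = u), Finset.filter_filter,
      Finset.filter_filter]
    congr 2 <;> ext u <;> simp only [Finset.mem_filter, Finset.mem_univ, true_and, ne_eq] <;> tauto
  have hmatch : (Finset.univ.filter fun u => ν u ≠ u ∧ Q u ∧ p u = r).card =
      (Finset.univ.filter fun u => ν u ≠ u ∧ Q u ∧ p u = σ r).card := by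
    apply Finset.card_bij' (fun u _ => ν u) (fun u _ => ν u)
    · intro u hu
      simp only [Finset.mem_filter, Finset.mem_univ, true_and] at hu ⊢
      refine ⟨fun h => hu.1 (hν.injective h), hQ u hu.2.1, ?_⟩
      rw [hp u hu.1, hu.2.2]
    · intro u hu
      simp only [Finset.mem_filter, Finset.mem_univ, true_and] at hu ⊢
      refine ⟨fun h => hu.1 (hν.injective h), hQ u hu.2.1, ?_⟩
      rw [hp u hu.1, hu.2.2, hσ]
    · intro u _
      exact hν u
    · intro u _
      exact hν u
  rw [hsplit r, hsplit (σ r), hmatch]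
  omega

/-- The number of vertices with palette `R`. -/
noncomputable def paletteCount (G : SimpleGraph V) (φ : Sym2 V → ℕ) (R : Finset ℕ) : ℕ :=
  (Finset.univ.filter fun v => palette G φ v = R).card

/-- How far the palettes are from being taken at most twice each. -/
noncomputable def paletteExcess (G : SimpleGraph V) (C : Finset ℕ) (φ : Sym2 V → ℕ) : ℕ :=
  ∑ R ∈ C.powerset, (paletteCount G φ R - 2)

theorem image_swap_image_swap (a b : ℕ) (R : Finset ℕ) :
    (R.image (Equiv.swap a b)).image (Equiv.swap a b) = R := by
  rw [Finset.image_image, ← Equiv.coe_trans, Equiv.swap_swap]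
  exact Finset.image_id

theorem image_swap_eq_self_iff {a b : ℕ} {R : Finset ℕ} :
    R.image (Equiv.swap a b) = R ↔ (a ∈ R ↔ b ∈ R) := by
  refine ⟨fun h => ⟨fun ha => ?_, fun hb => ?_⟩, image_swap_eq_self⟩
  · rw [← h]
    exact Finset.mem_image.2 ⟨a, ha, Equiv.swap_apply_left a b⟩
  · rw [← h]
    exact Finset.mem_image.2 ⟨b, hb, Equiv.swap_apply_right a b⟩

theorem image_swap_subset {a b : ℕ} {C R : Finset ℕ} (ha : a ∈ C) (hb : b ∈ C) (hR : R ⊆ C) :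
    R.image (Equiv.swap a b) ⊆ C := by
  intro x hx
  obtain ⟨y, hy, rfl⟩ := Finset.mem_image.1 hx
  rw [Equiv.swap_apply_def]
  split_ifs
  · exact hb
  · exact ha
  · exact hR hy

theorem two_mul_sum_powerset_swap {a b : ℕ} {C : Finset ℕ} (ha : a ∈ C) (hb : b ∈ C)
    (g : Finset ℕ → ℕ) :
    2 * ∑ R ∈ C.powerset, g R = ∑ R ∈ C.powerset, (g R + g (R.image (Equiv.swap a b))) := by
  rw [Finset.sum_add_distrib, two_mul]
  congr 1
  have hmem : ∀ R ∈ C.powerset, R.image (Equiv.swap a b) ∈ C.powerset := fun R hR =>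
    Finset.mem_powerset.2 (image_swap_subset ha hb (Finset.mem_powerset.1 hR))
  exact Finset.sum_bij' (fun R _ => R.image (Equiv.swap a b))
    (fun R _ => R.image (Equiv.swap a b)) hmem hmem (fun R _ => image_swap_image_swap a b R)
    (fun R _ => image_swap_image_swap a b R) fun R _ => by rw [image_swap_image_swap]

variable {G : SimpleGraph V} {C : Finset ℕ} {φ : Sym2 V → ℕ}

theorem ProperOn.exists_move (h : ProperOn G C φ) {S : Finset ℕ} (hSC : S ⊆ C)
    (hS : 3 ≤ paletteCount G φ S) {a b : ℕ} (haS : a ∈ S) (hbC : b ∈ C) (hbS : b ∉ S)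
    (hS' : paletteCount G φ (S.image (Equiv.swap a b)) ≤ 2) :
    ∃ φ', ProperOn G C φ' ∧ paletteExcess G C φ' ≤ paletteExcess G C φ ∧
      (paletteExcess G C φ' < paletteExcess G C φ ∨
        paletteCount G φ (S.image (Equiv.swap a b)) ≠ 0 ∧
        3 ≤ paletteCount G φ' (S.image (Equiv.swap a b)) ∧
        ∃ R₀, ∀ R, paletteCount G φ R = 0 → R ≠ R₀ → paletteCount G φ' R = 0) := by
  have haC : a ∈ C := hSC haS
  have hab : a ≠ b := fun hh => hbS (hh ▸ haS)
  obtain ⟨σ, hσdef⟩ : ∃ σ : Finset ℕ → Finset ℕ, σ = fun R => R.image (Equiv.swap a b) := ⟨_, rfl⟩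
  have hσR : ∀ R : Finset ℕ, R.image (Equiv.swap a b) = σ R := fun R => by rw [hσdef]
  have hσ : Function.Involutive σ := by
    intro R
    rw [hσdef]
    exact image_swap_image_swap a b R
  have hSσ : σ S ≠ S := by
    rw [← hσR, Ne, image_swap_eq_self_iff]
    tauto
  rw [hσR] at hS' ⊢
  obtain ⟨ν, hν, hpair, hfix⟩ := exists_involutive_matching (palette G φ) hσ
  obtain ⟨X, hXdef⟩ : ∃ X : Finset V,
      X = Finset.univ.filter fun v => σ (palette G φ v) ≠ palette G φ v := ⟨_, rfl⟩
  have hX : ∀ v, v ∈ X ↔ ¬(a ∈ palette G φ v ↔ b ∈ palette G φ v) := by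
    intro v
    rw [← image_swap_eq_self_iff, hXdef, hσR]
    simp
  have hmemX : ∀ v, v ∈ X ↔ σ (palette G φ v) ≠ palette G φ v := by
    intro v
    rw [hXdef]
    simp
  have hνX : ∀ v ∈ X, ν v ∈ X := by
    intro v hv
    by_cases hvv : ν v = v
    · rwa [hvv]
    · rw [hmemX, (hpair v hvv).1, hσ]
      exact (hpair v hvv).2.symm
  obtain ⟨K, hflip, hcomp, hends⟩ := h.exists_kempe_components haC hbC hab hX hν hνX
  have hall := fun r => card_fiber_add_card_fixed (p := palette G φ) hσ hν (fun u hu => (hpair u hu).1)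
    (Q := fun _ => True) (fun _ _ => trivial) r
  simp only [true_and] at hall
  obtain ⟨F, hF⟩ : ∃ F : Finset ℕ → ℕ, ∀ R, F R =
    (Finset.univ.filter fun u => ν u = u ∧ palette G φ u = R).card := ⟨_, fun _ => rfl⟩
  have hnF : ∀ R, paletteCount G φ R + F (σ R) = paletteCount G φ (σ R) + F R := by
    intro R
    rw [hF, hF]
    exact hall R
  have hF0 : ∀ R, σ R ≠ R → F R = 0 ∨ F (σ R) = 0 := by
    intro R hR
    by_contra! hcon
    rw [hF, hF, Finset.card_ne_zero, Finset.card_ne_zero] at hcon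
    obtain ⟨⟨u, hu⟩, ⟨w, hw⟩⟩ := hcon
    simp only [Finset.mem_filter, Finset.mem_univ, true_and] at hu hw
    have := hfix u w hu.1 hw.1 (by rw [hw.2, hu.2])
    rw [hu.2] at this
    exact hR this
  have hFS : F S ≠ 0 := by
    have := hnF S
    omega
  obtain ⟨v, hv⟩ : ∃ v, ν v = v ∧ palette G φ v = S := by
    rw [hF, Finset.card_ne_zero] at hFS
    obtain ⟨v, hv⟩ := hFS
    exact ⟨v, by simpa using hv⟩
  have hvX : v ∈ X := by
    rw [hmemX, hv.2]
    exact hSσ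
  obtain ⟨w, hwX, hwv, hwfix, hwcomp, hwonly⟩ := hends v hvX hv.1
  obtain ⟨P, hP⟩ : ∃ P : V → Prop,
      ∀ u, P u ↔ K.connectedComponentMk u = K.connectedComponentMk v := ⟨_, fun _ => Iff.rfl⟩
  obtain ⟨φ', hφ', hpal⟩ := hflip {K.connectedComponentMk v}
  have hpal' : ∀ u, palette G φ' u = if P u then σ (palette G φ u) else palette G φ u := by
    intro u
    rw [hpal u]
    simp only [Set.mem_singleton_iff, hP, hσR]
  have hPν : ∀ u, P u → P (ν u) := by
    intro u hu
    by_cases huu : ν u = u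
    · rwa [huu]
    · rw [hP] at hu ⊢
      rw [hcomp u ((hmemX u).2 (hpair u huu).2), hu]
  obtain ⟨f, hf⟩ : ∃ f : Finset ℕ → ℕ, ∀ R, f R =
    (Finset.univ.filter fun u => ν u = u ∧ P u ∧ palette G φ u = R).card := ⟨_, fun _ => rfl⟩
  have hcount : ∀ R, paletteCount G φ' R + f R = paletteCount G φ R + f (σ R) := by
    intro R
    have h1 := card_fiber_add_card_fixed (p := palette G φ) hσ hν (fun u hu => (hpair u hu).1)
      hPν R
    rw [← hf, ← hf] at h1
    have h2 : paletteCount G φ R = (Finset.univ.filter fun u => P u ∧ palette G φ u = R).card +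
        (Finset.univ.filter fun u => ¬ P u ∧ palette G φ u = R).card := by
      rw [paletteCount, ← Finset.card_filter_add_card_filter_not (p := P), Finset.filter_filter,
        Finset.filter_filter]
      congr 2 <;> ext u <;> simp only [Finset.mem_filter, Finset.mem_univ, true_and] <;> tauto
    have h3 : paletteCount G φ' R =
        (Finset.univ.filter fun u => P u ∧ palette G φ u = σ R).card +
        (Finset.univ.filter fun u => ¬ P u ∧ palette G φ u = R).card := by
      rw [paletteCount, ← Finset.card_filter_add_card_filter_not (p := P), Finset.filter_filter,
        Finset.filter_filter]
      congr 2 <;> ext u <;> simp only [Finset.mem_filter, Finset.mem_univ, true_and, hpal']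
      · by_cases hu : P u
        · simp only [hu, if_true, true_and, and_true]
          exact hσ.eq_iff
        · simp [hu]
      · by_cases hu : P u <;> simp [hu]
    omega
  have hfF : ∀ R, f R ≤ F R := by
    intro R
    rw [hf, hF]
    apply Finset.card_le_card
    intro u hu
    simp only [Finset.mem_filter, Finset.mem_univ, true_and] at hu ⊢
    exact ⟨hu.1, hu.2.2⟩
  have hfS : 1 ≤ f S := by
    rw [hf]
    apply Finset.card_pos.2
    exact ⟨v, by simp [hv.1, hv.2, hP]⟩
  have hfv : ∀ R u, σ R ≠ R → ν u = u → P u → palette G φ u = R → u = v ∨ u = w := by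
    intro R u hR hu hPu huR
    exact hwonly u ((hmemX u).2 (by rwa [huR])) hu ((hP u).1 hPu)
  have hfS2 : f S ≤ 2 := by
    rw [hf]
    refine (Finset.card_le_card (t := {v, w}) fun u hu => ?_).trans Finset.card_le_two
    simp only [Finset.mem_filter, Finset.mem_univ, true_and] at hu
    have := hfv S u hSσ hu.1 hu.2.1 hu.2.2
    simpa using this
  have hpairle : ∀ R, paletteCount G φ' R - 2 + (paletteCount G φ' (σ R) - 2) ≤
      paletteCount G φ R - 2 + (paletteCount G φ (σ R) - 2) := by
    intro R
    have h1 := hcount R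
    have h2 := hcount (σ R)
    rw [hσ] at h2
    by_cases hR : σ R = R
    · rw [hR] at h1 ⊢
      omega
    · have h3 := hnF R
      have h4 := hF0 R hR
      have h5 := hfF R
      have h6 := hfF (σ R)
      omega
  have hcS := hcount S
  have hcS' := hcount (σ S)
  rw [hσ] at hcS'
  have hF0S := hF0 S hSσ
  have hfFS' := hfF (σ S)
  have hfFS := hfF S
  have hnFS := hnF S
  have hE := two_mul_sum_powerset_swap haC hbC fun R => paletteCount G φ R - 2
  have hE' := two_mul_sum_powerset_swap haC hbC fun R => paletteCount G φ' R - 2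
  simp only [hσR] at hE hE'
  have hEle : paletteExcess G C φ' ≤ paletteExcess G C φ := by
    have := Finset.sum_le_sum (s := C.powerset) fun R _ => hpairle R
    rw [paletteExcess, paletteExcess]
    omega
  refine ⟨φ', hφ', hEle, ?_⟩
  by_cases hbig : 3 ≤ paletteCount G φ' (σ S)
  · refine Or.inr ⟨by omega, hbig, σ (palette G φ w), fun R hR hRw => ?_⟩
    by_contra hne
    have h1 := hcount R
    have hσRne : σ R ≠ R := by
      intro hR'
      rw [hR'] at h1
      omega
    have h2 : f (σ R) ≠ 0 := by omega
    rw [hf, Finset.card_ne_zero] at h2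
    obtain ⟨u, hu⟩ := h2
    simp only [Finset.mem_filter, Finset.mem_univ, true_and] at hu
    rcases hfv (σ R) u (by rw [hσ]; exact hσRne.symm) hu.1 hu.2.1 hu.2.2 with rfl | rfl
    · have hRS : R = σ S := by rw [← hv.2, hu.2.2, hσ]
      rw [hRS] at hR
      omega
    · exact hRw (by rw [hu.2.2, hσ])
  · left
    have := Finset.sum_lt_sum (s := C.powerset) (fun R _ => hpairle R)
      ⟨S, Finset.mem_powerset.2 hSC, by omega⟩
    rw [paletteExcess, paletteExcess]
    omega

end Balancing

section Walking

open scoped Classical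

variable {V : Type*} [Fintype V] {G : SimpleGraph V} {C : Finset ℕ} {φ : Sym2 V → ℕ}

/-- The unused color sets obtained from `T` by exchanging one color. -/
noncomputable def unusedNeighbors (G : SimpleGraph V) (C : Finset ℕ) (φ : Sym2 V → ℕ)
    (T : Finset ℕ) : Finset (Finset ℕ) :=
  (C.powersetCard T.card).filter fun R => paletteCount G φ R = 0 ∧ (T \ R).card = 1

theorem image_swap_eq_insert_erase {a b : ℕ} {S : Finset ℕ} (ha : a ∈ S) (hb : b ∉ S) :
    S.image (Equiv.swap a b) = insert b (S.erase a) := by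
  have hab : a ≠ b := fun h => hb (h ▸ ha)
  ext x
  have hx : x ∈ S.image (Equiv.swap a b) ↔ Equiv.swap a b x ∈ S := by
    rw [Finset.mem_image]
    constructor
    · rintro ⟨y, hy, rfl⟩
      rwa [Equiv.swap_apply_self]
    · exact fun h => ⟨_, h, Equiv.swap_apply_self a b x⟩
  rw [hx, Finset.mem_insert, Finset.mem_erase, Equiv.swap_apply_def]
  split_ifs with h1 h2
  · subst h1
    simp [hb, hab]
  · subst h2
    simp [ha]
  · simp [h1, h2]

theorem ProperOn.exists_excess_lt_of_walk (t : ℕ) :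
    ∀ {φ : Sym2 V → ℕ} {S T : Finset ℕ}, ProperOn G C φ → S ⊆ C → T ⊆ C → S.card = T.card →
      3 ≤ paletteCount G φ S → (S \ T).card = t → t < (unusedNeighbors G C φ T).card →
      ∃ φ', ProperOn G C φ' ∧ paletteExcess G C φ' < paletteExcess G C φ := by
  induction t with
  | zero =>
    intro φ S T h hSC hTC hcard hS ht hZ
    have hST : S = T := Finset.eq_of_subset_of_card_le
      (Finset.sdiff_eq_empty_iff_subset.1 (Finset.card_eq_zero.1 ht)) hcard.ge
    subst hST
    obtain ⟨R, hR⟩ := Finset.card_pos.1 hZ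
    rw [unusedNeighbors, Finset.mem_filter, Finset.mem_powersetCard] at hR
    obtain ⟨⟨hRC, hRcard⟩, hR0, hSR⟩ := hR
    have hRS : (R \ S).card = 1 := by
      rw [← hSR]
      exact Finset.card_sdiff_comm hRcard
    obtain ⟨a, ha⟩ := Finset.card_eq_one.1 hSR
    obtain ⟨b, hb⟩ := Finset.card_eq_one.1 hRS
    have ha' : a ∈ S \ R := ha ▸ Finset.mem_singleton_self a
    have hb' : b ∈ R \ S := hb ▸ Finset.mem_singleton_self b
    rw [Finset.mem_sdiff] at ha' hb'
    have hRim : S.image (Equiv.swap a b) = R := by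
      rw [image_swap_eq_insert_erase ha'.1 hb'.2]
      ext x
      have h1 : x ∈ S \ R ↔ x = a := by rw [ha, Finset.mem_singleton]
      have h2 : x ∈ R \ S ↔ x = b := by rw [hb, Finset.mem_singleton]
      rw [Finset.mem_sdiff] at h1 h2
      rw [Finset.mem_insert, Finset.mem_erase]
      tauto
    obtain ⟨φ', hφ', -, hlt | ⟨hne, -⟩⟩ := h.exists_move hSC hS ha'.1 (hRC hb'.1) hb'.2
      (by rw [hRim, hR0]; omega)
    · exact ⟨φ', hφ', hlt⟩
    · rw [hRim] at hne
      exact absurd hR0 hne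
  | succ t ih =>
    intro φ S T h hSC hTC hcard hS ht hZ
    obtain ⟨a, ha⟩ : (S \ T).Nonempty := Finset.card_pos.1 (by omega)
    obtain ⟨b, hb⟩ : (T \ S).Nonempty := by
      rw [← Finset.card_pos, Finset.card_sdiff_comm hcard.symm]
      omega
    rw [Finset.mem_sdiff] at ha hb
    have him := image_swap_eq_insert_erase ha.1 hb.2
    have hS'C : S.image (Equiv.swap a b) ⊆ C := image_swap_subset (hSC ha.1) (hTC hb.1) hSC
    have hS'card : (S.image (Equiv.swap a b)).card = T.card := by
      rw [Finset.card_image_of_injective _ (Equiv.injective _), hcard]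
    have hS't : (S.image (Equiv.swap a b) \ T).card = t := by
      have : S.image (Equiv.swap a b) \ T = (S \ T).erase a := by
        rw [him]
        ext x
        simp only [Finset.mem_sdiff, Finset.mem_insert, Finset.mem_erase]
        constructor
        · rintro ⟨rfl | hx, hxT⟩
          · exact absurd hb.1 hxT
          · exact ⟨hx.1, hx.2, hxT⟩
        · rintro ⟨hx, hxS, hxT⟩
          exact ⟨Or.inr ⟨hx, hxS⟩, hxT⟩
      rw [this, Finset.card_erase_of_mem (Finset.mem_sdiff.2 ha), ht]
      rfl
    by_cases hbig : 3 ≤ paletteCount G φ (S.image (Equiv.swap a b))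
    · exact ih h hS'C hTC hS'card hbig hS't (by omega)
    obtain ⟨φ', hφ', hle, hlt | ⟨-, hbig', R₀, hR₀⟩⟩ :=
      h.exists_move hSC hS ha.1 (hTC hb.1) hb.2 (by omega)
    · exact ⟨φ', hφ', hlt⟩
    have hsub : unusedNeighbors G C φ T ⊆ insert R₀ (unusedNeighbors G C φ' T) := by
      intro R hR
      rw [unusedNeighbors, Finset.mem_filter] at hR
      by_cases hRR : R = R₀
      · exact Finset.mem_insert.2 (Or.inl hRR)
      · rw [Finset.mem_insert, unusedNeighbors, Finset.mem_filter]
        exact Or.inr ⟨hR.1, hR₀ R hR.2.1 hRR, hR.2.2⟩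
    have h1 := Finset.card_le_card hsub
    have h2 := Finset.card_insert_le R₀ (unusedNeighbors G C φ' T)
    obtain ⟨φ'', hφ'', hlt⟩ := ih hφ' hS'C hTC hS'card hbig' hS't (by omega)
    exact ⟨φ'', hφ'', hlt.trans_le hle⟩

theorem card_mul_card_sub_le_card_neighbors {R : Finset ℕ} (hR : R ⊆ C) :
    R.card * (C.card - R.card) ≤
      ((C.powersetCard R.card).filter fun T => (T \ R).card = 1).card := by
  rw [← Finset.card_sdiff_of_subset hR, ← Finset.card_product]
  apply Finset.card_le_card_of_injOn fun p => insert p.2 (R.erase p.1)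
  · rintro ⟨a, b⟩ hab
    rw [Finset.mem_coe, Finset.mem_product, Finset.mem_sdiff] at hab
    simp only at hab
    obtain ⟨ha, hbC, hbR⟩ := hab
    simp only [Finset.mem_coe, Finset.mem_filter, Finset.mem_powersetCard]
    have hbe : b ∉ R.erase a := fun h => hbR (Finset.mem_of_mem_erase h)
    have hpos := Finset.card_pos.2 ⟨a, ha⟩
    refine ⟨⟨Finset.insert_subset hbC ((Finset.erase_subset a R).trans hR), ?_⟩, ?_⟩
    · rw [Finset.card_insert_of_notMem hbe, Finset.card_erase_of_mem ha]
      omega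
    · rw [Finset.card_eq_one]
      refine ⟨b, ?_⟩
      ext x
      simp only [Finset.mem_sdiff, Finset.mem_insert, Finset.mem_erase, Finset.mem_singleton]
      constructor
      · rintro ⟨rfl | hx, hxR⟩
        · rfl
        · exact absurd hx.2 hxR
      · rintro rfl
        exact ⟨Or.inl rfl, hbR⟩
  · rintro ⟨a, b⟩ hab ⟨a', b'⟩ hab' heq
    simp only [Finset.coe_product, Set.mem_prod, Finset.mem_coe, Finset.mem_sdiff] at hab hab' heq
    have hx : ∀ x, (x = b ∨ x ≠ a ∧ x ∈ R) ↔ (x = b' ∨ x ≠ a' ∧ x ∈ R) := by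
      intro x
      rw [← Finset.mem_erase, ← Finset.mem_insert, heq, Finset.mem_insert, Finset.mem_erase]
    have hb : b = b' := by
      have := (hx b).1 (Or.inl rfl)
      tauto
    have ha : a = a' := by
      by_contra hne
      have := (hx a).2 (Or.inr ⟨hne, hab.1⟩)
      rcases this with rfl | h
      · exact hab.2.2 hab.1
      · exact h.1 rfl
    rw [ha, hb]

theorem exists_many_unusedNeighbors {s : ℕ} (hs : s < C.card)
    (hn : Fintype.card V * s < C.card.choose s * (s - 1)) :
    ∃ T ⊆ C, T.card = s ∧ C.card - s < (unusedNeighbors G C φ T).card := by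
  by_contra! hcon
  obtain ⟨Z, hZ⟩ : ∃ Z : Finset (Finset ℕ),
      Z = (C.powersetCard s).filter fun R => paletteCount G φ R = 0 := ⟨_, rfl⟩
  have hcardZ : C.card.choose s ≤ Z.card + Fintype.card V := by
    rw [← Finset.card_powersetCard, ← Finset.card_filter_add_card_filter_not
      (p := fun R => paletteCount G φ R = 0), ← hZ]
    gcongr
    refine (Finset.card_le_card (t := Finset.univ.image (palette G φ)) fun R hR => ?_).trans
      Finset.card_image_le
    rw [Finset.mem_filter, paletteCount, ← Ne, Finset.card_ne_zero] at hR
    obtain ⟨v, hv⟩ := hR.2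
    exact Finset.mem_image.2 ⟨v, Finset.mem_univ v, (Finset.mem_filter.1 hv).2⟩
  have hdouble := Finset.sum_card_bipartiteAbove_eq_sum_card_bipartiteBelow
    (s := C.powersetCard s) (t := Z) fun T R => (T \ R).card = 1
  have hupper : ∑ T ∈ C.powersetCard s,
      (Finset.bipartiteAbove (fun T R : Finset ℕ => (T \ R).card = 1) Z T).card ≤
      C.card.choose s * (C.card - s) := by
    rw [← Finset.card_powersetCard, ← smul_eq_mul]
    apply Finset.sum_le_card_nsmul
    intro T hT
    rw [Finset.mem_powersetCard] at hT
    convert hcon T hT.1 hT.2 using 2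
    ext R
    rw [Finset.mem_bipartiteAbove, unusedNeighbors, hZ, hT.2, Finset.mem_filter,
      Finset.mem_filter]
    tauto
  have hlower : Z.card * (s * (C.card - s)) ≤
      ∑ R ∈ Z, (Finset.bipartiteBelow (fun T R : Finset ℕ => (T \ R).card = 1)
        (C.powersetCard s) R).card := by
    rw [← smul_eq_mul]
    apply Finset.card_nsmul_le_sum
    intro R hR
    rw [hZ, Finset.mem_filter, Finset.mem_powersetCard] at hR
    have := card_mul_card_sub_le_card_neighbors hR.1.1
    rw [hR.1.2] at this
    exact this
  have hle : Z.card * s ≤ C.card.choose s := by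
    have h1 : Z.card * s * (C.card - s) ≤ C.card.choose s * (C.card - s) := by
      rw [mul_assoc]
      exact hlower.trans (hdouble ▸ hupper)
    exact Nat.le_of_mul_le_mul_right h1 (by omega)
  obtain _ | s := s
  · simp at hn
  · have := Nat.mul_le_mul_right (s + 1) hcardZ
    simp only [Nat.add_sub_cancel] at hn
    nlinarith

/-- A proper edge coloring can be changed so that every palette occurs at most twice. -/
theorem ProperOn.exists_balanced (h : ProperOn G C φ) (hdeg : ∀ v, G.degree v < C.card)
    (hn : ∀ v, Fintype.card V * G.degree v <
      C.card.choose (G.degree v) * (G.degree v - 1)) :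
    ∃ φ', ProperOn G C φ' ∧ ∀ R, paletteCount G φ' R ≤ 2 := by
  induction hE : paletteExcess G C φ using Nat.strong_induction_on generalizing φ with
  | _ E ih =>
    by_cases hbal : ∀ R, paletteCount G φ R ≤ 2
    · exact ⟨φ, h, hbal⟩
    push Not at hbal
    obtain ⟨S, hS⟩ := hbal
    obtain ⟨v, hv⟩ := Finset.card_pos.1 (show 0 < paletteCount G φ S by omega)
    have hvS : palette G φ v = S := (Finset.mem_filter.1 hv).2
    have hSC : S ⊆ C := hvS ▸ h.palette_subset v
    have hScard : S.card = G.degree v := hvS ▸ h.card_palette v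
    obtain ⟨T, hTC, hTcard, hT⟩ := exists_many_unusedNeighbors (G := G) (φ := φ) (hdeg v) (hn v)
    have hle : (S \ T).card ≤ C.card - G.degree v := by
      rw [← hTcard, ← Finset.card_sdiff_of_subset hTC]
      exact Finset.card_le_card (Finset.sdiff_subset_sdiff hSC le_rfl)
    obtain ⟨φ', hφ', hlt⟩ := ProperOn.exists_excess_lt_of_walk _ h hSC hTC
      (hScard.trans hTcard.symm) hS rfl (hle.trans_lt hT)
    exact ih _ (hE ▸ hlt) hφ' rfl

end Walking

section Assembly

open scoped Classical

theorem two_pow_le_choose {d : ℕ} (hd : 8 ≤ d) : 2 ^ d ≤ (2 * d - 3).choose d := by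
  induction d, hd using Nat.le_induction with
  | base => decide
  | succ d hd ih =>
    obtain ⟨m, rfl⟩ : ∃ m, d = m + 2 := ⟨d - 2, by omega⟩
    rw [show 2 * (m + 2) - 3 = 2 * m + 1 by omega] at ih
    rw [show 2 * (m + 2 + 1) - 3 = 2 * m + 3 by omega, pow_succ]
    have h1 : (2 * m + 3).choose (m + 2 + 1) = (2 * m + 2).choose (m + 2) +
        (2 * m + 2).choose (m + 2 + 1) := Nat.choose_succ_succ' _ _
    have h2 : (2 * m + 2).choose (m + 2) = (2 * m + 1).choose (m + 1) +
        (2 * m + 1).choose (m + 2) := Nat.choose_succ_succ' _ _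
    have h3 : (2 * m + 2).choose (m + 2 + 1) = (2 * m + 1).choose (m + 2) +
        (2 * m + 1).choose (m + 2 + 1) := Nat.choose_succ_succ' _ _
    omega

theorem mul_lt_choose_mul {n k d s : ℕ} (hn : 0 < n) (hk : n ≤ k.choose d) (hd : 8 ≤ d)
    (hdk : d < k) (hkd : k ≤ 2 * d - 3) (hs : s = d - 1 ∨ s = d - 2) :
    n * s < k.choose s * (s - 1) := by
  obtain ⟨e, rfl⟩ : ∃ e, d = e + 2 := ⟨d - 2, by omega⟩
  have h1 := Nat.choose_succ_right_eq k (e + 1)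
  have h2 := Nat.choose_succ_right_eq k e
  have h3 : k.choose (e + 2) * (e + 2) ≤ k.choose (e + 1) * e := by
    rw [h1]
    exact Nat.mul_le_mul_left _ (by omega)
  have h4 : k.choose (e + 1) ≤ k.choose e := by
    refine Nat.le_of_mul_le_mul_right (c := e + 1) ?_ (by omega)
    rw [h2]
    exact Nat.mul_le_mul_left _ (by omega)
  have h5 : n * (e + 2) ≤ k.choose (e + 1) * e := (Nat.mul_le_mul_right _ hk).trans h3
  rcases hs with hs | hs
  · rw [hs, show e + 2 - 1 = e + 1 by omega, show e + 1 - 1 = e by omega]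
    refine lt_of_lt_of_le ?_ h5
    exact Nat.mul_lt_mul_of_pos_left (by omega) hn
  · obtain ⟨f, rfl⟩ : ∃ f, e = f + 1 := ⟨e - 1, by omega⟩
    rw [hs, show f + 1 + 2 - 2 = f + 1 by omega, show f + 1 - 1 = f by omega]
    have h6 : n * (f + 3) * f ≤ k.choose (f + 1) * f * (f + 1) := by
      calc n * (f + 3) * f ≤ k.choose (f + 1 + 1) * (f + 1) * f := Nat.mul_le_mul_right _ h5
        _ ≤ k.choose (f + 1) * (f + 1) * f := by gcongr
        _ = k.choose (f + 1) * f * (f + 1) := by ring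
    have h7 : n * (f + 1) * (f + 1) < n * (f + 3) * f := by
      have hf : 5 ≤ f := by omega
      nlinarith
    exact Nat.lt_of_mul_lt_mul_right (h7.trans_le h6)

variable {V : Type*} [Fintype V] {G : SimpleGraph V}

theorem degree_add_degree_of_partition {H G' : SimpleGraph V} (hH : H ≤ G)
    (hG' : ∀ u v, G'.Adj u v ↔ G.Adj u v ∧ ¬ H.Adj u v) (v : V) :
    G'.degree v + H.degree v = G.degree v := by
  rw [← SimpleGraph.card_neighborFinset_eq_degree, ← SimpleGraph.card_neighborFinset_eq_degree,
    ← SimpleGraph.card_neighborFinset_eq_degree, ← Finset.card_union_of_disjoint]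
  · congr 1
    ext w
    simp only [Finset.mem_union, SimpleGraph.mem_neighborFinset, hG']
    have := @hH v w
    tauto
  · rw [Finset.disjoint_left]
    intro w hw hw'
    rw [SimpleGraph.mem_neighborFinset] at hw hw'
    exact ((hG' _ _).1 hw).2 hw'

theorem exists_isVDEC_of_regular {d k : ℕ} (hG : ∀ v, G.degree v = d) (hd : 8 ≤ d)
    (hn : 0 < Fintype.card V) (hk : Fintype.card V ≤ k.choose d) (hdk : d < k)
    (hkd : k ≤ 2 * d - 3) : ∃ φ, IsVDEC G (k + 3) φ := by
  obtain ⟨H, hHG, hH, hleaf⟩ := exists_isPathFactor (by omega) hG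
  obtain ⟨G', hG'eq⟩ : ∃ G' : SimpleGraph V, G' = G \ H := ⟨_, rfl⟩
  have hG' : ∀ u v, G'.Adj u v ↔ G.Adj u v ∧ ¬ H.Adj u v := by
    intro u v
    rw [hG'eq, SimpleGraph.sdiff_adj]
  have hdegree : ∀ v, G'.degree v + H.degree v = d := fun v => by
    rw [degree_add_degree_of_partition hHG hG', hG]
  have hcardC : (Finset.Icc 1 k).card = k := by simp
  have hdeg : ∀ v, G'.degree v < (Finset.Icc 1 k).card := by
    intro v
    have := hdegree v
    omega
  obtain ⟨φ₀, hφ₀⟩ := exists_properOn_of_degree_lt G' hdeg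
  obtain ⟨φ, hφ, hbal⟩ := hφ₀.exists_balanced hdeg (by
    intro v
    have h1 := hdegree v
    have h2 := hH.one_le v
    have h3 := hH.le_two v
    rw [hcardC]
    exact mul_lt_choose_mul hn hk hd hdk hkd (by omega))
  obtain ⟨ψ, hψ, hsep⟩ := exists_properOn_separating
    (f := Set.rangeFactorization (palette G' φ)) hH hleaf (by
      rintro ⟨R, hR⟩
      refine le_trans (le_of_eq ?_) (hbal R)
      rw [paletteCount]
      congr 1
      ext v
      simp [Set.rangeFactorization, Subtype.ext_iff])
    (C := Finset.Icc (k + 1) (k + 3)) (by simp)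
  obtain ⟨χ, hχ⟩ : ∃ χ : Sym2 V → ℕ, ∀ e, χ e = if e ∈ H.edgeSet then ψ e else φ e :=
    ⟨_, fun _ => rfl⟩
  have hχH : ∀ {u v}, H.Adj u v → χ s(u, v) = ψ s(u, v) ∧ k + 1 ≤ χ s(u, v) ∧
      χ s(u, v) ≤ k + 3 := by
    intro u v huv
    have h1 := Finset.mem_Icc.1 (hψ.mem huv)
    rw [hχ, if_pos (H.mem_edgeSet.2 huv)]
    exact ⟨rfl, h1⟩
  have hχG' : ∀ {u v}, G'.Adj u v → χ s(u, v) = φ s(u, v) ∧ 1 ≤ χ s(u, v) ∧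
      χ s(u, v) ≤ k := by
    intro u v huv
    have h1 := Finset.mem_Icc.1 (hφ.mem huv)
    rw [hχ, if_neg fun h => ((hG' u v).1 huv).2 (H.mem_edgeSet.1 h)]
    exact ⟨rfl, h1⟩
  have hor : ∀ {u v}, G.Adj u v → H.Adj u v ∨ G'.Adj u v := by
    intro u v huv
    rw [hG']
    tauto
  have hproper : ∀ {u v w}, G.Adj u v → G.Adj u w → χ s(u, v) = χ s(u, w) → v = w := by
    intro u v w huv huw heq
    rcases hor huv with h1 | h1 <;> rcases hor huw with h2 | h2
    · rw [(hχH h1).1, (hχH h2).1] at heq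
      exact hψ.eq h1 h2 heq
    · have := hχH h1
      have := hχG' h2
      omega
    · have := hχG' h1
      have := hχH h2
      omega
    · rw [(hχG' h1).1, (hχG' h2).1] at heq
      exact hφ.eq h1 h2 heq
  have hset : ∀ v c, c ∈ colorSet G χ v ↔ ∃ w, G.Adj v w ∧ χ s(v, w) = c := by
    intro v c
    constructor
    · rintro ⟨e, he, hve, rfl⟩
      obtain ⟨w, rfl⟩ := Sym2.mem_iff_exists.1 hve
      exact ⟨w, he, rfl⟩
    · rintro ⟨w, hw, rfl⟩
      exact ⟨s(v, w), hw, Sym2.mem_mk_left v w, rfl⟩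
  have hlow : ∀ v c, c ∈ palette G' φ v ↔ c ∈ colorSet G χ v ∧ c ≤ k := by
    intro v c
    rw [hset, mem_palette]
    constructor
    · rintro ⟨w, hw, rfl⟩
      have := hχG' hw
      exact ⟨⟨w, ((hG' v w).1 hw).1, this.1⟩, this.1 ▸ this.2.2⟩
    · rintro ⟨⟨w, hw, rfl⟩, hck⟩
      rcases hor hw with h | h
      · have := hχH h
        omega
      · exact ⟨w, h, (hχG' h).1.symm⟩
  have hhigh : ∀ v c, c ∈ palette H ψ v ↔ c ∈ colorSet G χ v ∧ k < c := by
    intro v c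
    rw [hset, mem_palette]
    constructor
    · rintro ⟨w, hw, rfl⟩
      have := hχH hw
      exact ⟨⟨w, hHG hw, this.1⟩, by omega⟩
    · rintro ⟨⟨w, hw, rfl⟩, hck⟩
      rcases hor hw with h | h
      · exact ⟨w, h, (hχH h).1.symm⟩
      · have := hχG' h
        omega
  refine ⟨χ, ⟨?_, ?_⟩, ?_⟩
  · intro e he
    induction e with
    | _ u v =>
      rw [Finset.mem_Icc]
      rcases hor (G.mem_edgeSet.1 he) with h | h
      · have := hχH h
        omega
      · have := hχG' h
        omega
  · rintro e₁ he₁ e₂ he₂ hne ⟨v, hv₁, hv₂⟩ heq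
    obtain ⟨x, rfl⟩ := Sym2.mem_iff_exists.1 hv₁
    obtain ⟨y, rfl⟩ := Sym2.mem_iff_exists.1 hv₂
    exact hne (congrArg (fun z => s(v, z)) (hproper he₁ he₂ heq))
  · intro u v huv heq
    have h1 : palette G' φ u = palette G' φ v := by
      ext c
      rw [hlow, hlow, heq]
    have h2 : palette H ψ u = palette H ψ v := by
      ext c
      rw [hhigh, hhigh, heq]
    refine huv (hsep u v (Subtype.ext h1) ?_ h2)
    rw [← hψ.card_palette, ← hψ.card_palette, h2]

end Assembly

/-- For a `d`-regular graph `G` on `n` vertices with `d ≥ log₂ n ≥ 8`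
(i.e. `2^d ≥ n` and `n ≥ 2^8`), `χ'_vd(G) ≤ k(G) + 3`. -/
theorem vdIndex_le_paramK_add_three_of_regular {V : Type*} [Fintype V]
    (G : SimpleGraph V) [DecidableRel G.Adj] (d : ℕ)
    (hreg : G.IsRegularOfDegree d)
    (hd : Fintype.card V ≤ 2 ^ d) (hn : 2 ^ 8 ≤ Fintype.card V) :
    vdIndex G ≤ paramK G + 3 := by
  have hd8 : 8 ≤ d := (Nat.pow_le_pow_iff_right one_lt_two).1 (hn.trans hd)
  have hmem : Fintype.card V ≤ (2 * d - 3).choose d := hd.trans (two_pow_le_choose hd8)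
  have hcount : ∀ e, (Finset.univ.filter fun v => G.degree v = e).card =
      if d = e then Fintype.card V else 0 := by
    intro e
    simp only [hreg.degree_eq]
    split_ifs with h <;> simp [h]
  have hset : 2 * d - 3 ∈ {k | ∀ e : ℕ, G.minDegree ≤ e → e ≤ G.maxDegree →
      (Finset.univ.filter (fun v => G.degree v = e)).card ≤ k.choose e} := by
    intro e _ _
    rw [hcount]
    split_ifs with h
    · exact h ▸ hmem
    · exact Nat.zero_le _
  have hkd : paramK G ≤ 2 * d - 3 := Nat.sInf_le hset
  obtain ⟨v⟩ : Nonempty V := Fintype.card_pos_iff.1 (by omega)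
  have hk : Fintype.card V ≤ (paramK G).choose d := by
    have h := Nat.sInf_mem ⟨_, hset⟩ d
      (hreg.degree_eq v ▸ G.minDegree_le_degree v) (hreg.degree_eq v ▸ G.degree_le_maxDegree v)
    rw [hcount, if_pos rfl] at h
    exact h
  have hdk : d < paramK G := by
    by_contra! hle
    have h1 : (paramK G).choose d ≤ 1 := by
      rcases hle.lt_or_eq with h | h
      · rw [Nat.choose_eq_zero_of_lt h]
        exact Nat.zero_le 1
      · rw [h, Nat.choose_self]
    omega
  refine Nat.sInf_le (exists_isVDEC_of_regular (d := d) (fun v => ?_) hd8 (by omega) hk hdk hkd)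
  rw [← hreg.degree_eq v]
  congr!
end
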